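/- Let c₁, c₂ > 0. Then there exists a biholomorphism from Ω_{c₁} onto Ω_{c₂} if and only if there exists an integer n ∈ ℤ such that c₁ = c₂·dⁿ (equivalently, c₁ = c₂·d^{±n} for some n ≥ 0). -/

import Mathlib

open Filter Topology Set

noncomputable section

/-- `f : U → V` and `g : V → U` are mutually inverse holomorphic maps, i.e.
`f` is a biholomorphism from `U` onto `V` with inverse `g`. -/
def IsBiholoOn (f g : ℂ × ℂ → ℂ × ℂ) (U V : Set (ℂ × ℂ)) : Prop :=
  DifferentiableOn ℂ f U ∧ DifferentiableOn ℂ g V ∧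
    Set.MapsTo f U V ∧ Set.MapsTo g V U ∧
    (∀ z ∈ U, g (f z) = z) ∧ (∀ w ∈ V, f (g w) = w)

/-- Data of a Hénon map together with its Green function. -/
structure HD where
  d : ℕ
  hd : 2 ≤ d
  a : ℂ
  ha : a ≠ 0
  p : Polynomial ℂ
  hpm : p.Monic
  hpd : p.natDegree = d

namespace HD

variable (D : HD)

/-- the Hénon map -/
def H (z : ℂ × ℂ) : ℂ × ℂ := (z.2, D.p.eval z.2 - D.a * z.1)

/-- its inverse -/
def Hi (z : ℂ × ℂ) : ℂ × ℂ := ((D.p.eval z.1 - z.2) / D.a, z.1)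

lemma H_Hi (z : ℂ × ℂ) : D.H (D.Hi z) = z := by
  have := D.ha
  ext <;> simp [H, Hi] <;> field_simp <;> ring

lemma Hi_H (z : ℂ × ℂ) : D.Hi (D.H z) = z := by
  have := D.ha
  ext <;> simp [H, Hi] <;> field_simp

lemma differentiable_H : Differentiable ℂ D.H := by
  unfold H
  have := D.p.differentiable
  fun_prop

lemma differentiable_Hi : Differentiable ℂ D.Hi := by
  unfold Hi
  have := D.p.differentiable
  fun_prop

lemma H_Hi_iter (n : ℕ) (z : ℂ × ℂ) : D.H^[n] (D.Hi^[n] z) = z :=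
  Function.LeftInverse.iterate D.H_Hi n z

lemma Hi_H_iter (n : ℕ) (z : ℂ × ℂ) : D.Hi^[n] (D.H^[n] z) = z :=
  Function.LeftInverse.iterate D.Hi_H n z

lemma d_pos : 0 < D.d := by have := D.hd; omega

lemma d_ne : (D.d : ℂ) ≠ 0 := by exact_mod_cast D.d_pos.ne'

lemma two_le_d : (2 : ℝ) ≤ D.d := by exact_mod_cast D.hd

/-- constant -/
def C : ℝ := ∑ i ∈ Finset.range D.d, ‖D.p.coeff i‖ + ‖D.a‖

lemma C_pos : 0 < D.C := by
  have h1 : 0 < ‖D.a‖ := norm_pos_iff.mpr D.ha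
  have h2 : 0 ≤ ∑ i ∈ Finset.range D.d, ‖D.p.coeff i‖ := Finset.sum_nonneg (fun _ _ => norm_nonneg _)
  unfold C; linarith

/-- radius -/
def R : ℝ := 4 * D.C + 4

lemma R_pos : 4 < D.R := by have := D.C_pos; unfold R; linarith

lemma eval_sub_pow_le (y : ℂ) (hy : 1 ≤ ‖y‖) :
    ‖D.p.eval y - y ^ D.d‖ ≤ (∑ i ∈ Finset.range D.d, ‖D.p.coeff i‖) * ‖y‖ ^ (D.d - 1) := by
  rw [Polynomial.eval_eq_sum_range, D.hpd, Finset.sum_range_succ]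
  have : D.p.coeff D.d = 1 := by rw [← D.hpd]; exact D.hpm
  rw [this, one_mul, add_sub_cancel_right, Finset.sum_mul]
  refine (norm_sum_le _ _).trans (Finset.sum_le_sum fun i hi => ?_)
  rw [norm_mul, norm_pow]
  have : i ≤ D.d - 1 := by have := Finset.mem_range.mp hi; omega
  gcongr

/-- escape region -/
def V : Set (ℂ × ℂ) := {q | ‖q.1‖ < ‖q.2‖ ∧ D.R < ‖q.2‖}

lemma isOpen_V : IsOpen D.V := by
  exact IsOpen.inter (isOpen_lt continuous_fst.norm continuous_snd.norm)
    (isOpen_lt continuous_const continuous_snd.norm)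

/-- relative error -/
def eps (q : ℂ × ℂ) : ℂ := (D.H q).2 / q.2 ^ D.d - 1

variable {D}

lemma V_ne {q : ℂ × ℂ} (hq : q ∈ D.V) : q.2 ≠ 0 := by
  have := D.R_pos
  have := hq.2
  intro h; rw [h] at this; simp at this; linarith

lemma eps_le {q : ℂ × ℂ} (hq : q ∈ D.V) : ‖D.eps q‖ ≤ D.C / ‖q.2‖ := by
  have hR := D.R_pos
  have h1 : 1 ≤ ‖q.2‖ := by have := hq.2; linarith
  have hy := V_ne hq
  have e : D.eps q = ((D.p.eval q.2 - q.2 ^ D.d) - D.a * q.1) / q.2 ^ D.d := by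
    unfold eps H; field_simp; ring
  rw [e, norm_div, norm_pow, div_le_div_iff₀ (by positivity) (by positivity)]
  have h2 := D.eval_sub_pow_le q.2 h1
  have h3 : ‖D.a * q.1‖ ≤ ‖D.a‖ * ‖q.2‖ ^ (D.d - 1) := by
    rw [norm_mul]
    have : ‖q.2‖ ≤ ‖q.2‖ ^ (D.d - 1) := le_self_pow₀ h1 (by have := D.hd; omega)
    have := hq.1.le
    gcongr; linarith
  have h4 := norm_sub_le (D.p.eval q.2 - q.2 ^ D.d) (D.a * q.1)
  have h5 : ‖q.2‖ ^ D.d = ‖q.2‖ ^ (D.d - 1) * ‖q.2‖ := by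
    rw [← pow_succ]; congr 1; have := D.hd; omega
  rw [h5, ← mul_assoc]
  gcongr
  unfold C; linarith

lemma eps_le' {q : ℂ × ℂ} (hq : q ∈ D.V) : ‖D.eps q‖ ≤ 1 / 4 := by
  refine (eps_le hq).trans ?_
  have hR := D.R_pos
  have := hq.2
  have h0 := D.C_pos
  rw [div_le_div_iff₀ (by linarith) (by norm_num)]
  unfold R at this; linarith

lemma H_snd {q : ℂ × ℂ} (hq : q ∈ D.V) : (D.H q).2 = q.2 ^ D.d * (1 + D.eps q) := by
  have hy := V_ne hq
  unfold eps; field_simp; ring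

lemma two_mul_le {q : ℂ × ℂ} (hq : q ∈ D.V) : 2 * ‖q.2‖ ≤ ‖(D.H q).2‖ := by
  rw [H_snd hq, norm_mul, norm_pow]
  have h1 := eps_le' hq
  have h2 : 3 / 4 ≤ ‖1 + D.eps q‖ := by
    have := norm_sub_norm_le (1 : ℂ) (- D.eps q)
    rw [norm_neg, sub_neg_eq_add, norm_one] at this; linarith
  have hR := D.R_pos
  have h4 : 4 < ‖q.2‖ := by have := hq.2; linarith
  have h3 : ‖q.2‖ ^ 2 ≤ ‖q.2‖ ^ D.d := pow_le_pow_right₀ (by linarith) D.hd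
  nlinarith

lemma H_mem_V {q : ℂ × ℂ} (hq : q ∈ D.V) : D.H q ∈ D.V := by
  have h := two_mul_le hq
  have hR := D.R_pos
  have h4 := hq.2
  refine ⟨?_, by linarith⟩
  show ‖q.2‖ < _
  linarith

lemma iter_mem_V {q : ℂ × ℂ} (hq : q ∈ D.V) (n : ℕ) : D.H^[n] q ∈ D.V := by
  induction n with
  | zero => exact hq
  | succ n ih => rw [Function.iterate_succ_apply']; exact H_mem_V ih

lemma iter_growth {q : ℂ × ℂ} (hq : q ∈ D.V) (n : ℕ) : 2 ^ n * ‖q.2‖ ≤ ‖(D.H^[n] q).2‖ := by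
  induction n with
  | zero => simp
  | succ n ih =>
    rw [Function.iterate_succ_apply']
    have := two_mul_le (iter_mem_V hq n)
    rw [pow_succ]; linarith

variable (D) in
/-- the correction series -/
def gs (q : ℂ × ℂ) : ℂ := ∑' n : ℕ, Complex.log (1 + D.eps (D.H^[n] q)) / (D.d : ℂ) ^ (n + 1)

variable (D) in
/-- the Böttcher function -/
def phi (q : ℂ × ℂ) : ℂ := q.2 * Complex.exp (D.gs q)

lemma log_le {q : ℂ × ℂ} (hq : q ∈ D.V) :
    ‖Complex.log (1 + D.eps q)‖ ≤ 2 * D.C / ‖q.2‖ := by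
  refine (Complex.norm_log_one_add_half_le_self (by have := eps_le' hq; linarith)).trans ?_
  have := eps_le hq
  have h0 : 0 ≤ ‖D.eps q‖ := norm_nonneg _
  rw [mul_div_assoc]; linarith

lemma term_le {q : ℂ × ℂ} (hq : q ∈ D.V) (n : ℕ) :
    ‖Complex.log (1 + D.eps (D.H^[n] q)) / (D.d : ℂ) ^ (n + 1)‖ ≤
      2 * D.C / ‖q.2‖ * (1 / 2 / 2 ^ n) := by
  rw [norm_div, norm_pow, Complex.norm_natCast]
  have h1 := log_le (iter_mem_V hq n)
  have h2 := iter_growth hq n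
  have h3 : 0 < ‖q.2‖ := norm_pos_iff.mpr (V_ne hq)
  have h4 : ‖q.2‖ ≤ ‖(D.H^[n] q).2‖ := by
    have : (1 : ℝ) ≤ 2 ^ n := one_le_pow₀ (by norm_num)
    nlinarith
  have h5 : 2 * D.C / ‖(D.H^[n] q).2‖ ≤ 2 * D.C / ‖q.2‖ := by
    have := D.C_pos
    gcongr
  have h6 : (2 : ℝ) ^ (n + 1) ≤ (D.d : ℝ) ^ (n + 1) := by have := D.two_le_d; gcongr
  have h7 : (1 : ℝ) / 2 / 2 ^ n = 1 / 2 ^ (n + 1) := by rw [pow_succ]; field_simp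
  rw [h7, ← div_eq_mul_one_div]
  have := D.C_pos
  gcongr
  exact h1.trans h5

lemma summable_gs {q : ℂ × ℂ} (hq : q ∈ D.V) :
    Summable (fun n : ℕ => Complex.log (1 + D.eps (D.H^[n] q)) / (D.d : ℂ) ^ (n + 1)) :=
  Summable.of_norm_bounded ((summable_geometric_two' 1).mul_left _) (term_le hq)

lemma gs_le {q : ℂ × ℂ} (hq : q ∈ D.V) : ‖D.gs q‖ ≤ 2 * D.C / ‖q.2‖ := by
  have h := tsum_of_norm_bounded ((hasSum_geometric_two' 1).mul_left (2 * D.C / ‖q.2‖)) (term_le hq)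
  simpa [gs] using h

lemma gs_le' {q : ℂ × ℂ} (hq : q ∈ D.V) : ‖D.gs q‖ ≤ 1 / 2 := by
  refine (gs_le hq).trans ?_
  have hR := D.R_pos
  have := hq.2
  have h0 := D.C_pos
  rw [div_le_div_iff₀ (by linarith) (by norm_num)]
  unfold R at this; linarith

lemma gs_H {q : ℂ × ℂ} (hq : q ∈ D.V) :
    (D.d : ℂ) * D.gs q = Complex.log (1 + D.eps q) + D.gs (D.H q) := by
  unfold gs
  rw [(summable_gs hq).tsum_eq_zero_add, mul_add, ← tsum_mul_left]
  have := D.d_ne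
  congr 1
  · simp; field_simp
  · congr 1; ext n
    rw [Function.iterate_succ_apply]
    field_simp
    ring

lemma one_add_eps_ne {q : ℂ × ℂ} (hq : q ∈ D.V) : 1 + D.eps q ≠ 0 := by
  intro h
  have h1 := eps_le' hq
  have : D.eps q = -1 := by linear_combination h
  rw [this] at h1; norm_num at h1

lemma phi_H {q : ℂ × ℂ} (hq : q ∈ D.V) : D.phi (D.H q) = D.phi q ^ D.d := by
  unfold phi
  rw [mul_pow, ← Complex.exp_nat_mul, gs_H hq, Complex.exp_add, Complex.exp_log (one_add_eps_ne hq),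
    H_snd hq]
  ring

lemma phi_iter {q : ℂ × ℂ} (hq : q ∈ D.V) (n : ℕ) : D.phi (D.H^[n] q) = D.phi q ^ (D.d ^ n) := by
  induction n with
  | zero => simp
  | succ n ih =>
    rw [Function.iterate_succ_apply', phi_H (iter_mem_V hq n), ih, ← pow_mul, pow_succ]

lemma phi_ne {q : ℂ × ℂ} (hq : q ∈ D.V) : D.phi q ≠ 0 :=
  mul_ne_zero (V_ne hq) (Complex.exp_ne_zero _)

lemma phi_near {q : ℂ × ℂ} (hq : q ∈ D.V) : ‖q.2 - D.phi q‖ ≤ 4 * D.C := by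
  have e : q.2 - D.phi q = - (q.2 * (Complex.exp (D.gs q) - 1)) := by unfold phi; ring
  rw [e, norm_neg, norm_mul]
  have h1 := Complex.norm_exp_sub_one_le (x := D.gs q) (by have := gs_le' hq; linarith)
  have h2 := gs_le hq
  have h3 : 0 < ‖q.2‖ := norm_pos_iff.mpr (V_ne hq)
  calc ‖q.2‖ * ‖Complex.exp (D.gs q) - 1‖ ≤ ‖q.2‖ * (2 * (2 * D.C / ‖q.2‖)) := by gcongr; linarith
    _ = 4 * D.C := by field_simp; ring

lemma differentiable_iter (n : ℕ) : Differentiable ℂ (D.H^[n]) := D.differentiable_H.iterate n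
lemma differentiable_iteri (n : ℕ) : Differentiable ℂ (D.Hi^[n]) := D.differentiable_Hi.iterate n

lemma differentiableOn_gs {c : ℂ → ℂ × ℂ} {S : Set ℂ} (hS : IsOpen S) (hc : DifferentiableOn ℂ c S)
    (hm : MapsTo c S D.V) : DifferentiableOn ℂ (fun t => D.gs (c t)) S := by
  unfold gs
  refine Complex.differentiableOn_tsum_of_summable_norm
    (u := fun n => 2 * D.C / D.R * (1 / 2 / 2 ^ n)) ((summable_geometric_two' 1).mul_left _) ?_ hS ?_
  · intro n
    have h1 : DifferentiableOn ℂ (fun t => D.H^[n] (c t)) S :=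
      (differentiable_iter n).comp_differentiableOn hc
    refine DifferentiableOn.div_const ?_ _
    have h2 : DifferentiableOn ℂ (fun t => D.eps (D.H^[n] (c t))) S := by
      unfold eps
      refine DifferentiableOn.sub_const ?_ _
      refine DifferentiableOn.div ?_ ?_ ?_
      · have := D.differentiable_H.comp_differentiableOn h1
        exact this.snd
      · exact h1.snd.pow _
      · intro t ht
        exact pow_ne_zero _ (V_ne (iter_mem_V (hm ht) n))
    refine DifferentiableOn.clog (h2.const_add 1) ?_
    intro t ht
    have := eps_le' (iter_mem_V (hm ht) n)
    exact Complex.mem_slitPlane_of_norm_lt_one (by linarith)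
  · intro n t ht
    refine (term_le (hm ht) n).trans ?_
    have := D.C_pos
    have := D.R_pos
    have := (hm ht).2
    have : 0 < D.R := by linarith
    gcongr

lemma differentiableOn_phi {c : ℂ → ℂ × ℂ} {S : Set ℂ} (hS : IsOpen S) (hc : DifferentiableOn ℂ c S)
    (hm : MapsTo c S D.V) : DifferentiableOn ℂ (fun t => D.phi (c t)) S := by
  unfold phi
  exact hc.snd.mul (differentiableOn_gs hS hc hm).cexp

variable (D) in
/-- the leaf with parameter `w` -/
def L (w : ℂ) : Set (ℂ × ℂ) :=
  {q | ∃ n : ℕ, D.H^[n] q ∈ D.V ∧ D.phi (D.H^[n] q) = Complex.exp ((D.d : ℂ) ^ n * w)}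

lemma L_step {q : ℂ × ℂ} {w : ℂ} {n : ℕ}
    (h : D.H^[n] q ∈ D.V ∧ D.phi (D.H^[n] q) = Complex.exp ((D.d : ℂ) ^ n * w)) {m : ℕ} (hm : n ≤ m) :
    D.H^[m] q ∈ D.V ∧ D.phi (D.H^[m] q) = Complex.exp ((D.d : ℂ) ^ m * w) := by
  obtain ⟨k, rfl⟩ := Nat.exists_eq_add_of_le hm
  rw [add_comm, Function.iterate_add_apply]
  refine ⟨iter_mem_V h.1 k, ?_⟩
  rw [phi_iter h.1, h.2, ← Complex.exp_nat_mul]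
  congr 1; push_cast; ring

lemma L_eventually {q : ℂ × ℂ} {w : ℂ} (h : q ∈ D.L w) :
    ∀ᶠ n in atTop, D.H^[n] q ∈ D.V ∧ D.phi (D.H^[n] q) = Complex.exp ((D.d : ℂ) ^ n * w) := by
  obtain ⟨n, hn⟩ := h
  filter_upwards [eventually_ge_atTop n] with m hm using L_step hn hm

lemma L_iter {q : ℂ × ℂ} {w : ℂ} (n : ℕ) : D.H^[n] q ∈ D.L ((D.d : ℂ) ^ n * w) ↔ q ∈ D.L w := by
  constructor
  · rintro ⟨m, hm⟩
    refine ⟨m + n, ?_⟩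
    rw [Function.iterate_add_apply]
    refine ⟨hm.1, hm.2.trans ?_⟩
    congr 1; ring
  · intro h
    obtain ⟨m, hm, hmn⟩ := ((L_eventually h).and (eventually_ge_atTop n)).exists
    obtain ⟨k, rfl⟩ := Nat.exists_eq_add_of_le hmn
    refine ⟨k, ?_⟩
    rw [← Function.iterate_add_apply, add_comm]
    refine ⟨hm.1, hm.2.trans ?_⟩
    congr 1; ring

lemma L_shift {w : ℂ} (k : ℤ) (n : ℕ) :
    D.L (w + 2 * Real.pi * Complex.I * k / (D.d : ℂ) ^ n) = D.L w := by
  have key : ∀ (w : ℂ) (k : ℤ), D.L w ⊆ D.L (w + 2 * Real.pi * Complex.I * k / (D.d : ℂ) ^ n) := by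
    intro w k q h
    obtain ⟨m, hm, hmn⟩ := ((L_eventually h).and (eventually_ge_atTop n)).exists
    obtain ⟨l, rfl⟩ := Nat.exists_eq_add_of_le hmn
    refine ⟨n + l, hm.1, hm.2.trans ?_⟩
    rw [Complex.exp_eq_exp_iff_exists_int]
    refine ⟨- k * D.d ^ l, ?_⟩
    have := D.d_ne
    push_cast
    field_simp
    ring
  refine Subset.antisymm ?_ (key w k)
  have := key (w + 2 * Real.pi * Complex.I * k / (D.d : ℂ) ^ n) (-k)
  convert this using 2
  push_cast; ring

lemma L_inter {q : ℂ × ℂ} {w w' : ℂ} (h : q ∈ D.L w) (h' : q ∈ D.L w') :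
    ∃ (k : ℤ) (n : ℕ), w' = w + 2 * Real.pi * Complex.I * k / (D.d : ℂ) ^ n := by
  obtain ⟨n, h1, h2⟩ := ((L_eventually h).and (L_eventually h')).exists
  have := h2.2.symm.trans h1.2
  rw [Complex.exp_eq_exp_iff_exists_int] at this
  obtain ⟨k, hk⟩ := this
  refine ⟨k, n, ?_⟩
  have := D.d_ne
  field_simp
  linear_combination hk

lemma L_eq_of_mem {q : ℂ × ℂ} {w w' : ℂ} (h : q ∈ D.L w) (h' : q ∈ D.L w') : D.L w' = D.L w := by
  obtain ⟨k, n, rfl⟩ := L_inter h h'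
  exact L_shift k n

end HD

namespace HD

/-- the Green function -/
structure IsGreen (D : HD) (G : ℂ × ℂ → ℝ) : Prop where
  cont : Continuous G
  nonneg : ∀ z, 0 ≤ G z
  lim : ∀ z : ℂ × ℂ,
      Tendsto (fun n : ℕ => Real.log (max ‖D.H^[n] z‖ 1) / (D.d : ℝ) ^ n) atTop (𝓝 (G z))
  GH : ∀ z : ℂ × ℂ, G (D.H z) = D.d * G z

variable {D : HD} {G : ℂ × ℂ → ℝ}

lemma phi_norm {q : ℂ × ℂ} (hq : q ∈ D.V) : 1 < ‖D.phi q‖ := by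
  have h1 := phi_near hq
  have h2 := norm_sub_norm_le q.2 (D.phi q)
  have h3 := hq.2
  unfold R at h3; linarith

lemma dpow_pos (n : ℕ) : (0 : ℝ) < (D.d : ℝ) ^ n := by
  have := D.two_le_d
  positivity

lemma tendsto_dpow : Tendsto (fun n : ℕ => (D.d : ℝ) ^ n) atTop atTop :=
  tendsto_pow_atTop_atTop_of_one_lt (by have := D.two_le_d; linarith)

lemma IsGreen.iter (hG : IsGreen D G) (n : ℕ) (q : ℂ × ℂ) : G (D.H^[n] q) = (D.d : ℝ) ^ n * G q := by
  induction n with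
  | zero => simp
  | succ n ih => rw [Function.iterate_succ_apply', hG.GH, ih]; ring

lemma IsGreen.G_V (hG : IsGreen D G) {q : ℂ × ℂ} (hq : q ∈ D.V) : G q = Real.log ‖D.phi q‖ := by
  refine tendsto_nhds_unique (hG.lim q) ?_
  have key : ∀ n : ℕ, Real.log (max ‖D.H^[n] q‖ 1) / (D.d : ℝ) ^ n =
      Real.log ‖D.phi q‖ - (D.gs (D.H^[n] q)).re / (D.d : ℝ) ^ n := by
    intro n
    have hn := iter_mem_V hq n
    have h0 := dpow_pos (D := D) n
    have e1 : max ‖D.H^[n] q‖ 1 = ‖(D.H^[n] q).2‖ := by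
      have hR := D.R_pos
      rw [Prod.norm_def, max_eq_right hn.1.le, max_eq_left]
      have := hn.2; linarith
    have e2 : ‖D.phi q‖ ^ (D.d ^ n) = ‖(D.H^[n] q).2‖ * Real.exp (D.gs (D.H^[n] q)).re := by
      rw [← norm_pow, ← phi_iter hq, phi, norm_mul, Complex.norm_exp]
    have e3 := congrArg Real.log e2
    rw [Real.log_pow, Real.log_mul (norm_ne_zero_iff.mpr (V_ne hn)) (Real.exp_ne_zero _), Real.log_exp] at e3
    push_cast at e3
    rw [e1]; field_simp; linarith
  simp_rw [key]
  conv => rhs; rw [← sub_zero (Real.log ‖D.phi q‖)]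
  refine tendsto_const_nhds.sub ?_
  refine squeeze_zero_norm (a := fun n : ℕ => (1 / 2) / (D.d : ℝ) ^ n) ?_ ?_
  · intro n
    have h0 := dpow_pos (D := D) n
    rw [norm_div, Real.norm_of_nonneg h0.le]
    gcongr
    exact (Complex.abs_re_le_norm _).trans (gs_le' (iter_mem_V hq n))
  · exact tendsto_dpow.const_div_atTop _

lemma IsGreen.G_L (hG : IsGreen D G) {q : ℂ × ℂ} {w : ℂ} (hq : q ∈ D.L w) : G q = w.re := by
  obtain ⟨n, h1, h2⟩ := hq
  have h3 := hG.G_V h1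
  rw [hG.iter, h2, Complex.norm_exp, Real.log_exp] at h3
  have h0 := dpow_pos (D := D) n
  have : ((D.d : ℂ) ^ n * w).re = (D.d : ℝ) ^ n * w.re := by
    rw [show (D.d : ℂ) ^ n = (((D.d : ℝ) ^ n : ℝ) : ℂ) by push_cast; rfl, Complex.re_ofReal_mul]
  rw [this] at h3
  exact mul_left_cancel₀ h0.ne' h3

lemma IsGreen.pos_V (hG : IsGreen D G) {q : ℂ × ℂ} (hq : q ∈ D.V) : 0 < G q := by
  rw [hG.G_V hq]; exact Real.log_pos (phi_norm hq)

lemma IsGreen.exists_V (hG : IsGreen D G) {q : ℂ × ℂ} (hq : 0 < G q) : ∃ n, D.H^[n] q ∈ D.V := by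
  by_contra! hcon
  have hb : ∀ n, ‖D.H^[n] q‖ ≤ max D.R ‖q‖ := by
    intro n
    induction n with
    | zero => simp
    | succ n ih =>
      by_cases h : ‖D.H^[n+1] q‖ ≤ D.R
      · exact h.trans (le_max_left _ _)
      · refine le_trans ?_ ih
        push Not at h
        have h1 := hcon (n+1)
        rw [Function.iterate_succ_apply'] at h1 h ⊢
        rw [Prod.norm_def] at h ⊢
        have : ‖(D.H (D.H^[n] q)).2‖ ≤ ‖(D.H (D.H^[n] q)).1‖ := by
          by_contra! h2
          rw [max_eq_right h2.le] at h
          exact h1 ⟨h2, h⟩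
        rw [max_eq_left this]
        exact norm_snd_le (D.H^[n] q)
  have : G q = 0 := by
    refine tendsto_nhds_unique (hG.lim q) ?_
    refine squeeze_zero_norm (a := fun n : ℕ => Real.log (max (max D.R ‖q‖) 1) / (D.d : ℝ) ^ n) ?_ ?_
    · intro n
      have h0 := dpow_pos (D := D) n
      rw [norm_div, Real.norm_of_nonneg h0.le, Real.norm_of_nonneg (Real.log_nonneg (le_max_right _ _))]
      have := hb n
      gcongr
    · exact tendsto_dpow.const_div_atTop _
  linarith

/-- local holomorphic lifts along curves -/
lemma IsGreen.lift (hG : IsGreen D G) {c : ℂ → ℂ × ℂ} {S : Set ℂ} (hS : IsOpen S)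
    (hc : DifferentiableOn ℂ c S) {t₀ : ℂ} (ht : t₀ ∈ S) (hpos : 0 < G (c t₀)) :
    ∃ F : ℂ → ℂ, ∃ ε > 0, Metric.ball t₀ ε ⊆ S ∧ DifferentiableOn ℂ F (Metric.ball t₀ ε) ∧
      ∀ t ∈ Metric.ball t₀ ε, c t ∈ D.L (F t) := by
  obtain ⟨n, hn⟩ := hG.exists_V hpos
  have hcn : DifferentiableOn ℂ (fun t => D.H^[n] (c t)) S :=
    (differentiable_iter n).comp_differentiableOn hc
  have hS1 : IsOpen (S ∩ (fun t => D.H^[n] (c t)) ⁻¹' D.V) :=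
    hcn.continuousOn.isOpen_inter_preimage hS D.isOpen_V
  set S1 := S ∩ (fun t => D.H^[n] (c t)) ⁻¹' D.V with hS1def
  have hphi : DifferentiableOn ℂ (fun t => D.phi (D.H^[n] (c t))) S1 :=
    differentiableOn_phi hS1 (hcn.mono inter_subset_left) (fun t ht => ht.2)
  set φ := fun t => D.phi (D.H^[n] (c t)) with hφ
  have ht1 : t₀ ∈ S1 := ⟨ht, hn⟩
  have hne : φ t₀ ≠ 0 := phi_ne hn
  have hcont : ContinuousAt (fun t => φ t / φ t₀) t₀ :=
    (hphi.continuousOn.continuousAt (hS1.mem_nhds ht1)).div_const _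
  have hsl : ∀ᶠ t in 𝓝 t₀, φ t / φ t₀ ∈ Complex.slitPlane := by
    refine hcont.eventually_mem (Complex.isOpen_slitPlane.mem_nhds ?_)
    simp [div_self hne]
  obtain ⟨ε, hε, hball⟩ := Metric.mem_nhds_iff.mp ((hS1.mem_nhds ht1 : S1 ∈ 𝓝 t₀) |> (inter_mem · hsl))
  refine ⟨fun t => (Complex.log (φ t / φ t₀) + Complex.log (φ t₀)) / (D.d : ℂ) ^ n, ε, hε,
    fun t h => (hball h).1.1, ?_, ?_⟩
  · refine DifferentiableOn.div_const (DifferentiableOn.add_const _ ?_) _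
    refine DifferentiableOn.clog ((hphi.mono fun t h => (hball h).1).div_const _) fun t h => (hball h).2
  · intro t h
    refine ⟨n, (hball h).1.2, ?_⟩
    have := D.d_ne
    rw [mul_div_cancel₀ _ (pow_ne_zero _ this), Complex.exp_add, Complex.exp_log, Complex.exp_log hne]
    · rw [div_mul_cancel₀ _ hne]
    · exact div_ne_zero (phi_ne (hball h).1.2) hne

lemma IsGreen.exists_L (hG : IsGreen D G) {q : ℂ × ℂ} (hpos : 0 < G q) : ∃ w, q ∈ D.L w := by
  obtain ⟨F, ε, hε, -, -, h⟩ := hG.lift (c := fun _ => q) (S := univ) isOpen_univ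
    (differentiableOn_const _) (mem_univ 0) hpos
  exact ⟨F 0, h 0 (Metric.mem_ball_self hε)⟩

lemma IsGreen.localmax (hG : IsGreen D G) {c : ℂ → ℂ × ℂ} {S : Set ℂ} (hS : IsOpen S)
    (hc : DifferentiableOn ℂ c S) {t₀ : ℂ} (ht : t₀ ∈ S) (hpos : 0 < G (c t₀))
    {v : ℂ → ℝ} {l : ℂ → ℂ} (hl : ∀ᶠ t in 𝓝 t₀, DifferentiableAt ℂ l t)
    (hv : ∀ᶠ t in 𝓝 t₀, v t = G (c t) + (l t).re) (hmax : IsLocalMax v t₀) :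
    ∀ᶠ t in 𝓝 t₀, v t = v t₀ := by
  obtain ⟨F, ε, hε, -, hF, h⟩ := hG.lift hS hc ht hpos
  have hb : ∀ᶠ t in 𝓝 t₀, t ∈ Metric.ball t₀ ε := Metric.ball_mem_nhds _ hε
  have hFd : ∀ᶠ t in 𝓝 t₀, DifferentiableAt ℂ F t := by
    filter_upwards [hb] with t ht using hF.differentiableAt (Metric.isOpen_ball.mem_nhds ht)
  have hn : ∀ᶠ t in 𝓝 t₀, ‖Complex.exp (F t + l t)‖ = Real.exp (v t) := by
    filter_upwards [hb, hv] with t h1 h2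
    rw [Complex.norm_exp, h2, hG.G_L (h t h1), Complex.add_re]
  have hmax2 : IsLocalMax (norm ∘ fun t => Complex.exp (F t + l t)) t₀ := by
    have h0 := hn.self_of_nhds
    filter_upwards [hn, hmax] with t h1 h2
    simp only [Function.comp]
    rw [h1, h0]
    exact Real.exp_le_exp.mpr h2
  have := Complex.eventually_eq_of_isLocalMax_norm (f := fun t => Complex.exp (F t + l t)) (c := t₀)
    (by filter_upwards [hFd, hl] with t h1 h2 using (h1.add h2).cexp) hmax2
  have h0 := hn.self_of_nhds
  filter_upwards [this, hn] with t h1 h2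
  have : Real.exp (v t) = Real.exp (v t₀) := by rw [← h2, ← h0, h1]
  exact Real.exp_injective this

lemma IsGreen.liouville (hG : IsGreen D G) {γ : ℂ → ℂ × ℂ} (hγ : Differentiable ℂ γ) {c : ℝ}
    (hc : ∀ t, G (γ t) < c) (t s : ℂ) : G (γ t) = G (γ s) := by
  set u := fun t => G (γ t) with hu
  have hucont : Continuous u := hG.cont.comp hγ.continuous
  obtain ⟨t3, ht3, hmax3⟩ := (isCompact_closedBall (0 : ℂ) 1).exists_isMaxOn
    ⟨0, by simp⟩ hucont.continuousOn
  set M := u t3 with hM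
  have hM0 : 0 ≤ M := hG.nonneg _
  have hle : ∀ t, u t ≤ M := by
    by_contra! hcon
    obtain ⟨t1, ht1⟩ := hcon
    have hn1 : 1 < ‖t1‖ := by
      by_contra! h
      exact absurd (hmax3 (show t1 ∈ Metric.closedBall (0:ℂ) 1 by simpa using h)) (not_le.mpr ht1)
    have hlog1 : 0 < Real.log ‖t1‖ := Real.log_pos hn1
    obtain ⟨ε, hε, hε1⟩ : ∃ ε > 0, M < u t1 - ε * Real.log ‖t1‖ := by
      refine ⟨(u t1 - M) / (2 * Real.log ‖t1‖), div_pos (by linarith) (by linarith), ?_⟩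
      have : (u t1 - M) / (2 * Real.log ‖t1‖) * Real.log ‖t1‖ = (u t1 - M) / 2 := by field_simp
      rw [this]; linarith
    set v := fun t : ℂ => u t - ε * Real.log ‖t‖ with hv
    set K := {t : ℂ | 1 ≤ ‖t‖} with hK
    have hKc : IsClosed K := isClosed_le continuous_const continuous_norm
    have hvc : ContinuousOn v K := by
      refine hucont.continuousOn.sub (continuousOn_const.mul ?_)
      refine ContinuousOn.log continuous_norm.continuousOn ?_
      intro t ht
      have : 1 ≤ ‖t‖ := ht
      linarith
    obtain ⟨ρ, hρ1, hρ2⟩ : ∃ ρ : ℝ, ‖t1‖ ≤ ρ ∧ c - ε * Real.log ρ < v t1 := by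
      have h1 : Tendsto (fun ρ : ℝ => ε * Real.log ρ) atTop atTop :=
        Real.tendsto_log_atTop.const_mul_atTop hε
      obtain ⟨ρ, h2, h3⟩ := ((h1.eventually_gt_atTop (c - v t1)).and (eventually_ge_atTop ‖t1‖)).exists
      exact ⟨ρ, h3, by linarith⟩
    obtain ⟨t2, ht2, hmax2⟩ := ((isCompact_closedBall (0 : ℂ) ρ).inter_right hKc).exists_isMaxOn
      ⟨t1, by simpa using hρ1, hn1.le⟩ (hvc.mono inter_subset_right)
    have h12 : v t1 ≤ v t2 := hmax2 ⟨by simpa using hρ1, hn1.le⟩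
    have hmaxK : ∀ t ∈ K, v t ≤ v t2 := by
      intro t ht
      by_cases h : ‖t‖ ≤ ρ
      · exact hmax2 ⟨by simpa using h, ht⟩
      · push Not at h
        have h3 : Real.log ρ ≤ Real.log ‖t‖ := Real.log_le_log (by linarith) h.le
        have h4 := hc t
        have h5 : v t < c - ε * Real.log ρ := by
          simp only [hv, hu]; nlinarith
        linarith
    have hMv : M < v t2 := lt_of_lt_of_le hε1 h12
    set E := {t : ℂ | 1 < ‖t‖ ∧ v t = v t2} with hE
    have hEK : E = K ∩ v ⁻¹' {v t2} := by
      ext t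
      constructor
      · rintro ⟨h1, h2⟩; exact ⟨h1.le, h2⟩
      · rintro ⟨h1, h2⟩
        refine ⟨lt_of_le_of_ne h1 ?_, h2⟩
        intro h3
        have h4 : u t ≤ M := hmax3 (show t ∈ Metric.closedBall (0:ℂ) 1 by simp [← h3])
        have h5 : v t = u t := by simp [hv, ← h3]
        have h6 : v t = v t2 := h2
        linarith
    have hEclosed : IsClosed E := by
      rw [hEK]; exact hvc.preimage_isClosed_of_isClosed hKc isClosed_singleton
    have hEopen : IsOpen E := by
      rw [isOpen_iff_mem_nhds]
      rintro t0 ⟨h1, h2⟩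
      have ht0 : t0 ≠ 0 := by intro h; rw [h] at h1; simp at h1; linarith
      have hbig : ∀ᶠ t in 𝓝 t0, 1 < ‖t‖ := continuous_norm.continuousAt.eventually (lt_mem_nhds h1)
      have hpos : 0 < G (γ t0) := by
        have h4 : 0 ≤ ε * Real.log ‖t0‖ := mul_nonneg hε.le (Real.log_nonneg h1.le)
        have h5 : v t0 = G (γ t0) - ε * Real.log ‖t0‖ := rfl
        linarith
      have hsl : ∀ᶠ t in 𝓝 t0, t / t0 ∈ Complex.slitPlane := by
        have : ContinuousAt (fun t : ℂ => t / t0) t0 := continuousAt_id.div_const _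
        refine this.eventually_mem (Complex.isOpen_slitPlane.mem_nhds ?_)
        simp [div_self ht0]
      have hlm : IsLocalMax v t0 := by
        filter_upwards [hbig] with t ht
        rw [h2]; exact hmaxK t ht.le
      have := hG.localmax (v := v) (l := fun t => - ε * (Complex.log (t / t0) + Real.log ‖t0‖))
        isOpen_univ hγ.differentiableOn (mem_univ t0) hpos
        (by
          filter_upwards [hsl] with t ht
          have h1 : DifferentiableAt ℂ (fun t => Complex.log (t / t0)) t :=
            (differentiableAt_id.div_const t0).clog ht
          exact (h1.add_const _).const_mul _)
        (by
          filter_upwards [hbig] with t ht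
          have : (-(ε:ℂ) * (Complex.log (t / t0) + Real.log ‖t0‖)).re = - (ε * Real.log ‖t‖) := by
            rw [← Complex.ofReal_neg, Complex.re_ofReal_mul, Complex.add_re, Complex.ofReal_re,
              Complex.log_re, norm_div, Real.log_div]
            · ring
            · linarith
            · linarith
          rw [this]; simp only [hv, hu]; ring) hlm
      filter_upwards [hbig, this] with t h3 h4
      exact ⟨h3, h4.trans h2⟩
    have ht2E : t2 ∈ E := by rw [hEK]; exact ⟨ht2.2, rfl⟩
    have := IsClopen.eq_univ ⟨hEclosed, hEopen⟩ ⟨t2, ht2E⟩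
    have h0 : (0 : ℂ) ∈ E := by rw [this]; exact mem_univ _
    have := h0.1
    simp at this
    linarith
  rcases hM0.eq_or_lt with h0 | h0
  · have : ∀ t, u t = 0 := fun t => le_antisymm (by rw [h0]; exact hle t) (hG.nonneg _)
    show u t = u s
    rw [this, this]
  · have hopen : IsOpen {t | u t = M} := by
      rw [isOpen_iff_mem_nhds]
      intro t0 ht0
      have ht0' : u t0 = M := ht0
      have := hG.localmax (v := u) (l := fun _ => 0) isOpen_univ hγ.differentiableOn (mem_univ t0)
        (show 0 < u t0 by linarith) (by simp) (by simp [hu])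
        (Eventually.of_forall fun t => by rw [ht0']; exact hle t)
      filter_upwards [this] with t h using h.trans ht0
    have hclosed : IsClosed {t | u t = M} := isClosed_eq hucont continuous_const
    have := IsClopen.eq_univ ⟨hclosed, hopen⟩ ⟨t3, rfl⟩
    have h1 : t ∈ {t | u t = M} := by rw [this]; exact mem_univ _
    have h2 : s ∈ {t | u t = M} := by rw [this]; exact mem_univ _
    exact Eq.trans h1 (Eq.symm h2)

end HD

namespace HD

/-- abstract contraction estimate -/
lemma seq_est {d : ℕ} (hd : 2 ≤ d) {a : ℂ} (ha : a ≠ 0) {K : ℝ} (hK : 0 ≤ K) {B : ℝ}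
    (z Δ : ℕ → ℂ) (hz : ∀ n, z (n + 1) = z n ^ d) (h1 : 2 ≤ ‖z 0‖)
    (h2 : K + ‖a‖ + 2 ≤ 2 * ‖z 0‖) (h3 : 8 * (K + 1) ≤ ‖z 0‖)
    (hB : ∀ n, ‖Δ n‖ ≤ B)
    (hΔ : ∀ n, ‖Δ (n + 2) + a * Δ n - d * z n ^ (d - 1) * Δ (n + 1)‖ ≤
      K * ‖z n‖ ^ (d - 2) * ‖Δ (n + 1)‖) :
    ‖Δ 1‖ ≤ ‖Δ 0‖ ∧ ∃ δ : ℂ, ∀ n, ‖((d : ℂ) / a) ^ n * z n * Δ n - δ‖ ≤ 8 * (K + 1) * (1 / 2) ^ n * ‖Δ 0‖ := by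
  have hdR : (2 : ℝ) ≤ d := by exact_mod_cast hd
  have ha' : 0 < ‖a‖ := norm_pos_iff.mpr ha
  have zg : ∀ n, (2 : ℝ) ^ n * ‖z 0‖ ≤ ‖z n‖ := by
    intro n
    induction n with
    | zero => simp
    | succ n ih =>
      have h2n : 2 ≤ ‖z n‖ := by
        refine le_trans ?_ ih
        have : (1 : ℝ) ≤ 2 ^ n := one_le_pow₀ (by norm_num)
        nlinarith
      rw [hz, norm_pow]
      calc (2 : ℝ) ^ (n + 1) * ‖z 0‖ = 2 * (2 ^ n * ‖z 0‖) := by ring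
        _ ≤ ‖z n‖ * ‖z n‖ := by gcongr
        _ = ‖z n‖ ^ 2 := by ring
        _ ≤ ‖z n‖ ^ d := pow_le_pow_right₀ (by linarith) hd
  have zg0 : ∀ n, ‖z 0‖ ≤ ‖z n‖ := by
    intro n
    refine le_trans ?_ (zg n)
    have : (1 : ℝ) ≤ 2 ^ n := one_le_pow₀ (by norm_num)
    nlinarith
  have pw : ∀ n, ‖z n‖ ^ (d - 1) = ‖z n‖ ^ (d - 2) * ‖z n‖ := by
    intro n; rw [← pow_succ]; congr 1; omega
  have one_le : ∀ n, 1 ≤ ‖z n‖ ^ (d - 2) := fun n => one_le_pow₀ (by linarith [zg0 n])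
  -- growth step
  have gr : ∀ n, ‖Δ n‖ < ‖Δ (n + 1)‖ → 2 * ‖Δ (n + 1)‖ ≤ ‖Δ (n + 2)‖ := by
    intro n hn
    have e1 : ‖(d : ℂ) * z n ^ (d - 1) * Δ (n + 1)‖ = d * (‖z n‖ ^ (d - 2) * ‖z n‖) * ‖Δ (n + 1)‖ := by
      rw [norm_mul, norm_mul, norm_pow, pw]; simp
    have e2 : ‖(d : ℂ) * z n ^ (d - 1) * Δ (n + 1)‖ ≤
        ‖Δ (n + 2)‖ + ‖a‖ * ‖Δ n‖ + K * ‖z n‖ ^ (d - 2) * ‖Δ (n + 1)‖ := by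
      have := hΔ n
      have e3 : (d : ℂ) * z n ^ (d - 1) * Δ (n + 1) = Δ (n + 2) + a * Δ n -
        (Δ (n + 2) + a * Δ n - d * z n ^ (d - 1) * Δ (n + 1)) := by ring
      rw [e3]
      refine (norm_sub_le _ _).trans ?_
      have := norm_add_le (Δ (n + 2)) (a * Δ n)
      rw [norm_mul] at this
      linarith
    rw [e1] at e2
    set t := ‖z n‖ ^ (d - 2) with ht
    have ht1 : 1 ≤ t := one_le n
    set D1 := ‖Δ (n + 1)‖
    have hD : 0 ≤ D1 := norm_nonneg _
    have f1 : 2 * (t * ‖z n‖) * D1 ≤ d * (t * ‖z n‖) * D1 := by gcongr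
    have f2 : ‖a‖ * ‖Δ n‖ ≤ ‖a‖ * t * D1 := by
      calc ‖a‖ * ‖Δ n‖ ≤ ‖a‖ * D1 := by gcongr
        _ = ‖a‖ * 1 * D1 := by ring
        _ ≤ _ := by gcongr
    have f3 : t * (2 * ‖z n‖ - K - ‖a‖) * D1 ≥ 1 * 2 * D1 := by
      have : 2 ≤ 2 * ‖z n‖ - K - ‖a‖ := by linarith [zg0 n]
      gcongr
    nlinarith
  have mono : ∀ n, ‖Δ (n + 1)‖ ≤ ‖Δ n‖ := by
    intro n
    by_contra! hn
    have key : ∀ k, ‖Δ (n + k)‖ < ‖Δ (n + k + 1)‖ ∧ 2 ^ k * ‖Δ (n + 1)‖ ≤ ‖Δ (n + k + 1)‖ := by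
      intro k
      induction k with
      | zero => simpa using hn
      | succ k ih =>
        have := gr _ ih.1
        have h0 : 0 < ‖Δ (n + k + 1)‖ := lt_of_le_of_lt (norm_nonneg _) ih.1
        constructor
        · show ‖Δ (n + k + 1)‖ < ‖Δ (n + k + 2)‖
          linarith
        · show _ ≤ ‖Δ (n + k + 2)‖
          have := ih.2
          rw [pow_succ]; linarith
    have h0 : 0 < ‖Δ (n + 1)‖ := lt_of_le_of_lt (norm_nonneg _) hn
    have : Tendsto (fun k : ℕ => (2 : ℝ) ^ k * ‖Δ (n + 1)‖) atTop atTop :=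
      (tendsto_pow_atTop_atTop_of_one_lt (by norm_num)).atTop_mul_const h0
    obtain ⟨k, hk⟩ := (this.eventually_gt_atTop B).exists
    linarith [(key k).2, hB (n + k + 1)]
  refine ⟨mono 0, ?_⟩
  set e : ℕ → ℂ := fun n => ((d : ℂ) / a) ^ n * z n * Δ n with he
  have st : ∀ n, ‖e (n + 1) - e n‖ ≤ (K + 1) / ‖z n‖ * ‖e (n + 1)‖ := by
    intro n
    have zp : 0 < ‖z n‖ := by linarith [zg0 n]
    have zn : z n ≠ 0 := norm_pos_iff.mp zp
    have pz : z n ^ d = z n ^ (d - 1) * z n := by rw [← pow_succ]; congr 1; omega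
    have e1 : e (n + 1) - e n = ((d : ℂ) / a) ^ n * z n * (1 / a) *
        (d * z n ^ (d - 1) * Δ (n + 1) - a * Δ n) := by
      simp only [he, hz, pz, pow_succ]; field_simp
    have e2 : ‖d * z n ^ (d - 1) * Δ (n + 1) - a * Δ n‖ ≤ (K + 1) * ‖z n‖ ^ (d - 2) * ‖Δ (n + 1)‖ := by
      have e3 : d * z n ^ (d - 1) * Δ (n + 1) - a * Δ n =
        Δ (n + 2) - (Δ (n + 2) + a * Δ n - d * z n ^ (d - 1) * Δ (n + 1)) := by ring
      rw [e3]
      refine (norm_sub_le _ _).trans ?_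
      have := hΔ n
      have := mono (n + 1)
      have := one_le n
      nlinarith [norm_nonneg (Δ (n + 1))]
    have e4 : ‖e (n + 1)‖ = ‖((d : ℂ) / a) ^ n * z n * (1 / a)‖ * (d * ‖z n‖ ^ (d - 2) * ‖z n‖ * ‖Δ (n + 1)‖) := by
      have : e (n + 1) = ((d : ℂ) / a) ^ n * z n * (1 / a) * (d * (z n ^ (d - 1)) * Δ (n + 1)) := by
        simp only [he, hz, pz, pow_succ]; field_simp
      rw [this, norm_mul _ ((d : ℂ) * (z n ^ (d - 1)) * Δ (n + 1)), norm_mul (_ * _) (Δ _), norm_mul (d : ℂ), norm_pow, pw, Complex.norm_natCast]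
      ring
    rw [e1, e4, norm_mul _ (_ - _)]
    set A := ‖((d : ℂ) / a) ^ n * z n * (1 / a)‖
    have hA : 0 ≤ A := norm_nonneg _
    calc A * _ ≤ A * ((K + 1) * ‖z n‖ ^ (d - 2) * ‖Δ (n + 1)‖) := by gcongr
      _ ≤ A * (d * ((K + 1) * ‖z n‖ ^ (d - 2) * ‖Δ (n + 1)‖)) := by
        refine mul_le_mul_of_nonneg_left ?_ hA
        exact le_mul_of_one_le_left (by positivity) (by linarith)
      _ = _ := by field_simp
  have st2 : ∀ n, ‖e (n + 1) - e n‖ ≤ 2 * (K + 1) / (2 ^ n * ‖z 0‖) * ‖e n‖ := by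
    intro n
    have zp : 0 < ‖z n‖ := by linarith [zg0 n]
    have h := st n
    have h8 : (K + 1) / ‖z n‖ ≤ 1 / 2 := by
      rw [div_le_iff₀ zp]; linarith [zg0 n]
    have : ‖e (n + 1)‖ ≤ ‖e n‖ + ‖e (n + 1) - e n‖ := by
      have := norm_add_le (e n) (e (n + 1) - e n); simpa using this
    have h9 : ‖e (n + 1)‖ ≤ 2 * ‖e n‖ := by nlinarith [norm_nonneg (e (n + 1))]
    calc _ ≤ _ := h
      _ ≤ (K + 1) / (2 ^ n * ‖z 0‖) * (2 * ‖e n‖) := by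
        have := zg n
        gcongr
      _ = _ := by ring
  have e0 : ‖e 0‖ = ‖z 0‖ * ‖Δ 0‖ := by simp [he]
  have zp : 0 < ‖z 0‖ := by linarith
  have hKz : 8 * (K + 1) / ‖z 0‖ ≤ 1 := by rw [div_le_one zp]; exact h3
  have bd : ∀ n, ‖e n - e 0‖ ≤ 8 * (K + 1) / ‖z 0‖ * (1 - (1 / 2) ^ n) * ‖e 0‖ := by
    intro n
    induction n with
    | zero => simp
    | succ n ih =>
      have hp : (0 : ℝ) < (1 / 2) ^ n := by positivity
      have : ‖e n‖ ≤ ‖e 0‖ + ‖e n - e 0‖ := by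
        have := norm_add_le (e 0) (e n - e 0); simpa using this
      have h2 : ‖e n‖ ≤ 2 * ‖e 0‖ := by
        have : 8 * (K + 1) / ‖z 0‖ * (1 - (1 / 2) ^ n) * ‖e 0‖ ≤ 1 * 1 * ‖e 0‖ := by
          have h7 : (1 : ℝ) - (1 / 2) ^ n ≤ 1 := by linarith
          have h6 : (0 : ℝ) ≤ 1 - (1 / 2) ^ n := by
            have : ((1 : ℝ) / 2) ^ n ≤ 1 := pow_le_one₀ (by norm_num) (by norm_num)
            linarith
          gcongr
        linarith
      have h3 := st2 n
      have h4 : ‖e (n + 1) - e 0‖ ≤ ‖e (n + 1) - e n‖ + ‖e n - e 0‖ := norm_sub_le_norm_sub_add_norm_sub _ _ _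
      have h5 : 2 * (K + 1) / (2 ^ n * ‖z 0‖) * ‖e n‖ ≤ 2 * (K + 1) / (2 ^ n * ‖z 0‖) * (2 * ‖e 0‖) := by gcongr
      calc _ ≤ _ := h4
        _ ≤ 2 * (K + 1) / (2 ^ n * ‖z 0‖) * (2 * ‖e 0‖) + 8 * (K + 1) / ‖z 0‖ * (1 - (1 / 2) ^ n) * ‖e 0‖ := by linarith
        _ = _ := by rw [pow_succ, one_div, inv_pow]; field_simp; ring
  have st3 : ∀ n, dist (e n) (e (n + 1)) ≤ (4 * (K + 1) * ‖Δ 0‖) * (1 / 2) ^ n := by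
    intro n
    have : ‖e n‖ ≤ ‖e 0‖ + ‖e n - e 0‖ := by
      have := norm_add_le (e 0) (e n - e 0); simpa using this
    have h2 : ‖e n‖ ≤ 2 * ‖e 0‖ := by
      have := bd n
      have : 8 * (K + 1) / ‖z 0‖ * (1 - (1 / 2) ^ n) * ‖e 0‖ ≤ 1 * 1 * ‖e 0‖ := by
        have hp : (0 : ℝ) < (1 / 2) ^ n := by positivity
        have h7 : (1 : ℝ) - (1 / 2) ^ n ≤ 1 := by linarith
        have h6 : (0 : ℝ) ≤ 1 - (1 / 2) ^ n := by
          have : ((1 : ℝ) / 2) ^ n ≤ 1 := pow_le_one₀ (by norm_num) (by norm_num)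
          linarith
        gcongr
      linarith
    rw [dist_comm, dist_eq_norm]
    calc _ ≤ _ := st2 n
      _ ≤ 2 * (K + 1) / (2 ^ n * ‖z 0‖) * (2 * ‖e 0‖) := by gcongr
      _ = _ := by rw [e0, one_div, inv_pow]; field_simp; ring
  have hc : CauchySeq e := cauchySeq_of_le_geometric _ _ (by norm_num) st3
  obtain ⟨δ, hδ⟩ := cauchySeq_tendsto_of_complete hc
  refine ⟨δ, fun n => ?_⟩
  have := dist_le_of_le_geometric_of_tendsto (1 / 2) _ (by norm_num) st3 hδ n
  rw [dist_eq_norm] at this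
  refine this.trans (le_of_eq ?_)
  ring

lemma pow_sub_le {x z : ℂ} {M : ℝ} (hx : ‖x‖ ≤ M) (hz : ‖z‖ ≤ M) (n : ℕ) :
    ‖x ^ (n + 1) - z ^ (n + 1)‖ ≤ (n + 1) * M ^ n * ‖x - z‖ := by
  have hM : 0 ≤ M := (norm_nonneg x).trans hx
  induction n with
  | zero => simp
  | succ n ih =>
    have : x ^ (n + 2) - z ^ (n + 2) = x * (x ^ (n + 1) - z ^ (n + 1)) + (x - z) * z ^ (n + 1) := by ring
    rw [this]
    calc _ ≤ ‖x * (x ^ (n + 1) - z ^ (n + 1))‖ + ‖(x - z) * z ^ (n + 1)‖ := norm_add_le _ _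
      _ = ‖x‖ * ‖x ^ (n + 1) - z ^ (n + 1)‖ + ‖x - z‖ * ‖z‖ ^ (n + 1) := by simp
      _ ≤ M * ((n + 1) * M ^ n * ‖x - z‖) + ‖x - z‖ * M ^ (n + 1) := by gcongr
      _ = _ := by push_cast; ring

variable (D : HD)

lemma deriv_est (B : ℝ) (hB : 0 ≤ B) : ∃ K : ℝ, 0 ≤ K ∧ ∀ z x : ℂ, 1 ≤ ‖z‖ → ‖x - z‖ ≤ B →
    ‖D.p.derivative.eval x - D.d * z ^ (D.d - 1)‖ ≤ K * ‖z‖ ^ (D.d - 2) := by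
  obtain ⟨m, hm⟩ : ∃ m, D.d = m + 2 := ⟨D.d - 2, by have := D.hd; omega⟩
  have c1 : D.p.coeff (m + 2) = 1 := by rw [← hm, ← D.hpd]; exact D.hpm
  set r := D.p.derivative with hr
  have hdeg : r.natDegree < m + 2 := by
    have := D.p.natDegree_derivative_le; rw [D.hpd, hm, ← hr] at this; omega
  refine ⟨(∑ i ∈ Finset.range (m + 1), ‖r.coeff i‖) * (1 + B) ^ m + (m + 2) * ((m + 1) * (1 + B) ^ m * B),
    by positivity, fun z x hz hx => ?_⟩
  have hzM : ‖z‖ ≤ (1 + B) * ‖z‖ := le_mul_of_one_le_left (by linarith) (by linarith)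
  have hxM : ‖x‖ ≤ (1 + B) * ‖z‖ := by
    have := norm_add_le (x - z) z
    rw [sub_add_cancel] at this
    nlinarith
  have hM1 : 1 ≤ (1 + B) * ‖z‖ := by nlinarith
  have e1 : r.eval x = ∑ i ∈ Finset.range (m + 1), r.coeff i * x ^ i + (m + 2) * x ^ (m + 1) := by
    rw [Polynomial.eval_eq_sum_range' hdeg, Finset.sum_range_succ]
    congr 2
    rw [hr, Polynomial.coeff_derivative, c1]; push_cast; ring
  rw [hm, e1]
  have e2 : ∑ i ∈ Finset.range (m + 1), r.coeff i * x ^ i + (m + 2) * x ^ (m + 1) -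
      ((m + 2 : ℕ) : ℂ) * z ^ (m + 2 - 1) = ∑ i ∈ Finset.range (m + 1), r.coeff i * x ^ i +
        (m + 2) * (x ^ (m + 1) - z ^ (m + 1)) := by
    simp; ring
  rw [e2]
  refine (norm_add_le _ _).trans ?_
  have e3 : ‖∑ i ∈ Finset.range (m + 1), r.coeff i * x ^ i‖ ≤
      (∑ i ∈ Finset.range (m + 1), ‖r.coeff i‖) * ((1 + B) * ‖z‖) ^ m := by
    rw [Finset.sum_mul]
    refine (norm_sum_le _ _).trans (Finset.sum_le_sum fun i hi => ?_)
    rw [norm_mul, norm_pow]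
    have : i ≤ m := by have := Finset.mem_range.mp hi; omega
    have : ‖x‖ ^ i ≤ ((1 + B) * ‖z‖) ^ m :=
      (pow_le_pow_left₀ (norm_nonneg _) hxM i).trans (pow_le_pow_right₀ hM1 this)
    gcongr
  have e4 := pow_sub_le hxM hzM m
  have e5 : ‖((m : ℂ) + 2) * (x ^ (m + 1) - z ^ (m + 1))‖ ≤ (m + 2) * ((m + 1) * ((1 + B) * ‖z‖) ^ m * B) := by
    rw [norm_mul]
    have : ‖(m : ℂ) + 2‖ = m + 2 := by
      have := Complex.norm_natCast (m + 2); push_cast at this; exact this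
    rw [this]
    gcongr
    exact e4.trans (by gcongr)
  rw [mul_pow] at e3 e5
  have : m + 2 - 2 = m := by omega
  rw [this]
  calc _ ≤ _ := add_le_add e3 e5
    _ = _ := by ring

lemma poly_est (B : ℝ) (hB : 0 ≤ B) : ∃ K : ℝ, 0 ≤ K ∧ ∀ z u v : ℂ, 1 ≤ ‖z‖ → ‖u - z‖ ≤ B → ‖v - z‖ ≤ B →
    ‖D.p.eval u - D.p.eval v - D.d * z ^ (D.d - 1) * (u - v)‖ ≤ K * ‖z‖ ^ (D.d - 2) * ‖u - v‖ := by
  obtain ⟨K, hK, h⟩ := D.deriv_est B hB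
  refine ⟨K, hK, fun z u v hz hu hv => ?_⟩
  have := (convex_closedBall z B).norm_image_sub_le_of_norm_hasDerivWithin_le
    (f := fun x => D.p.eval x - D.d * z ^ (D.d - 1) * x)
    (f' := fun x => D.p.derivative.eval x - D.d * z ^ (D.d - 1) * 1) (C := K * ‖z‖ ^ (D.d - 2))
    (fun x hx => ((D.p.hasDerivAt x).sub ((hasDerivAt_id x).const_mul _)).hasDerivWithinAt)
    (fun x hx => by rw [mul_one]; exact h z x hz (by simpa [dist_eq_norm] using hx))
    (x := v) (y := u) (by simpa [dist_eq_norm] using hv) (by simpa [dist_eq_norm] using hu)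
  have e : D.p.eval u - D.p.eval v - D.d * z ^ (D.d - 1) * (u - v) =
    D.p.eval u - D.d * z ^ (D.d - 1) * u - (D.p.eval v - D.d * z ^ (D.d - 1) * v) := by ring
  rw [e]; exact this

lemma iter_fst (n : ℕ) (q : ℂ × ℂ) : (D.H^[n + 1] q).1 = (D.H^[n] q).2 := by
  rw [Function.iterate_succ_apply']; rfl

lemma iter_snd (n : ℕ) (q : ℂ × ℂ) : (D.H^[n + 2] q).1 = D.p.eval (D.H^[n + 1] q).1 - D.a * (D.H^[n] q).1 := by
  rw [D.iter_fst (n + 1), Function.iterate_succ_apply']; rfl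

lemma exists_est : ∃ R1 K : ℝ, 0 < K ∧ 2 * K ≤ R1 ∧ D.R ≤ R1 ∧ ∀ q ∈ D.V, ∀ q' ∈ D.V, D.phi q = D.phi q' →
    R1 ≤ ‖D.phi q‖ → ‖q.2 - q'.2‖ ≤ ‖q.1 - q'.1‖ ∧ ∃ δ, ∀ n,
      ‖((D.d : ℂ) / D.a) ^ n * D.phi q ^ (D.d ^ n) * ((D.H^[n] q).1 - (D.H^[n] q').1) - δ‖ ≤
        K * (1 / 2) ^ n * ‖q.1 - q'.1‖ := by
  have hC := D.C_pos
  obtain ⟨K, hK, h⟩ := D.poly_est (4 * D.C) (by positivity)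
  refine ⟨16 * (K + 1) + K + ‖D.a‖ + 2 + D.R, 8 * (K + 1), by positivity,
    by have := norm_nonneg D.a; have := D.R_pos; linarith, by have := norm_nonneg D.a; linarith,
    fun q hq q' hq' he hR => ?_⟩
  have hna := norm_nonneg D.a
  have hR4 := D.R_pos
  have hphi : ∀ n, D.phi (D.H^[n] q) = D.phi q ^ (D.d ^ n) := fun n => D.phi_iter hq n
  have hphi' : ∀ n, D.phi (D.H^[n] q') = D.phi q ^ (D.d ^ n) := fun n => by rw [D.phi_iter hq' n, he]
  have near : ∀ n, ‖(D.H^[n + 1] q).1 - D.phi q ^ (D.d ^ n)‖ ≤ 4 * D.C := fun n => by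
    rw [← hphi, iter_fst]; exact D.phi_near (D.iter_mem_V hq n)
  have near' : ∀ n, ‖(D.H^[n + 1] q').1 - D.phi q ^ (D.d ^ n)‖ ≤ 4 * D.C := fun n => by
    rw [← hphi', iter_fst]; exact D.phi_near (D.iter_mem_V hq' n)
  have := seq_est D.hd D.ha hK (B := max ‖q.1 - q'.1‖ (8 * D.C)) (fun n => D.phi q ^ (D.d ^ n))
    (fun n => (D.H^[n] q).1 - (D.H^[n] q').1) (fun n => by simp only [pow_succ, pow_mul])
    (by simp; linarith) (by simp; linarith) (by simp; linarith)
    (fun n => by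
      cases n with
      | zero => simp
      | succ n =>
        refine le_trans ?_ (le_max_right _ _)
        have h1 := near n
        have h2 := near' n
        rw [norm_sub_rev] at h2
        have := norm_sub_le_norm_sub_add_norm_sub (D.H^[n + 1] q).1 (D.phi q ^ (D.d ^ n)) (D.H^[n + 1] q').1
        linarith)
    (fun n => by
      have h1 : 1 ≤ ‖D.phi q ^ (D.d ^ n)‖ := by
        rw [norm_pow]; exact one_le_pow₀ (by linarith)
      convert h _ _ _ h1 (near n) (near' n) using 2
      rw [iter_snd, iter_snd]; ring)
  refine ⟨?_, by simpa using this.2⟩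
  simpa [H] using this.1

end HD

namespace HD

variable (D : HD)

/-- large radius -/
def R1 : ℝ := D.exists_est.choose
/-- constant of the contraction estimate -/
def K1 : ℝ := D.exists_est.choose_spec.choose

lemma K1_pos : 0 < D.K1 := D.exists_est.choose_spec.choose_spec.1
lemma K1_le : 2 * D.K1 ≤ D.R1 := D.exists_est.choose_spec.choose_spec.2.1
lemma R_le_R1 : D.R ≤ D.R1 := D.exists_est.choose_spec.choose_spec.2.2.1
lemma est {q q' : ℂ × ℂ} (hq : q ∈ D.V) (hq' : q' ∈ D.V) (h : D.phi q = D.phi q') (hR : D.R1 ≤ ‖D.phi q‖) :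
    ‖q.2 - q'.2‖ ≤ ‖q.1 - q'.1‖ ∧ ∃ δ, ∀ n,
      ‖((D.d : ℂ) / D.a) ^ n * D.phi q ^ (D.d ^ n) * ((D.H^[n] q).1 - (D.H^[n] q').1) - δ‖ ≤
        D.K1 * (1 / 2) ^ n * ‖q.1 - q'.1‖ :=
  D.exists_est.choose_spec.choose_spec.2.2.2 q hq q' hq' h hR

/-- approximants of the affine difference on leaves -/
def en (w : ℂ) (q q' : ℂ × ℂ) (n : ℕ) : ℂ :=
  ((D.d : ℂ) / D.a) ^ n * Complex.exp ((D.d : ℂ) ^ n * w) * ((D.H^[n] q).1 - (D.H^[n] q').1)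

/-- affine difference on leaves -/
def del (w : ℂ) (q q' : ℂ × ℂ) : ℂ := limUnder atTop (D.en w q q')

/-- `q` is in the good part of the leaf `w` -/
def InV (w : ℂ) (q : ℂ × ℂ) : Prop := q ∈ D.V ∧ D.phi q = Complex.exp w

lemma en_est {w : ℂ} {q q' : ℂ × ℂ} (hq : D.InV w q) (hq' : D.InV w q') (hR : D.R1 ≤ ‖Complex.exp w‖) :
    Tendsto (D.en w q q') atTop (𝓝 (D.del w q q')) ∧
    ∀ n, ‖D.en w q q' n - D.del w q q'‖ ≤ D.K1 * (1 / 2) ^ n * ‖q.1 - q'.1‖ := by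
  obtain ⟨δ, hδ⟩ := (D.est hq.1 hq'.1 (hq.2.trans hq'.2.symm) (by rw [hq.2]; exact hR)).2
  have h1 : ∀ n, ‖D.en w q q' n - δ‖ ≤ D.K1 * (1 / 2) ^ n * ‖q.1 - q'.1‖ := by
    intro n
    convert hδ n using 5
    rw [hq.2, ← Complex.exp_nat_mul]; push_cast; rfl
  have h2 : Tendsto (D.en w q q') atTop (𝓝 δ) := by
    rw [tendsto_iff_norm_sub_tendsto_zero]
    refine squeeze_zero (fun n => norm_nonneg _) h1 ?_
    have : Tendsto (fun n : ℕ => ((1 : ℝ) / 2) ^ n) atTop (𝓝 0) :=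
      tendsto_pow_atTop_nhds_zero_of_lt_one (by norm_num) (by norm_num)
    simpa using (this.const_mul D.K1).mul_const ‖q.1 - q'.1‖
  have h3 : D.del w q q' = δ := h2.limUnder_eq
  rw [h3]; exact ⟨h2, h1⟩

lemma InV_of_L {w : ℂ} {q : ℂ × ℂ} (hq : q ∈ D.L w) :
    ∀ᶠ n in atTop, D.InV ((D.d : ℂ) ^ n * w) (D.H^[n] q) := by
  obtain ⟨n, hn⟩ := hq
  filter_upwards [eventually_ge_atTop n] with m hm
  exact D.L_step hn hm

lemma InV.mem_L {w : ℂ} {q : ℂ × ℂ} {D : HD} (hq : D.InV w q) : q ∈ D.L w := ⟨0, by simpa [InV] using hq⟩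

lemma big_exp {w : ℂ} (hw : 0 < w.re) (R : ℝ) : ∀ᶠ n : ℕ in atTop, R < ‖Complex.exp ((D.d : ℂ) ^ n * w)‖ := by
  have h1 : ∀ n : ℕ, ‖Complex.exp ((D.d : ℂ) ^ n * w)‖ = Real.exp ((D.d : ℝ) ^ n * w.re) := by
    intro n
    rw [Complex.norm_exp]; congr 1
    rw [← Complex.ofReal_natCast, ← Complex.ofReal_pow, Complex.re_ofReal_mul]
  simp only [h1]
  exact (Real.tendsto_exp_atTop.comp (D.tendsto_dpow.atTop_mul_const hw)).eventually_gt_atTop R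

lemma en_add (w : ℂ) (q q' : ℂ × ℂ) (m n : ℕ) :
    D.en w q q' (n + m) = ((D.d : ℂ) / D.a) ^ m * D.en ((D.d : ℂ) ^ m * w) (D.H^[m] q) (D.H^[m] q') n := by
  unfold en
  rw [← Function.iterate_add_apply, ← Function.iterate_add_apply, pow_add, pow_add, ← mul_assoc ((D.d : ℂ) ^ n)]
  ring

lemma del_tendsto {w : ℂ} {q q' : ℂ × ℂ} (hw : 0 < w.re) (hq : q ∈ D.L w) (hq' : q' ∈ D.L w) :
    Tendsto (D.en w q q') atTop (𝓝 (D.del w q q')) := by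
  obtain ⟨m, h1, h2, h3⟩ := ((D.InV_of_L hq).and ((D.InV_of_L hq').and (D.big_exp hw D.R1))).exists
  have := (D.en_est h1 h2 h3.le).1
  have h4 : Tendsto (fun n => D.en w q q' (n + m)) atTop (𝓝 (((D.d : ℂ) / D.a) ^ m *
      D.del ((D.d : ℂ) ^ m * w) (D.H^[m] q) (D.H^[m] q'))) := by
    simp only [en_add]; exact this.const_mul _
  rw [tendsto_add_atTop_iff_nat] at h4
  have h5 : D.del w q q' = _ := h4.limUnder_eq
  rw [h5]; exact h4

lemma re_dpow (n : ℕ) (w : ℂ) : ((D.d : ℂ) ^ n * w).re = (D.d : ℝ) ^ n * w.re := by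
  rw [← Complex.ofReal_natCast, ← Complex.ofReal_pow, Complex.re_ofReal_mul]

lemma re_dpow_pos (n : ℕ) {w : ℂ} (hw : 0 < w.re) : 0 < ((D.d : ℂ) ^ n * w).re := by
  rw [re_dpow]; exact mul_pos (D.dpow_pos n) hw

lemma del_iter {w : ℂ} {q q' : ℂ × ℂ} (hw : 0 < w.re) (hq : q ∈ D.L w) (hq' : q' ∈ D.L w) (m : ℕ) :
    D.del w q q' = ((D.d : ℂ) / D.a) ^ m * D.del ((D.d : ℂ) ^ m * w) (D.H^[m] q) (D.H^[m] q') := by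
  have h1 := D.del_tendsto (D.re_dpow_pos m hw) ((D.L_iter m).mpr hq) ((D.L_iter m).mpr hq')
  have h2 := (tendsto_add_atTop_iff_nat m).mpr (D.del_tendsto hw hq hq')
  simp only [en_add] at h2
  exact tendsto_nhds_unique h2 (h1.const_mul _)

lemma del_add {w : ℂ} {q q' q'' : ℂ × ℂ} (hw : 0 < w.re) (hq : q ∈ D.L w) (hq' : q' ∈ D.L w) (hq'' : q'' ∈ D.L w) :
    D.del w q q'' = D.del w q q' + D.del w q' q'' := by
  refine tendsto_nhds_unique (D.del_tendsto hw hq hq'') ?_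
  convert (D.del_tendsto hw hq hq').add (D.del_tendsto hw hq' hq'') using 2 with n
  unfold en; ring

lemma del_self (w : ℂ) (q : ℂ × ℂ) : D.del w q q = 0 := by
  have : D.en w q q = fun _ => 0 := by funext n; simp [en]
  unfold del; rw [this]; exact tendsto_const_nhds.limUnder_eq

lemma del_symm {w : ℂ} {q q' : ℂ × ℂ} (hw : 0 < w.re) (hq : q ∈ D.L w) (hq' : q' ∈ D.L w) :
    D.del w q q' = - D.del w q' q := by
  have := D.del_add hw hq hq' hq
  rw [del_self] at this
  linear_combination -this

lemma a_div_ne (n : ℕ) : ((D.d : ℂ) / D.a) ^ n ≠ 0 := pow_ne_zero _ (div_ne_zero D.d_ne D.ha)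

lemma del_eq_zero {w : ℂ} {q q' : ℂ × ℂ} (hw : 0 < w.re) (hq : q ∈ D.L w) (hq' : q' ∈ D.L w)
    (h : D.del w q q' = 0) : q = q' := by
  obtain ⟨m, h1, h2, h3⟩ := ((D.InV_of_L hq).and ((D.InV_of_L hq').and (D.big_exp hw D.R1))).exists
  rw [D.del_iter hw hq hq' m, mul_eq_zero, or_iff_right (D.a_div_ne m)] at h
  have h4 := (D.en_est h1 h2 h3.le).2 0
  rw [h] at h4
  simp only [en, pow_zero, one_mul, Function.iterate_zero, id, sub_zero, norm_mul, mul_one] at h4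
  have h5 : ‖(D.H^[m] q).1 - (D.H^[m] q').1‖ = 0 := by
    by_contra hne
    have : 0 < ‖(D.H^[m] q).1 - (D.H^[m] q').1‖ := lt_of_le_of_ne (norm_nonneg _) (Ne.symm hne)
    have := le_of_mul_le_mul_right h4 this
    have := D.K1_le; have := D.K1_pos; linarith
  have h6 := (D.est h1.1 h2.1 (h1.2.trans h2.2.symm) (by rw [h1.2]; exact h3.le)).1
  rw [h5] at h6
  have h7 : D.H^[m] q = D.H^[m] q' := by
    ext
    · exact sub_eq_zero.mp (norm_eq_zero.mp h5)
    · exact sub_eq_zero.mp (norm_eq_zero.mp (le_antisymm h6 (norm_nonneg _)))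
  rw [← D.Hi_H_iter m q, h7, D.Hi_H_iter]

lemma exp_shift (w : ℂ) (k : ℤ) {n m : ℕ} (h : n ≤ m) :
    Complex.exp ((D.d : ℂ) ^ m * (w + 2 * Real.pi * Complex.I * k / (D.d : ℂ) ^ n)) = Complex.exp ((D.d : ℂ) ^ m * w) := by
  obtain ⟨j, rfl⟩ := Nat.exists_eq_add_of_le h
  have hd := D.d_ne
  have : (D.d : ℂ) ^ (n + j) * (w + 2 * Real.pi * Complex.I * k / (D.d : ℂ) ^ n) =
    (D.d : ℂ) ^ (n + j) * w + ((k * D.d ^ j : ℤ) : ℂ) * (2 * Real.pi * Complex.I) := by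
    push_cast; field_simp; ring
  rw [this, Complex.exp_add, Complex.exp_int_mul_two_pi_mul_I, mul_one]

lemma del_shift (w : ℂ) (q q' : ℂ × ℂ) (k : ℤ) (n : ℕ) :
    D.del (w + 2 * Real.pi * Complex.I * k / (D.d : ℂ) ^ n) q q' = D.del w q q' := by
  unfold del limUnder
  congr 1
  refine Filter.map_congr ?_
  filter_upwards [eventually_ge_atTop n] with m hm
  unfold en
  rw [D.exp_shift w k hm]

/-- good representatives stay good in holomorphic families -/
lemma InV_local {S : Set ℂ} (hS : IsOpen S) {w : ℂ → ℂ} {q : ℂ → ℂ × ℂ} (hw : DifferentiableOn ℂ w S)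
    (hq : DifferentiableOn ℂ q S) (hL : ∀ t ∈ S, q t ∈ D.L (w t)) {t₀ : ℂ} (ht : t₀ ∈ S)
    (h0 : D.InV (w t₀) (q t₀)) : ∀ᶠ t in 𝓝 t₀, D.InV (w t) (q t) := by
  have hV : ∀ᶠ t in 𝓝 t₀, t ∈ S ∧ q t ∈ D.V :=
    (hS.eventually_mem ht).and (((hq t₀ ht).continuousWithinAt.continuousAt (hS.mem_nhds ht)).eventually
      (D.isOpen_V.mem_nhds h0.1))
  obtain ⟨ε, hε, hb⟩ := Metric.eventually_nhds_iff_ball.mp hV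
  set u : ℂ → ℂ := fun t => D.phi (q t) / Complex.exp (w t) with hu
  have hBS : Metric.ball t₀ ε ⊆ S := fun t ht => (hb t ht).1
  have hc : ContinuousOn u (Metric.ball t₀ ε) := by
    refine ContinuousOn.div (D.differentiableOn_phi Metric.isOpen_ball (hq.mono hBS)
      (fun t ht => (hb t ht).2)).continuousOn (Complex.continuous_exp.comp_continuousOn
        (hw.mono hBS).continuousOn) (fun t _ => Complex.exp_ne_zero _)
  have hpow : ∀ t ∈ Metric.ball t₀ ε, ∃ n : ℕ, u t ^ (D.d ^ n) = 1 := by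
    intro t ht
    obtain ⟨n, hn⟩ := hL t (hb t ht).1
    refine ⟨n, ?_⟩
    rw [D.phi_iter (hb t ht).2] at hn
    rw [hu]; simp only [div_pow]
    rw [hn.2, ← Complex.exp_nat_mul]; push_cast
    exact div_self (Complex.exp_ne_zero _)
  have hcount : (⋃ n : ℕ, {z : ℂ | z ^ (D.d ^ n) = 1}).Countable := by
    refine countable_iUnion fun n => ?_
    have hf : ({z : ℂ | z ^ (D.d ^ n) = 1}).Finite := by
      have := (Polynomial.nthRoots (D.d ^ n) (1 : ℂ)).toFinset.finite_toSet
      refine this.subset fun z hz => ?_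
      simp [Polynomial.mem_nthRoots (pow_pos D.d_pos n)]; exact hz
    exact hf.countable
  have hpre : (u '' Metric.ball t₀ ε).Subsingleton :=
    hcount.isTotallyDisconnected _ (by
      rintro _ ⟨t, ht, rfl⟩
      simpa using hpow t ht) ((convex_ball t₀ ε).isPreconnected.image _ hc)
  filter_upwards [Metric.ball_mem_nhds t₀ hε] with t ht
  refine ⟨(hb t ht).2, ?_⟩
  have h1 := hpre (mem_image_of_mem u ht) (mem_image_of_mem u (Metric.mem_ball_self hε))
  have h2 : u t₀ = 1 := by rw [hu]; simp only; rw [h0.2]; exact div_self (Complex.exp_ne_zero _)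
  rw [h2] at h1
  exact (div_eq_one_iff_eq (Complex.exp_ne_zero _)).mp h1

lemma differentiable_en {S : Set ℂ} {w : ℂ → ℂ} {q q' : ℂ → ℂ × ℂ} (hw : DifferentiableOn ℂ w S)
    (hq : DifferentiableOn ℂ q S) (hq' : DifferentiableOn ℂ q' S) (n : ℕ) :
    DifferentiableOn ℂ (fun t => D.en (w t) (q t) (q' t) n) S := by
  unfold en
  have h1 : DifferentiableOn ℂ (fun t => D.H^[n] (q t)) S := (D.differentiable_iter n).comp_differentiableOn hq
  have h2 : DifferentiableOn ℂ (fun t => D.H^[n] (q' t)) S := (D.differentiable_iter n).comp_differentiableOn hq'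
  have h3 := h1.fst
  have h4 := h2.fst
  fun_prop

lemma differentiableOn_del {S : Set ℂ} (hS : IsOpen S) {w : ℂ → ℂ} {q q' : ℂ → ℂ × ℂ} (hw : DifferentiableOn ℂ w S)
    (hq : DifferentiableOn ℂ q S) (hq' : DifferentiableOn ℂ q' S) (hre : ∀ t ∈ S, 0 < (w t).re)
    (hL : ∀ t ∈ S, q t ∈ D.L (w t)) (hL' : ∀ t ∈ S, q' t ∈ D.L (w t)) :
    DifferentiableOn ℂ (fun t => D.del (w t) (q t) (q' t)) S := by
  intro t₀ ht₀
  refine DifferentiableAt.differentiableWithinAt ?_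
  obtain ⟨m, h1, h2, h3⟩ := ((D.InV_of_L (hL t₀ ht₀)).and ((D.InV_of_L (hL' t₀ ht₀)).and
    (D.big_exp (hre t₀ ht₀) D.R1))).exists
  set W : ℂ → ℂ := fun t => (D.d : ℂ) ^ m * w t with hW
  set Q : ℂ → ℂ × ℂ := fun t => D.H^[m] (q t) with hQ
  set Q' : ℂ → ℂ × ℂ := fun t => D.H^[m] (q' t) with hQ'
  have dW : DifferentiableOn ℂ W S := hw.const_mul _
  have dQ : DifferentiableOn ℂ Q S := (D.differentiable_iter m).comp_differentiableOn hq
  have dQ' : DifferentiableOn ℂ Q' S := (D.differentiable_iter m).comp_differentiableOn hq'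
  have e1 := D.InV_local hS dW dQ (fun t ht => (D.L_iter m).mpr (hL t ht)) ht₀ h1
  have e2 := D.InV_local hS dW dQ' (fun t ht => (D.L_iter m).mpr (hL' t ht)) ht₀ h2
  have cat : ∀ {E : Type} [NormedAddCommGroup E] [NormedSpace ℂ E] {g : ℂ → E}, DifferentiableOn ℂ g S → ContinuousAt g t₀ :=
    fun hg => (hg t₀ ht₀).continuousWithinAt.continuousAt (hS.mem_nhds ht₀)
  have e3 : ∀ᶠ t in 𝓝 t₀, D.R1 < ‖Complex.exp (W t)‖ :=
    ((Complex.continuous_exp.continuousAt.comp (cat dW)).norm).eventually (lt_mem_nhds h3)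
  set M : ℝ := ‖(Q t₀).1 - (Q' t₀).1‖ + 1
  have e4 : ∀ᶠ t in 𝓝 t₀, ‖(Q t).1 - (Q' t).1‖ < M :=
    (((cat dQ.fst).sub (cat dQ'.fst)).norm).eventually (gt_mem_nhds (by simp [M]))
  obtain ⟨ε, hε, hb⟩ := Metric.eventually_nhds_iff_ball.mp
    ((((hS.eventually_mem ht₀).and e1).and (e2.and (e3.and e4))))
  have hBS : Metric.ball t₀ ε ⊆ S := fun t ht => (hb t ht).1.1
  have hunif : TendstoLocallyUniformlyOn (fun n t => D.en (W t) (Q t) (Q' t) n)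
      (fun t => D.del (W t) (Q t) (Q' t)) atTop (Metric.ball t₀ ε) := by
    refine TendstoUniformlyOn.tendstoLocallyUniformlyOn ?_
    rw [Metric.tendstoUniformlyOn_iff]
    intro η hη
    have ht : Tendsto (fun n : ℕ => D.K1 * (1 / 2) ^ n * M) atTop (𝓝 0) := by
      have : Tendsto (fun n : ℕ => ((1 : ℝ) / 2) ^ n) atTop (𝓝 0) :=
        tendsto_pow_atTop_nhds_zero_of_lt_one (by norm_num) (by norm_num)
      simpa using (this.const_mul D.K1).mul_const M
    filter_upwards [ht.eventually (gt_mem_nhds hη)] with n hn t htb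
    obtain ⟨⟨_, i1⟩, i2, i3, i4⟩ := hb t htb
    rw [dist_comm, dist_eq_norm]
    refine lt_of_le_of_lt ((D.en_est i1 i2 i3.le).2 n) (lt_of_le_of_lt ?_ hn)
    have := D.K1_pos
    gcongr
  have hd := hunif.differentiableOn (Eventually.of_forall fun n =>
    D.differentiable_en (dW.mono hBS) (dQ.mono hBS) (dQ'.mono hBS) n) Metric.isOpen_ball
  have hd2 := (hd.const_mul (((D.d : ℂ) / D.a) ^ m)).differentiableAt (Metric.ball_mem_nhds t₀ hε)
  refine hd2.congr_of_eventuallyEq ?_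
  filter_upwards [hS.mem_nhds ht₀] with t ht
  exact D.del_iter (hre t ht) (hL t ht) (hL' t ht) m

end HD

namespace HD

variable (D : HD)

/-- radius for solving `phi (x, y) = ζ` -/
def R2 : ℝ := 200 * D.C + 2 * D.R + D.R1

lemma R2_ge : 200 * D.C ≤ D.R2 ∧ 2 * D.R ≤ D.R2 ∧ D.R1 ≤ D.R2 ∧ 4 < D.R2 := by
  have := D.C_pos; have := D.R_pos; have := D.R_le_R1
  unfold R2
  refine ⟨?_, ?_, ?_, ?_⟩ <;> linarith

/-- iterates converging to the solution -/
def Yk (x z : ℂ) : ℕ → ℂ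
  | 0 => z
  | k + 1 => z * Complex.exp (-D.gs (x, Yk x z k))

/-- solution of `phi (x, y) = z` -/
def Y (x z : ℂ) : ℂ := limUnder atTop (D.Yk x z)

lemma mem_V_of_near {x z y : ℂ} (hz : D.R2 < ‖z‖) (hx : ‖x‖ < ‖z‖ / 2) (hy : ‖y - z‖ < ‖z‖ / 4) :
    (x, y) ∈ D.V ∧ 3 * ‖z‖ / 4 ≤ ‖y‖ := by
  have h1 : ‖z‖ ≤ ‖y‖ + ‖y - z‖ := by
    have := norm_sub_le y (y - z); simpa using this
  have := D.R2_ge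
  exact ⟨⟨show ‖x‖ < ‖y‖ by linarith, show D.R < ‖y‖ by linarith⟩, by linarith⟩

lemma Phi_near {x z y : ℂ} (hz : D.R2 < ‖z‖) (hx : ‖x‖ < ‖z‖ / 2) (hy : ‖y - z‖ < ‖z‖ / 4) :
    ‖z * Complex.exp (-D.gs (x, y)) - z‖ ≤ 6 * D.C := by
  obtain ⟨h1, h2⟩ := D.mem_V_of_near hz hx hy
  have hC := D.C_pos
  have hR := D.R2_ge
  have z0 : 0 < ‖z‖ := by linarith
  have h3 : ‖D.gs (x, y)‖ ≤ 2 * D.C / (3 * ‖z‖ / 4) := (D.gs_le h1).trans (by simp only; gcongr)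
  have h4 := D.gs_le' h1
  have h5 := Complex.norm_exp_sub_one_le (x := -D.gs (x, y)) (by rw [norm_neg]; linarith)
  rw [norm_neg] at h5
  have : z * Complex.exp (-D.gs (x, y)) - z = z * (Complex.exp (-D.gs (x, y)) - 1) := by ring
  rw [this, norm_mul]
  calc _ ≤ ‖z‖ * (2 * (2 * D.C / (3 * ‖z‖ / 4))) := by gcongr; linarith
    _ ≤ 6 * D.C := by
      have : ‖z‖ * (2 * (2 * D.C / (3 * ‖z‖ / 4))) = 16 / 3 * D.C := by field_simp; ring
      rw [this]; linarith

lemma Phi_lip {x z y y' : ℂ} (hz : D.R2 < ‖z‖) (hx : ‖x‖ < ‖z‖ / 2) (hy : ‖y - z‖ ≤ ‖z‖ / 8)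
    (hy' : ‖y' - z‖ ≤ ‖z‖ / 8) :
    ‖z * Complex.exp (-D.gs (x, y)) - z * Complex.exp (-D.gs (x, y'))‖ ≤ 1 / 2 * ‖y - y'‖ := by
  have hR := D.R2_ge
  have z0 : 0 < ‖z‖ := by linarith
  have hC := D.C_pos
  have hd : DifferentiableOn ℂ (fun y => z * Complex.exp (-D.gs (x, y)) - z) (Metric.ball z (‖z‖ / 4)) := by
    have : DifferentiableOn ℂ (fun y => D.gs (x, y)) (Metric.ball z (‖z‖ / 4)) :=
      D.differentiableOn_gs (c := fun y => (x, y)) Metric.isOpen_ball (by fun_prop)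
        (fun y hy => (D.mem_V_of_near hz hx (by simpa [dist_eq_norm] using hy)).1)
    fun_prop
  have hder : ∀ u ∈ Metric.closedBall z (‖z‖ / 8),
      ‖deriv (fun y => z * Complex.exp (-D.gs (x, y)) - z) u‖ ≤ 1 / 2 := by
    intro u hu
    have hu' : ‖u - z‖ ≤ ‖z‖ / 8 := by simpa [dist_eq_norm] using hu
    have hsub : Metric.closedBall u (‖z‖ / 16) ⊆ Metric.ball z (‖z‖ / 4) := by
      refine Metric.closedBall_subset_ball' ?_
      rw [dist_eq_norm]; linarith
    have := Complex.norm_deriv_le_of_forall_mem_sphere_norm_le (c := u) (R := ‖z‖ / 16) (C := 6 * D.C)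
      (f := fun y => z * Complex.exp (-D.gs (x, y)) - z) (by positivity)
      ((hd.mono hsub).diffContOnCl_ball (Subset.rfl))
      (fun v hv => D.Phi_near hz hx (by
        have := hsub (Metric.sphere_subset_closedBall hv); simpa [dist_eq_norm] using this))
    refine this.trans ?_
    rw [div_le_iff₀ (by positivity)]
    linarith
  have := (convex_closedBall z (‖z‖ / 8)).norm_image_sub_le_of_norm_deriv_le
    (f := fun y => z * Complex.exp (-D.gs (x, y)) - z) (C := 1 / 2)
    (fun u hu => hd.differentiableAt (Metric.isOpen_ball.mem_nhds
      (Metric.closedBall_subset_ball (by linarith) hu))) hder (x := y') (y := y)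
    (by simpa [dist_eq_norm] using hy') (by simpa [dist_eq_norm] using hy)
  simpa using this

lemma Yk_mem {x z : ℂ} (hz : D.R2 < ‖z‖) (hx : ‖x‖ < ‖z‖ / 2) (k : ℕ) : ‖D.Yk x z k - z‖ ≤ ‖z‖ / 8 := by
  have hR := D.R2_ge
  have hC := D.C_pos
  induction k with
  | zero => simp [Yk]; positivity
  | succ k ih =>
    have := D.Phi_near hz hx (y := D.Yk x z k) (by linarith)
    rw [Yk]; linarith

lemma Yk_step {x z : ℂ} (hz : D.R2 < ‖z‖) (hx : ‖x‖ < ‖z‖ / 2) (k : ℕ) :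
    dist (D.Yk x z k) (D.Yk x z (k + 1)) ≤ 6 * D.C * (1 / 2) ^ k := by
  have hR := D.R2_ge
  rw [dist_comm, dist_eq_norm]
  induction k with
  | zero =>
    have := D.Phi_near hz hx (y := z) (by rw [sub_self, norm_zero]; linarith)
    simpa [Yk] using this
  | succ k ih =>
    have := D.Phi_lip hz hx (D.Yk_mem hz hx (k + 1)) (D.Yk_mem hz hx k)
    rw [Yk, Yk]
    rw [Yk] at ih this
    refine this.trans ?_
    rw [pow_succ]; linarith

lemma Y_tendsto {x z : ℂ} (hz : D.R2 < ‖z‖) (hx : ‖x‖ < ‖z‖ / 2) :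
    Tendsto (D.Yk x z) atTop (𝓝 (D.Y x z)) ∧ ∀ k, dist (D.Yk x z k) (D.Y x z) ≤ 12 * D.C * (1 / 2) ^ k := by
  have h1 := D.Yk_step hz hx
  have hc : CauchySeq (D.Yk x z) := cauchySeq_of_le_geometric _ _ (by norm_num) h1
  have h2 : Tendsto (D.Yk x z) atTop (𝓝 (D.Y x z)) := hc.tendsto_limUnder
  refine ⟨h2, fun k => ?_⟩
  have := dist_le_of_le_geometric_of_tendsto (1 / 2) _ (by norm_num) h1 h2 k
  refine this.trans (le_of_eq ?_)
  ring

lemma Y_mem {x z : ℂ} (hz : D.R2 < ‖z‖) (hx : ‖x‖ < ‖z‖ / 2) : ‖D.Y x z - z‖ ≤ ‖z‖ / 8 := by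
  have h := ((D.Y_tendsto hz hx).1.sub_const z).norm
  exact le_of_tendsto h (Eventually.of_forall (D.Yk_mem hz hx))

lemma Y_V {x z : ℂ} (hz : D.R2 < ‖z‖) (hx : ‖x‖ < ‖z‖ / 2) : (x, D.Y x z) ∈ D.V := by
  have := D.R2_ge
  exact (D.mem_V_of_near hz hx (by linarith [D.Y_mem hz hx])).1

lemma Y_phi {x z : ℂ} (hz : D.R2 < ‖z‖) (hx : ‖x‖ < ‖z‖ / 2) : D.phi (x, D.Y x z) = z := by
  have h1 := (D.Y_tendsto hz hx).1
  have h2 : Tendsto (fun k => z * Complex.exp (-D.gs (x, D.Yk x z k))) atTop (𝓝 (z * Complex.exp (-D.gs (x, D.Y x z)))) := by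
    rw [tendsto_iff_norm_sub_tendsto_zero]
    refine squeeze_zero (fun n => norm_nonneg _)
      (fun k => D.Phi_lip hz hx (D.Yk_mem hz hx k) (D.Y_mem hz hx)) ?_
    have := (tendsto_iff_norm_sub_tendsto_zero.mp h1).const_mul (1 / 2 : ℝ)
    simpa using this
  have h3 : D.Y x z = z * Complex.exp (-D.gs (x, D.Y x z)) :=
    tendsto_nhds_unique ((tendsto_add_atTop_iff_nat 1).mpr h1) h2
  unfold phi
  simp only
  nth_rw 1 [h3]
  rw [mul_assoc, ← Complex.exp_add]; simp

lemma Y_near {x z : ℂ} (hz : D.R2 < ‖z‖) (hx : ‖x‖ < ‖z‖ / 2) : ‖D.Y x z - z‖ ≤ 4 * D.C := by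
  have := D.phi_near (D.Y_V hz hx)
  rwa [D.Y_phi hz hx] at this

lemma Y_unique {x y z : ℂ} (hz : D.R2 < ‖z‖) (hx : ‖x‖ < ‖z‖ / 2) (h : (x, y) ∈ D.V) (h' : D.phi (x, y) = z) :
    D.Y x z = y := by
  have := (D.est (D.Y_V hz hx) h (by rw [h', D.Y_phi hz hx]) (by rw [D.Y_phi hz hx]; linarith [D.R2_ge.2.2.1])).1
  simp at this
  exact sub_eq_zero.mp this

lemma differentiableOn_Y {S : Set ℂ} (hS : IsOpen S) {x z : ℂ → ℂ} (hx : DifferentiableOn ℂ x S)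
    (hz : DifferentiableOn ℂ z S) (h1 : ∀ t ∈ S, D.R2 < ‖z t‖) (h2 : ∀ t ∈ S, ‖x t‖ < ‖z t‖ / 2) :
    DifferentiableOn ℂ (fun t => D.Y (x t) (z t)) S := by
  have hk : ∀ k, DifferentiableOn ℂ (fun t => D.Yk (x t) (z t) k) S := by
    intro k
    induction k with
    | zero => simpa [Yk] using hz
    | succ k ih =>
      have : DifferentiableOn ℂ (fun t => D.gs (x t, D.Yk (x t) (z t) k)) S :=
        D.differentiableOn_gs (c := fun t => (x t, D.Yk (x t) (z t) k)) hS (hx.prodMk ih)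
          (fun t ht => (D.mem_V_of_near (h1 t ht) (h2 t ht) (by
            have := D.Yk_mem (h1 t ht) (h2 t ht) k
            have := h1 t ht
            have := D.R2_ge
            linarith)).1)
      simp only [Yk]
      fun_prop
  have hunif : TendstoLocallyUniformlyOn (fun k t => D.Yk (x t) (z t) k)
      (fun t => D.Y (x t) (z t)) atTop S := by
    refine TendstoUniformlyOn.tendstoLocallyUniformlyOn ?_
    rw [Metric.tendstoUniformlyOn_iff]
    intro η hη
    have ht : Tendsto (fun n : ℕ => 12 * D.C * (1 / 2) ^ n) atTop (𝓝 0) := by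
      have : Tendsto (fun n : ℕ => ((1 : ℝ) / 2) ^ n) atTop (𝓝 0) :=
        tendsto_pow_atTop_nhds_zero_of_lt_one (by norm_num) (by norm_num)
      simpa using (this.const_mul (12 * D.C))
    filter_upwards [ht.eventually (gt_mem_nhds hη)] with n hn t htb
    rw [dist_comm]
    exact lt_of_le_of_lt ((D.Y_tendsto (h1 t htb) (h2 t htb)).2 n) hn
  exact hunif.differentiableOn (Eventually.of_forall hk) hS

end HD

namespace HD

lemma superexp (d : ℕ) (hd : 2 ≤ d) (A : ℝ) (hA : 0 ≤ A) {s : ℝ} (hs : 0 < s) :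
    Tendsto (fun n : ℕ => A ^ n * Real.exp (-(s * (d : ℝ) ^ n))) atTop (𝓝 0) := by
  have hd1 : (1 : ℝ) < d := by exact_mod_cast (by omega : 1 < d)
  have h1 : Tendsto (fun n : ℕ => (n : ℝ) ^ 1 / (d : ℝ) ^ n) atTop (𝓝 0) :=
    tendsto_pow_const_div_const_pow_of_one_lt 1 hd1
  set B := Real.log (max A 1) with hB
  have hB0 : 0 ≤ B := Real.log_nonneg (le_max_right _ _)
  have hAB : ∀ n : ℕ, A ^ n ≤ Real.exp (n * B) := by
    intro n
    rw [Real.exp_nat_mul, Real.exp_log (lt_of_lt_of_le one_pos (le_max_right _ _))]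
    exact pow_le_pow_left₀ hA (le_max_left _ _) n
  have h2 : Tendsto (fun n : ℕ => Real.exp (-(s / 2 * (d : ℝ) ^ n))) atTop (𝓝 0) := by
    refine Real.tendsto_exp_neg_atTop_nhds_zero.comp ?_
    exact (tendsto_pow_atTop_atTop_of_one_lt hd1).const_mul_atTop (by positivity)
  refine squeeze_zero' (Eventually.of_forall fun n => by positivity) ?_ h2
  have h3 : ∀ᶠ n : ℕ in atTop, (n : ℝ) ^ 1 / (d : ℝ) ^ n < s / 2 / (B + 1) :=
    h1.eventually (gt_mem_nhds (by positivity))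
  filter_upwards [h3] with n hn
  calc _ ≤ Real.exp (n * B) * Real.exp (-(s * (d : ℝ) ^ n)) := by gcongr; exact hAB n
    _ = Real.exp (n * B + -(s * (d : ℝ) ^ n)) := (Real.exp_add _ _).symm
    _ ≤ _ := by
      apply Real.exp_le_exp.mpr
      have hp : (0 : ℝ) < (d : ℝ) ^ n := by positivity
      rw [pow_one, div_lt_div_iff₀ hp (by positivity)] at hn
      nlinarith

/-- entire injective functions are affine -/
lemma affine_of_injective {F : ℂ → ℂ} (hF : Differentiable ℂ F) (hi : Function.Injective F) :
    ∃ A : ℂ, A ≠ 0 ∧ ∀ z z', F z - F z' = A * (z - z') := by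
  obtain ⟨z0, hz0⟩ : ∃ z0, deriv F z0 ≠ 0 := by
    by_contra! h
    exact zero_ne_one (hi (is_const_of_deriv_eq_zero hF h 0 1))
  set F1 : ℂ → ℂ := fun z => F (z + z0) - F z0 with hF1
  have dF1 : Differentiable ℂ F1 := by
    have : Differentiable ℂ (fun z => F (z + z0)) := hF.comp (by fun_prop)
    exact this.sub_const _
  have F10 : F1 0 = 0 := by simp [hF1]
  have F1i : ∀ z, F1 z = 0 → z = 0 := by
    intro z hz
    have := hi (sub_eq_zero.mp hz)
    simpa using this
  set h : ℂ → ℂ := dslope F1 0 with hh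
  have dh : Differentiable ℂ h := by
    rw [← differentiableOn_univ] at dF1 ⊢
    exact (Complex.differentiableOn_dslope univ_mem).mpr dF1
  have h0 : h 0 = deriv F z0 := by
    rw [hh, dslope_same, hF1, deriv_sub_const, deriv_comp_add_const]; simp
  have hne : ∀ z, h z ≠ 0 := by
    intro z
    by_cases hz : z = 0
    · rw [hz, h0]; exact hz0
    · rw [hh, dslope_of_ne _ hz, slope_def_field]
      intro h1
      rw [F10] at h1
      rcases div_eq_zero_iff.mp h1 with h2 | h2
      · exact hz (F1i z (by simpa using h2))
      · exact hz (by simpa using h2)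
  have hzF : ∀ z, z * h z = F1 z := by
    intro z
    have := sub_smul_dslope F1 0 z
    simpa [F10] using this
  obtain ⟨r, hr, hrb⟩ : ∃ r > 0, ∀ z, 1 ≤ ‖z‖ → r ≤ ‖F1 z‖ := by
    have hfreq : ∃ᶠ z in 𝓝 (0 : ℂ), F1 z ≠ F1 0 := by
      have : ∀ᶠ z in 𝓝[≠] (0 : ℂ), F1 z ≠ F1 0 := by
        filter_upwards [self_mem_nhdsWithin] with z hz
        rw [F10]; exact fun h => hz (F1i z h)
      exact this.frequently.filter_mono nhdsWithin_le_nhds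
    have hcs : IsCompact (Metric.sphere (0 : ℂ) (1 / 2)) := isCompact_sphere _ _
    have hns : (Metric.sphere (0 : ℂ) (1 / 2)).Nonempty := NormedSpace.sphere_nonempty.mpr (by norm_num)
    obtain ⟨x, hx, hmin⟩ := hcs.exists_isMinOn hns dF1.continuous.norm.continuousOn
    have hxp : 0 < ‖F1 x‖ := by
      refine norm_pos_iff.mpr fun h => ?_
      have := F1i x h
      rw [this] at hx
      simp at hx
    have := (dF1.diffContOnCl (s := Metric.ball (0 : ℂ) (1 / 2))).ball_subset_image_closedBall (r := 1 / 2)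
      (ε := ‖F1 x‖) (by norm_num) (fun z hz => by rw [F10, sub_zero]; exact hmin hz) hfreq
    refine ⟨‖F1 x‖ / 2, by positivity, fun z hz => ?_⟩
    by_contra! hlt
    obtain ⟨z', hz', he⟩ := this (show F1 z ∈ Metric.ball (F1 0) (‖F1 x‖ / 2) by
      rw [F10]; simpa using hlt)
    have : z' = z := by
      have := hi (sub_left_injective he)
      simpa using this
    rw [this] at hz'
    simp at hz'
    linarith
  set u : ℂ → ℂ := fun z => (h z)⁻¹ with hu
  have du : Differentiable ℂ u := fun z => (dh z).inv (hne z)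
  have hub : ∀ z, 1 ≤ ‖z‖ → ‖u z‖ ≤ ‖z‖ / r := by
    intro z hz
    have h1 := hrb z hz
    rw [← hzF, norm_mul] at h1
    have h2 : 0 < ‖h z‖ := norm_pos_iff.mpr (hne z)
    rw [hu]; simp only [norm_inv]
    rw [le_div_iff₀ hr, inv_mul_le_iff₀ h2]
    linarith
  set v : ℂ → ℂ := dslope u 0 with hv
  have dv : Differentiable ℂ v := by
    rw [← differentiableOn_univ] at du ⊢
    exact (Complex.differentiableOn_dslope univ_mem).mpr du
  have huv : ∀ z, u z = u 0 + z * v z := by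
    intro z
    have := sub_smul_dslope u 0 z
    simp only [sub_zero, smul_eq_mul] at this
    rw [hv, this]; ring
  have hvb : Bornology.IsBounded (range v) := by
    obtain ⟨M, hM⟩ := (isCompact_closedBall (0 : ℂ) 1).exists_bound_of_continuousOn dv.continuous.continuousOn
    refine isBounded_iff_forall_norm_le.mpr ⟨max M (1 / r + ‖u 0‖), ?_⟩
    rintro _ ⟨z, rfl⟩
    by_cases hz : ‖z‖ ≤ 1
    · exact (hM z (by simpa using hz)).trans (le_max_left _ _)
    · push Not at hz
      refine le_trans ?_ (le_max_right _ _)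
      have h1 := hub z hz.le
      have h2 : z * v z = u z - u 0 := by rw [huv z]; ring
      have h3 : ‖z‖ * ‖v z‖ ≤ ‖u z‖ + ‖u 0‖ := by rw [← norm_mul, h2]; exact norm_sub_le _ _
      have h4 : ‖z‖ * ‖v z‖ ≤ ‖z‖ * (1 / r + ‖u 0‖) := by
        rw [mul_add, mul_one_div]
        nlinarith [norm_nonneg (u 0)]
      exact le_of_mul_le_mul_left h4 (by linarith)
  have hvc : ∀ z, v z = v 0 := fun z => dv.apply_eq_apply_of_bounded hvb z 0
  have hv0 : v 0 = 0 := by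
    by_contra hvne
    have h1 := huv (-(u 0) / v 0)
    rw [hvc (-(u 0) / v 0)] at h1
    have h2 : u (-(u 0) / v 0) = 0 := by rw [h1]; field_simp; ring
    exact inv_ne_zero (hne _) h2
  have hconst : ∀ z, h z = h 0 := by
    intro z
    have := huv z
    rw [hvc, hv0, mul_zero, add_zero] at this
    exact inv_injective this
  refine ⟨h 0, hne 0, fun z z' => ?_⟩
  have e : ∀ z, F z = F z0 + (z - z0) * h 0 := by
    intro z
    have := hzF (z - z0)
    rw [hconst] at this
    rw [this, hF1]; simp
  rw [e z, e z']; ring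

variable (D : HD)

lemma del_lower {w : ℂ} {q q' : ℂ × ℂ} (hq : D.InV w q) (hq' : D.InV w q') (hR : D.R1 ≤ ‖Complex.exp w‖) :
    ‖Complex.exp w‖ / 2 * ‖q.1 - q'.1‖ ≤ ‖D.del w q q'‖ := by
  have h := (D.en_est hq hq' hR).2 0
  simp only [en, pow_zero, one_mul, Function.iterate_zero, id, mul_one] at h
  have h1 := norm_sub_norm_le (Complex.exp w * (q.1 - q'.1)) (D.del w q q')
  rw [norm_mul] at h1
  have := D.K1_le
  nlinarith [norm_nonneg (q.1 - q'.1)]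

lemma Y_InV {x w : ℂ} (hz : D.R2 < ‖Complex.exp w‖) (hx : ‖x‖ < ‖Complex.exp w‖ / 2) :
    D.InV w (x, D.Y x (Complex.exp w)) := ⟨D.Y_V hz hx, D.Y_phi hz hx⟩

lemma L_iteri {q : ℂ × ℂ} {w : ℂ} (n : ℕ) (h : q ∈ D.L ((D.d : ℂ) ^ n * w)) : D.Hi^[n] q ∈ D.L w := by
  rw [← D.L_iter n, D.H_Hi_iter]; exact h

/-- local chart of a leaf -/
lemma chart {w : ℂ} (hw : 0 < w.re) {q0 : ℂ × ℂ} (hq0 : q0 ∈ D.L w) (z0 : ℂ) :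
    ∃ (c : ℂ → ℂ × ℂ) (S : Set ℂ) (x0 : ℂ), IsOpen S ∧ x0 ∈ S ∧ DifferentiableOn ℂ c S ∧
      (∀ x ∈ S, c x ∈ D.L w) ∧ D.del w (c x0) q0 = z0 ∧ ∃ m > 0, ∀ x ∈ S, ∀ x' ∈ S,
        m * ‖x - x'‖ ≤ ‖D.del w (c x) (c x')‖ := by
  have hR := D.R2_ge
  -- choose n
  obtain ⟨n, h1, h2, h3, h4⟩ : ∃ n, D.InV ((D.d : ℂ) ^ n * w) (D.H^[n] q0) ∧
      D.R2 < ‖Complex.exp ((D.d : ℂ) ^ n * w)‖ ∧ ‖(D.H^[n] q0).1‖ < ‖Complex.exp ((D.d : ℂ) ^ n * w)‖ / 4 ∧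
      ‖z0‖ * ‖((D.d : ℂ) / D.a) ^ n‖⁻¹ < ‖Complex.exp ((D.d : ℂ) ^ n * w)‖ ^ 2 / 32 := by
    have e1 := D.InV_of_L hq0
    have e1' := (tendsto_add_atTop_nat 1).eventually e1
    have e2 := (tendsto_add_atTop_nat 1).eventually (D.big_exp hw D.R2)
    have e3 := D.big_exp hw (4 + 8 + 32 * D.C)
    have e4 : ∀ᶠ n : ℕ in atTop, ‖z0‖ * ‖((D.d : ℂ) / D.a) ^ n‖⁻¹ < ‖Complex.exp ((D.d : ℂ) ^ n * w)‖ ^ 2 / 32 := by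
      have ht := (superexp D.d D.hd (‖(D.d : ℂ) / D.a‖⁻¹) (by positivity) (s := 2 * w.re) (by linarith)).const_mul (‖z0‖)
      rw [mul_zero] at ht
      filter_upwards [ht.eventually (gt_mem_nhds (show (0 : ℝ) < 1 / 32 by norm_num))] with n hn
      rw [Complex.norm_exp, re_dpow, norm_pow, ← inv_pow]
      have : Real.exp ((D.d : ℝ) ^ n * w.re) ^ 2 = (Real.exp (-(2 * w.re * (D.d : ℝ) ^ n)))⁻¹ := by
        rw [← Real.exp_neg, ← Real.exp_nat_mul]; congr 1; push_cast; ring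
      rw [this]
      set E := Real.exp (-(2 * w.re * (D.d : ℝ) ^ n))
      have hE : 0 < E := Real.exp_pos _
      rw [lt_div_iff₀ (by norm_num), ← one_div E, lt_div_iff₀ hE]
      linarith
    have e4' := (tendsto_add_atTop_nat 1).eventually e4
    obtain ⟨n, i0, i1, i2, i3, i4⟩ := (e1.and (e1'.and (e2.and (e3.and e4')))).exists
    refine ⟨n + 1, i1, i2, ?_, i4⟩
    have hn := D.phi_near i0.1
    rw [i0.2] at hn
    rw [iter_fst]
    set ζ := Complex.exp ((D.d : ℂ) ^ n * w)
    have hz : Complex.exp ((D.d : ℂ) ^ (n + 1) * w) = ζ ^ D.d := by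
      rw [← Complex.exp_nat_mul]; congr 1; rw [pow_succ]; ring
    rw [hz, norm_pow]
    have hp : ‖ζ‖ * ‖ζ‖ ≤ ‖ζ‖ ^ D.d := by
      rw [← sq]; exact pow_le_pow_right₀ (by linarith [D.C_pos]) D.hd
    have h5 : ‖(D.H^[n] q0).2‖ ≤ ‖(D.H^[n] q0).2 - ζ‖ + ‖ζ‖ := by
      have := norm_add_le ((D.H^[n] q0).2 - ζ) ζ; simpa using this
    nlinarith [D.C_pos]
  set W := (D.d : ℂ) ^ n * w with hW
  set ζ := Complex.exp W with hζ
  set x1 := (D.H^[n] q0).1 with hx1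
  set c : ℂ → ℂ × ℂ := fun x => D.Hi^[n] (x, D.Y x ζ) with hc
  set S := Metric.ball (0 : ℂ) (‖ζ‖ / 2) with hS
  have hζ0 : 0 < ‖ζ‖ := by linarith
  have mS : ∀ x ∈ S, ‖x‖ < ‖ζ‖ / 2 := fun x hx => by simpa [hS] using hx
  have hInV : ∀ x ∈ S, D.InV W (x, D.Y x ζ) := fun x hx => D.Y_InV h2 (mS x hx)
  have hcL : ∀ x ∈ S, c x ∈ D.L w := fun x hx => D.L_iteri n (hInV x hx).mem_L
  have dc : DifferentiableOn ℂ c S := by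
    refine (D.differentiable_iteri n).comp_differentiableOn ?_
    exact differentiableOn_id.prodMk (D.differentiableOn_Y Metric.isOpen_ball differentiableOn_id
      (differentiableOn_const ζ) (fun t _ => h2) mS)
  have hdel : ∀ x ∈ S, ∀ x' ∈ S, D.del w (c x) (c x') = ((D.d : ℂ) / D.a) ^ n * D.del W (x, D.Y x ζ) (x', D.Y x' ζ) := by
    intro x hx x' hx'
    rw [D.del_iter hw (hcL x hx) (hcL x' hx') n, hc]
    simp only [D.H_Hi_iter]
    rfl
  set m := ‖((D.d : ℂ) / D.a) ^ n‖ * (‖ζ‖ / 2) with hm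
  have hA : 0 < ‖((D.d : ℂ) / D.a) ^ n‖ := norm_pos_iff.mpr (D.a_div_ne n)
  have hm0 : 0 < m := by positivity
  have hlow : ∀ x ∈ S, ∀ x' ∈ S, m * ‖x - x'‖ ≤ ‖D.del w (c x) (c x')‖ := by
    intro x hx x' hx'
    rw [hdel x hx x' hx', norm_mul, hm, mul_assoc]
    gcongr
    exact D.del_lower (hInV x hx) (hInV x' hx') (by linarith)
  have hx1S : x1 ∈ S := by simp [hS]; linarith
  have hcx1 : c x1 = q0 := by
    have : D.Y x1 ζ = (D.H^[n] q0).2 := D.Y_unique h2 (mS _ hx1S) h1.1 h1.2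
    rw [hc]; simp only; rw [this]; exact D.Hi_H_iter n q0
  set f : ℂ → ℂ := fun x => D.del w (c x) q0 with hf
  have df : DifferentiableOn ℂ f S := D.differentiableOn_del Metric.isOpen_ball (differentiableOn_const w) dc
    (differentiableOn_const q0) (fun _ _ => hw) hcL (fun _ _ => hq0)
  have fsub : ∀ x ∈ S, ∀ x' ∈ S, f x - f x' = D.del w (c x) (c x') := by
    intro x hx x' hx'
    have := D.del_add hw (hcL x hx) (hcL x' hx') hq0
    simp only [hf]; rw [this]; ring
  have hsub : Metric.closedBall x1 (‖ζ‖ / 8) ⊆ S := by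
    refine Metric.closedBall_subset_ball' ?_
    rw [dist_zero_right]; linarith
  have hfx1 : f x1 = 0 := by simp only [hf, hcx1, del_self]
  have hfreq : ∃ᶠ x in 𝓝 x1, f x ≠ f x1 := by
    have : ∀ᶠ x in 𝓝[≠] x1, f x ≠ f x1 := by
      filter_upwards [self_mem_nhdsWithin, nhdsWithin_le_nhds (Metric.isOpen_ball.mem_nhds hx1S)] with x hx hxS
      intro he
      have := hlow x hxS x1 hx1S
      rw [← fsub x hxS x1 hx1S, he, sub_self, norm_zero] at this
      have h6 : 0 < ‖x - x1‖ := norm_pos_iff.mpr (sub_ne_zero.mpr hx)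
      nlinarith
    exact this.frequently.filter_mono nhdsWithin_le_nhds
  have him := ((df.mono hsub).diffContOnCl_ball (Subset.rfl)).ball_subset_image_closedBall
    (ε := m * (‖ζ‖ / 8)) (by positivity) (fun x hx => by
      have hxS := hsub (Metric.sphere_subset_closedBall hx)
      have := hlow x hxS x1 hx1S
      rw [← fsub x hxS x1 hx1S] at this
      have h7 : ‖x - x1‖ = ‖ζ‖ / 8 := by simpa [dist_eq_norm] using hx
      rwa [h7] at this) hfreq
  obtain ⟨x0, hx0, hx0'⟩ := him (show z0 ∈ Metric.ball (f x1) (m * (‖ζ‖ / 8) / 2) by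
    rw [hfx1, mem_ball_zero_iff]
    rw [mul_inv_lt_iff₀ hA] at h4
    rw [hm]; linarith)
  exact ⟨c, S, x0, Metric.isOpen_ball, hsub hx0, dc, hcL, hx0', m, hm0, hlow⟩

/-- affine parametrization of leaves -/
lemma leaf_param {w : ℂ} (hw : 0 < w.re) {q0 : ℂ × ℂ} (hq0 : q0 ∈ D.L w) :
    ∃ π : ℂ → ℂ × ℂ, Differentiable ℂ π ∧ (∀ z, π z ∈ D.L w) ∧ (∀ z, D.del w (π z) q0 = z) ∧
      ∀ q ∈ D.L w, π (D.del w q q0) = q := by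
  have hsurj : ∀ z, ∃ q ∈ D.L w, D.del w q q0 = z := by
    intro z
    obtain ⟨c, S, x0, _, hx0, _, hcL, hd, _⟩ := D.chart hw hq0 z
    exact ⟨c x0, hcL x0 hx0, hd⟩
  choose π hπL hπ using hsurj
  have hinv : ∀ q ∈ D.L w, π (D.del w q q0) = q := by
    intro q hq
    refine D.del_eq_zero hw (hπL _) hq ?_
    have := D.del_add hw (hπL (D.del w q q0)) hq hq0
    rw [hπ] at this
    linear_combination -this
  refine ⟨π, fun z0 => ?_, hπL, hπ, hinv⟩
  obtain ⟨c, S, x0, hS, hx0, dc, hcL, hd, m, hm, hlow⟩ := D.chart hw hq0 z0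
  set f : ℂ → ℂ := fun x => D.del w (c x) q0 with hf
  have df : DifferentiableOn ℂ f S := D.differentiableOn_del hS (differentiableOn_const w) dc
    (differentiableOn_const q0) (fun _ _ => hw) hcL (fun _ _ => hq0)
  have fsub : ∀ x ∈ S, ∀ x' ∈ S, f x - f x' = D.del w (c x) (c x') := by
    intro x hx x' hx'
    have := D.del_add hw (hcL x hx) (hcL x' hx') hq0
    simp only [hf]; rw [this]; ring
  have hst : HasStrictDerivAt f (deriv f x0) x0 :=
    (df.analyticAt (hS.mem_nhds hx0)).hasStrictDerivAt
  have hne : deriv f x0 ≠ 0 := by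
    have h1 := hst.hasDerivAt.tendsto_slope.norm
    have h2 : m ≤ ‖deriv f x0‖ := by
      refine ge_of_tendsto h1 ?_
      filter_upwards [self_mem_nhdsWithin, nhdsWithin_le_nhds (hS.mem_nhds hx0)] with x hx hxS
      have h3 := hlow x hxS x0 hx0
      rw [← fsub x hxS x0 hx0] at h3
      rw [slope_def_field, norm_div, le_div_iff₀ (norm_pos_iff.mpr (sub_ne_zero.mpr hx))]
      exact h3
    exact norm_pos_iff.mp (lt_of_lt_of_le hm h2)
  set g := hst.localInverse f (deriv f x0) x0 hne with hg
  have hgd : HasStrictDerivAt g (deriv f x0)⁻¹ (f x0) := hst.to_localInverse hne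
  have hfx0 : f x0 = z0 := hd
  have hg0 : g (f x0) = x0 := (hst.hasStrictFDerivAt_equiv hne).localInverse_apply_image
  have hfg : ∀ᶠ z in 𝓝 (f x0), f (g z) = z := (hst.hasStrictFDerivAt_equiv hne).eventually_right_inverse
  have hgS : ∀ᶠ z in 𝓝 (f x0), g z ∈ S := by
    refine hgd.hasDerivAt.continuousAt.eventually_mem ?_
    rw [hg0]; exact hS.mem_nhds hx0
  have hcomp : DifferentiableAt ℂ (fun z => c (g z)) (f x0) := by
    refine DifferentiableAt.comp (f x0) ?_ hgd.hasDerivAt.differentiableAt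
    rw [hg0]; exact dc.differentiableAt (hS.mem_nhds hx0)
  rw [← hfx0]
  refine hcomp.congr_of_eventuallyEq ?_
  filter_upwards [hfg, hgS] with z h1 h2
  rw [← hinv _ (hcL _ h2)]
  congr 1
  exact h1.symm

/-- injective holomorphic maps between leaves are affine -/
lemma leaf_affine {w w' : ℂ} (hw : 0 < w.re) (hw' : 0 < w'.re) {U : Set (ℂ × ℂ)}
    {f : ℂ × ℂ → ℂ × ℂ} (hf : DifferentiableOn ℂ f U) (hLU : D.L w ⊆ U) (hm : MapsTo f (D.L w) (D.L w'))
    (hi : InjOn f (D.L w)) (hne : (D.L w).Nonempty) :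
    ∃ A : ℂ, A ≠ 0 ∧ ∀ q ∈ D.L w, ∀ q' ∈ D.L w, D.del w' (f q) (f q') = A * D.del w q q' := by
  obtain ⟨q0, hq0⟩ := hne
  obtain ⟨π, dπ, hπL, hπ, hinv⟩ := D.leaf_param hw hq0
  set F : ℂ → ℂ := fun z => D.del w' (f (π z)) (f q0) with hF
  have dfπ : DifferentiableOn ℂ (fun z => f (π z)) univ :=
    hf.comp dπ.differentiableOn (fun z _ => hLU (hπL z))
  have dF : Differentiable ℂ F := by
    rw [← differentiableOn_univ]
    exact D.differentiableOn_del isOpen_univ (differentiableOn_const w') dfπ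
      (differentiableOn_const (f q0)) (fun _ _ => hw') (fun z _ => hm (hπL z)) (fun _ _ => hm hq0)
  have Fsub : ∀ z z', F z - F z' = D.del w' (f (π z)) (f (π z')) := by
    intro z z'
    have := D.del_add hw' (hm (hπL z)) (hm (hπL z')) (hm hq0)
    simp only [hF]; rw [this]; ring
  have Fi : Function.Injective F := by
    intro z z' h
    have h1 := Fsub z z'
    rw [h, sub_self] at h1
    have h2 := hi (hπL z) (hπL z') (D.del_eq_zero hw' (hm (hπL z)) (hm (hπL z')) h1.symm)
    rw [← hπ z, ← hπ z', h2]
  obtain ⟨A, hA, h⟩ := affine_of_injective dF Fi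
  refine ⟨A, hA, fun q hq q' hq' => ?_⟩
  have h1 := h (D.del w q q0) (D.del w q' q0)
  rw [Fsub, hinv q hq, hinv q' hq'] at h1
  rw [h1, D.del_add hw hq hq' hq0]; ring

end HD

namespace HD

variable (D : HD)

/-- threshold -/
def R0 : ℝ := Real.log D.R2

lemma R0_pos : 0 < D.R0 := Real.log_pos (by linarith [D.R2_ge])

lemma exp_big {w : ℂ} (h : D.R0 < w.re) : D.R2 < ‖Complex.exp w‖ := by
  rw [Complex.norm_exp]
  have : 0 < D.R2 := by linarith [D.R2_ge]
  rwa [← Real.log_lt_iff_lt_exp this]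

/-- transversal -/
def r0 (w : ℂ) : ℂ × ℂ := (0, D.Y 0 (Complex.exp w))

/-- pulled back transversals -/
def rr (N : ℕ) (w : ℂ) : ℂ × ℂ := D.Hi^[N] (D.r0 ((D.d : ℂ) ^ N * w))

lemma r0_InV {w : ℂ} (h : D.R0 < w.re) : D.InV w (D.r0 w) :=
  D.Y_InV (D.exp_big h) (by rw [norm_zero]; linarith [D.exp_big h, D.R2_ge])

lemma rr_zero (w : ℂ) : D.rr 0 w = D.r0 w := by simp [rr]

lemma rr_mem {N : ℕ} {w : ℂ} (h : D.R0 < ((D.d : ℂ) ^ N * w).re) : D.rr N w ∈ D.L w :=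
  D.L_iteri N (D.r0_InV h).mem_L

lemma H_rr {N M : ℕ} (w : ℂ) : D.H^[N] (D.rr (M + N) w) = D.rr M ((D.d : ℂ) ^ N * w) := by
  unfold rr
  rw [add_comm M N, Function.iterate_add_apply, D.H_Hi_iter, pow_add]
  congr 2; ring

lemma dpow_ge_one (N : ℕ) : (1 : ℝ) ≤ (D.d : ℝ) ^ N := one_le_pow₀ (by linarith [D.two_le_d])

lemma R0_lt_dpow {w : ℂ} (h : D.R0 < w.re) (N : ℕ) : D.R0 < ((D.d : ℂ) ^ N * w).re := by
  rw [re_dpow]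
  have := D.dpow_ge_one N; have := D.R0_pos
  nlinarith

lemma rr_shift (N : ℕ) (w : ℂ) (k : ℤ) : D.rr N (w + 2 * Real.pi * Complex.I * k / (D.d : ℂ) ^ N) = D.rr N w := by
  unfold rr r0
  rw [D.exp_shift w k le_rfl]

lemma rr_differentiableOn (N : ℕ) {S : Set ℂ} (hS : IsOpen S) {w : ℂ → ℂ} (hw : DifferentiableOn ℂ w S)
    (h : ∀ t ∈ S, D.R0 < ((D.d : ℂ) ^ N * w t).re) : DifferentiableOn ℂ (fun t => D.rr N (w t)) S := by
  refine (D.differentiable_iteri N).comp_differentiableOn ?_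
  refine (differentiableOn_const 0).prodMk (D.differentiableOn_Y hS (differentiableOn_const 0) (by fun_prop)
    (fun t ht => D.exp_big (h t ht)) (fun t ht => ?_))
  rw [norm_zero]; linarith [D.exp_big (h t ht), D.R2_ge]

/-- transition function -/
def T (w : ℂ) : ℂ := D.del w (D.rr 1 w) (D.rr 0 w)

lemma re_pos_of {w : ℂ} (h : D.R0 < w.re) : 0 < w.re := D.R0_pos.trans h

lemma rr_mem' {N : ℕ} {w : ℂ} (h : D.R0 < w.re) : D.rr N w ∈ D.L w := D.rr_mem (D.R0_lt_dpow h N)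

lemma T_ne {w : ℂ} (h : D.R0 < w.re) : D.T w ≠ 0 := by
  intro h0
  have h1 := D.del_eq_zero (D.re_pos_of h) (D.rr_mem' h) (D.rr_mem' h) h0
  have h2 : (D.rr 1 w).2 = 0 := by simp [rr, Hi, r0]
  rw [h1, rr_zero] at h2
  exact D.V_ne (D.r0_InV h).1 h2

lemma T_differentiableOn : DifferentiableOn ℂ D.T {w | D.R0 < w.re} := by
  have ho : IsOpen {w : ℂ | D.R0 < w.re} := isOpen_lt continuous_const Complex.continuous_re
  exact D.differentiableOn_del ho differentiableOn_id
    (D.rr_differentiableOn 1 ho differentiableOn_id (fun t ht => D.R0_lt_dpow ht 1))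
    (D.rr_differentiableOn 0 ho differentiableOn_id (fun t ht => D.R0_lt_dpow ht 0))
    (fun t ht => D.re_pos_of ht) (fun t ht => D.rr_mem' ht) (fun t ht => D.rr_mem' ht)

lemma T_periodic (w : ℂ) (k : ℤ) : D.T (w + 2 * Real.pi * Complex.I * k) = D.T w := by
  have h1 := D.rr_shift 1 w (k * D.d)
  have h0 := D.rr_shift 0 w k
  have h2 := D.del_shift w (D.rr 1 w) (D.rr 0 w) k 0
  have hd := D.d_ne
  have e : 2 * (Real.pi : ℂ) * Complex.I * ((k * D.d : ℤ) : ℂ) / (D.d : ℂ) ^ 1 = 2 * Real.pi * Complex.I * k := by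
    push_cast; field_simp
  rw [e] at h1
  rw [pow_zero, div_one] at h0 h2
  unfold T
  rw [h1, h0, h2]

lemma del_rr (N : ℕ) {w : ℂ} (h : D.R0 < w.re) :
    D.del w (D.rr N w) (D.rr 0 w) = ∑ l ∈ Finset.range N, ((D.d : ℂ) / D.a) ^ l * D.T ((D.d : ℂ) ^ l * w) := by
  have hp := D.re_pos_of h
  induction N with
  | zero => simp [del_self]
  | succ N ih =>
    rw [Finset.sum_range_succ, ← ih, D.del_add hp (D.rr_mem' h) (D.rr_mem' (N := N) h) (D.rr_mem' h), add_comm]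
    congr 1
    rw [D.del_iter hp (D.rr_mem' h) (D.rr_mem' h) N, add_comm N 1, H_rr]
    have := D.H_rr (N := N) (M := 0) w
    rw [zero_add] at this
    rw [this]; rfl

/-- constant in the asymptotics of `T` -/
def KT : ℝ := ‖(D.d : ℂ) / D.a‖ * (D.K1 * (1 + 4 * D.C) + 4 * D.C)

lemma KT_nonneg : 0 ≤ D.KT := by
  have := D.K1_pos; have := D.C_pos; unfold KT; positivity

lemma T_asymp {w : ℂ} (h : D.R0 < w.re) :
    ‖D.T w + (D.d : ℂ) / D.a * Complex.exp ((D.d + 1) * w)‖ ≤ D.KT * Real.exp (D.d * w.re) := by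
  have hp := D.re_pos_of h
  have hC := D.C_pos
  have hK := D.K1_pos
  have hb := D.exp_big h
  have hR := D.R2_ge
  set ζ := Complex.exp w with hζ
  have hd1 : D.R0 < ((D.d : ℂ) ^ 1 * w).re := D.R0_lt_dpow h 1
  have e1 : D.T w = (D.d : ℂ) / D.a * D.del ((D.d : ℂ) ^ 1 * w) (D.r0 ((D.d : ℂ) ^ 1 * w)) (D.H (D.r0 w)) := by
    unfold T
    rw [D.del_iter hp (D.rr_mem' h) (D.rr_mem' h) 1, pow_one ((D.d : ℂ) / D.a), rr_zero]
    have := D.H_rr (N := 1) (M := 0) w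
    rw [zero_add, rr_zero] at this
    rw [this]; rfl
  have i0 := D.r0_InV h
  have i1 : D.InV ((D.d : ℂ) ^ 1 * w) (D.H (D.r0 w)) := by
    refine ⟨D.H_mem_V i0.1, ?_⟩
    rw [D.phi_H i0.1, i0.2, ← Complex.exp_nat_mul, pow_one]
  have hz : Complex.exp ((D.d : ℂ) ^ 1 * w) = ζ ^ D.d := by
    rw [← Complex.exp_nat_mul, pow_one]
  have e2 := (D.en_est (D.r0_InV hd1) i1 (by linarith [D.exp_big hd1])).2 0
  simp only [en, pow_zero, one_mul, Function.iterate_zero, id, mul_one] at e2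
  rw [hz] at e2
  have e3 : (D.r0 ((D.d : ℂ) ^ 1 * w)).1 = 0 := rfl
  set y := D.Y 0 ζ with hy
  have e4 : (D.H (D.r0 w)).1 = y := rfl
  rw [e3, e4, zero_sub, norm_neg] at e2
  have e5 : ‖y - ζ‖ ≤ 4 * D.C := D.Y_near hb (by rw [norm_zero]; linarith)
  have hζ1 : 1 ≤ ‖ζ‖ := by linarith
  have e6 : ‖y‖ ≤ ‖ζ‖ + 4 * D.C := by
    have := norm_add_le (y - ζ) ζ
    rw [sub_add_cancel] at this; linarith
  have e7 : Complex.exp ((D.d + 1) * w) = ζ ^ D.d * ζ := by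
    rw [← Complex.exp_nat_mul, ← Complex.exp_add]; congr 1; ring
  have e8 : Real.exp (D.d * w.re) = ‖ζ‖ ^ D.d := by
    rw [hζ, Complex.norm_exp, ← Real.exp_nat_mul]
  have e9 : ‖ζ‖ ≤ ‖ζ‖ ^ D.d := by
    simpa using pow_le_pow_right₀ hζ1 (show 1 ≤ D.d from D.d_pos)
  have e9' : 1 ≤ ‖ζ‖ ^ D.d := hζ1.trans e9
  rw [e1, e7, e8]
  set δ := D.del ((D.d : ℂ) ^ 1 * w) (D.r0 ((D.d : ℂ) ^ 1 * w)) (D.H (D.r0 w))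
  have e10 : (D.d : ℂ) / D.a * δ + (D.d : ℂ) / D.a * (ζ ^ D.d * ζ) =
    (D.d : ℂ) / D.a * (-(ζ ^ D.d * -y - δ) - ζ ^ D.d * (y - ζ)) := by ring
  rw [e10, norm_mul]
  unfold KT
  rw [mul_assoc]
  gcongr
  calc _ ≤ ‖-(ζ ^ D.d * -y - δ)‖ + ‖ζ ^ D.d * (y - ζ)‖ := norm_sub_le _ _
    _ ≤ D.K1 * ‖y‖ + ‖ζ‖ ^ D.d * (4 * D.C) := by
      rw [norm_neg, norm_mul, norm_pow]
      gcongr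
    _ ≤ D.K1 * (‖ζ‖ ^ D.d + ‖ζ‖ ^ D.d * (4 * D.C)) + ‖ζ‖ ^ D.d * (4 * D.C) := by
      gcongr
      nlinarith
    _ = _ := by ring

/-- constant bounding `T` -/
def MT : ℝ := D.KT + ‖(D.d : ℂ) / D.a‖

lemma T_le {w : ℂ} (h : D.R0 < w.re) : ‖D.T w‖ ≤ D.MT * Real.exp ((D.d + 1) * w.re) := by
  have h1 := D.T_asymp h
  have hp := D.re_pos_of h
  have h2 : ‖(D.d : ℂ) / D.a * Complex.exp ((D.d + 1) * w)‖ = ‖(D.d : ℂ) / D.a‖ * Real.exp ((D.d + 1) * w.re) := by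
    rw [norm_mul, Complex.norm_exp]; congr 3
    have : ((D.d : ℂ) + 1) * w = (((D.d : ℝ) + 1 : ℝ) : ℂ) * w := by push_cast; rfl
    rw [this, Complex.re_ofReal_mul]
  have h3 : ‖D.T w‖ ≤ ‖D.T w + (D.d : ℂ) / D.a * Complex.exp ((D.d + 1) * w)‖ +
      ‖(D.d : ℂ) / D.a * Complex.exp ((D.d + 1) * w)‖ := by
    have := norm_sub_le (D.T w + (D.d : ℂ) / D.a * Complex.exp ((D.d + 1) * w))
      ((D.d : ℂ) / D.a * Complex.exp ((D.d + 1) * w))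
    simpa using this
  have h4 : Real.exp (D.d * w.re) ≤ Real.exp ((D.d + 1) * w.re) := by
    apply Real.exp_le_exp.mpr; linarith
  have := D.KT_nonneg
  unfold MT
  nlinarith

end HD

namespace HD

lemma line_indep {F : ℂ → ℂ} {s0 : ℝ} (hF : DifferentiableOn ℂ F {w | s0 < w.re})
    (hper : ∀ w, F (w + 2 * Real.pi * Complex.I) = F w) {σ σ' : ℝ} (h : s0 < σ) (h' : s0 < σ') :
    ∫ t in (0 : ℝ)..2 * Real.pi, F (σ + t * Complex.I) = ∫ t in (0 : ℝ)..2 * Real.pi, F (σ' + t * Complex.I) := by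
  have := Complex.integral_boundary_rect_eq_zero_of_differentiableOn F (σ : ℂ) (σ' + 2 * Real.pi * Complex.I)
    (hF.mono (by
      intro w hw
      have h1 := hw.1
      simp at h1
      have := (lt_min h h').trans_le h1.1
      exact this))
  simp at this
  have e : ∀ x : ℝ, F (x + 2 * Real.pi * Complex.I) = F x := fun x => hper x
  simp only [e] at this
  rw [sub_self, zero_add, ← mul_sub] at this
  rcases mul_eq_zero.mp this with h | h
  · exact absurd h Complex.I_ne_zero
  · exact (sub_eq_zero.mp h).symm

lemma integral_zero {g : ℝ → ℂ} (hg : Function.Periodic g (2 * Real.pi)) {c : ℝ} {ω : ℂ} (hω : ω ≠ 1)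
    (h : ∀ t, g (t + c) = ω * g t) : ∫ t in (0 : ℝ)..2 * Real.pi, g t = 0 := by
  have h1 : ∫ t in (0 : ℝ)..2 * Real.pi, g (t + c) = ∫ t in (0 : ℝ)..2 * Real.pi, g t := by
    rw [intervalIntegral.integral_comp_add_right]
    have := hg.intervalIntegral_add_eq c 0
    rw [zero_add, add_comm (2 * Real.pi) c, this, zero_add]
  simp only [h] at h1
  rw [intervalIntegral.integral_const_mul] at h1
  have : (ω - 1) * ∫ t in (0 : ℝ)..2 * Real.pi, g t = 0 := by linear_combination h1
  exact (mul_eq_zero.mp this).resolve_left (sub_ne_zero.mpr hω)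

lemma integral_scale {g : ℝ → ℂ} (hg : Function.Periodic g (2 * Real.pi)) (hc : Continuous g) {M : ℤ} (hM : M ≠ 0) (b : ℝ) :
    ∫ t in (0 : ℝ)..2 * Real.pi, g (M * t + b) = ∫ t in (0 : ℝ)..2 * Real.pi, g t := by
  have hM' : (M : ℝ) ≠ 0 := by exact_mod_cast hM
  rw [intervalIntegral.integral_comp_mul_add _ hM']
  have h1 := hg.intervalIntegral_add_zsmul_eq M b (fun _ _ => hc.intervalIntegrable _ _)
  have h2 := hg.intervalIntegral_add_eq b 0
  rw [zero_add] at h2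
  have e : (M : ℝ) * (2 * Real.pi) + b = b + M • (2 * Real.pi) := by simp; ring
  rw [mul_zero, zero_add, e, h1, h2, ← Int.cast_smul_eq_zsmul ℝ, smul_smul, inv_mul_cancel₀ hM', one_smul]

/-- Fourier type coefficient along a vertical line -/
def cf (r : ℝ) (j : ℤ) (F : ℂ → ℂ) : ℂ :=
  ∫ t in (0 : ℝ)..2 * Real.pi, F (r + t * Complex.I) * Complex.exp (-(j * (r + t * Complex.I)))

lemma exp_line_period (r : ℝ) (j : ℤ) (t : ℝ) :
    Complex.exp (-(j * (r + ((t + 2 * Real.pi : ℝ) : ℂ) * Complex.I))) = Complex.exp (-(j * (r + t * Complex.I))) := by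
  have : -((j : ℂ) * (r + ((t + 2 * Real.pi : ℝ) : ℂ) * Complex.I)) =
    -(j * (r + t * Complex.I)) + ((-j : ℤ) : ℂ) * (2 * Real.pi * Complex.I) := by push_cast; ring
  rw [this, Complex.exp_add, Complex.exp_int_mul_two_pi_mul_I, mul_one]

/-- vanishing for functions with a small period -/
lemma cf_zero (r : ℝ) (j : ℤ) {F : ℂ → ℂ} {M : ℤ} (hM : M ≠ 0) (hj : ¬ M ∣ j)
    (hper : ∀ t : ℝ, F (r + t * Complex.I + 2 * Real.pi * Complex.I / M) = F (r + t * Complex.I))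
    (hper2 : ∀ t : ℝ, F (r + t * Complex.I + 2 * Real.pi * Complex.I) = F (r + t * Complex.I)) :
    cf r j F = 0 := by
  have hM' : (M : ℂ) ≠ 0 := by exact_mod_cast hM
  refine integral_zero (c := 2 * Real.pi / M) (ω := Complex.exp (-(j * (2 * Real.pi * Complex.I) / M))) ?_ ?_ ?_
  · intro t
    dsimp only
    rw [exp_line_period]
    congr 1
    rw [← hper2 t]; congr 1; push_cast; ring
  · intro h
    obtain ⟨n, hn⟩ := Complex.exp_eq_one_iff.mp h
    apply hj
    refine ⟨-n, ?_⟩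
    have hpi : (2 * Real.pi * Complex.I : ℂ) ≠ 0 := Complex.two_pi_I_ne_zero
    have h2 : (-(j : ℂ) / M) * (2 * Real.pi * Complex.I) = n * (2 * Real.pi * Complex.I) := by
      rw [← hn]; ring
    have h3 := mul_right_cancel₀ hpi h2
    rw [div_eq_iff hM'] at h3
    have h4 : (j : ℂ) = ((M * -n : ℤ) : ℂ) := by push_cast; linear_combination -h3
    exact_mod_cast h4
  · intro t
    have e : (r : ℂ) + ((t + 2 * Real.pi / M : ℝ) : ℂ) * Complex.I = r + t * Complex.I + 2 * Real.pi * Complex.I / M := by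
      push_cast; ring
    rw [e, hper, mul_left_comm]
    congr 1
    rw [← Complex.exp_add]; congr 1; ring

lemma cf_le (r : ℝ) (j : ℤ) {F : ℂ → ℂ} {B : ℝ} (h : ∀ t ∈ Icc (0 : ℝ) (2 * Real.pi), ‖F (r + t * Complex.I)‖ ≤ B) :
    ‖cf r j F‖ ≤ 2 * Real.pi * B * Real.exp (-(j * r)) := by
  have hpi := Real.pi_pos
  have := intervalIntegral.norm_integral_le_of_norm_le_const (a := (0 : ℝ)) (b := 2 * Real.pi)
    (C := B * Real.exp (-(j * r)))
    (f := fun t : ℝ => F (r + t * Complex.I) * Complex.exp (-(j * (r + t * Complex.I)))) (by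
      intro t ht
      rw [uIoc_of_le (by positivity)] at ht
      rw [norm_mul, Complex.norm_exp]
      have : (-((j : ℂ) * (r + t * Complex.I))).re = -(j * r) := by simp
      rw [this]
      gcongr
      exact h t ⟨ht.1.le, ht.2⟩)
  refine this.trans (le_of_eq ?_)
  rw [sub_zero, abs_of_pos (by positivity)]; ring

variable (D : HD)

/-- Laurent coefficients of `T` -/
def J (i : ℤ) : ℂ := cf (D.R0 + 1) i D.T

lemma cf_T {σ : ℝ} (h : D.R0 < σ) (i : ℤ) : cf σ i D.T = D.J i := by
  have hd : DifferentiableOn ℂ (fun w => D.T w * Complex.exp (-(i * w))) {w | D.R0 < w.re} := by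
    have := D.T_differentiableOn
    fun_prop
  have hp : ∀ w, D.T (w + 2 * Real.pi * Complex.I) * Complex.exp (-(i * (w + 2 * Real.pi * Complex.I))) =
      D.T w * Complex.exp (-(i * w)) := by
    intro w
    have h1 := D.T_periodic w 1
    simp only [Int.cast_one, mul_one] at h1
    rw [h1]
    congr 1
    have : -((i : ℂ) * (w + 2 * Real.pi * Complex.I)) = -(i * w) + ((-i : ℤ) : ℂ) * (2 * Real.pi * Complex.I) := by
      push_cast; ring
    rw [this, Complex.exp_add, Complex.exp_int_mul_two_pi_mul_I, mul_one]
  have := line_indep hd hp h (σ' := D.R0 + 1) (by linarith)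
  unfold J cf
  rw [this]

lemma J_le {σ : ℝ} (h : D.R0 < σ) (i : ℤ) :
    ‖D.J i‖ ≤ 2 * Real.pi * D.MT * Real.exp ((D.d + 1 - i) * σ) := by
  rw [← D.cf_T h]
  refine (cf_le σ i (B := D.MT * Real.exp ((D.d + 1) * σ)) (fun t _ => ?_)).trans (le_of_eq ?_)
  · have := D.T_le (w := σ + t * Complex.I) (by simpa using h)
    simpa using this
  · rw [← mul_assoc, mul_assoc _ (Real.exp _), ← Real.exp_add]; congr 2; ring

lemma J_zero {i : ℤ} (hi : (D.d : ℤ) + 1 < i) : D.J i = 0 := by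
  rw [← norm_le_zero_iff]
  have hi' : (D.d : ℝ) + 1 < i := by exact_mod_cast hi
  have ht : Tendsto (fun σ : ℝ => 2 * Real.pi * D.MT * Real.exp ((D.d + 1 - i) * σ)) atTop (𝓝 0) := by
    have h1 : Tendsto (fun σ : ℝ => ((D.d : ℝ) + 1 - i) * σ) atTop atBot :=
      tendsto_id.const_mul_atTop_of_neg (by linarith)
    simpa using (Real.tendsto_exp_atBot.comp h1).const_mul (2 * Real.pi * D.MT)
  refine ge_of_tendsto ht ?_
  filter_upwards [eventually_gt_atTop D.R0] with σ hσ
  exact D.J_le hσ i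

lemma line_continuous (σ : ℝ) : Continuous (fun t : ℝ => (σ : ℂ) + t * Complex.I) := by fun_prop

lemma T_line_continuous {σ : ℝ} (h : D.R0 < σ) : Continuous (fun t : ℝ => D.T (σ + t * Complex.I)) :=
  D.T_differentiableOn.continuousOn.comp_continuous (line_continuous σ) (fun t => by simpa using h)

lemma J_top : D.J (D.d + 1) = -(2 * Real.pi * (D.d / D.a)) := by
  rw [← sub_eq_zero, ← norm_le_zero_iff]
  have hpi := Real.pi_pos
  have ht : Tendsto (fun σ : ℝ => 2 * Real.pi * D.KT * Real.exp (-σ)) atTop (𝓝 0) := by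
    simpa using Real.tendsto_exp_neg_atTop_nhds_zero.const_mul (2 * Real.pi * D.KT)
  refine ge_of_tendsto ht ?_
  filter_upwards [eventually_gt_atTop D.R0] with σ hσ
  rw [← D.cf_T hσ]
  have e1 : cf σ (D.d + 1) D.T - -(2 * Real.pi * (D.d / D.a)) =
      cf σ (D.d + 1) (fun w => D.T w + (D.d : ℂ) / D.a * Complex.exp ((D.d + 1) * w)) := by
    have hT := D.T_line_continuous hσ
    unfold cf
    simp only [add_mul]
    rw [intervalIntegral.integral_add]
    · have : ∀ t : ℝ, (D.d : ℂ) / D.a * Complex.exp ((D.d + 1) * (σ + t * Complex.I)) *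
          Complex.exp (-(((D.d + 1 : ℤ) : ℂ) * (σ + t * Complex.I))) = (D.d : ℂ) / D.a := by
        intro t
        rw [mul_assoc, ← Complex.exp_add]; push_cast; rw [add_neg_cancel]; simp
      simp only [add_mul] at this
      simp only [this]
      rw [intervalIntegral.integral_const]; simp
    · apply Continuous.intervalIntegrable; fun_prop
    · apply Continuous.intervalIntegrable; fun_prop
  rw [e1]
  refine (cf_le σ (D.d + 1) (B := D.KT * Real.exp (D.d * σ)) (fun t _ => ?_)).trans (le_of_eq ?_)
  · have := D.T_asymp (w := σ + t * Complex.I) (by simpa using hσ)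
    simpa using this
  · rw [← mul_assoc, mul_assoc _ (Real.exp _), ← Real.exp_add]; congr 2; push_cast; ring

/-- coefficients of `T (M w + b)` -/
lemma cf_T_zero (r : ℝ) {M : ℤ} (hM : M ≠ 0) (b : ℂ) {j : ℤ} (hj : ¬ M ∣ j) :
    cf r j (fun w => D.T (M * w + b)) = 0 := by
  have hM' : (M : ℂ) ≠ 0 := by exact_mod_cast hM
  refine cf_zero r j hM hj (fun t => ?_) (fun t => ?_)
  · rw [← D.T_periodic (M * (r + t * Complex.I) + b) 1]
    congr 1; field_simp; push_cast; ring
  · rw [← D.T_periodic (M * (r + t * Complex.I) + b) M]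
    congr 1; ring

lemma cf_T_mul {r : ℝ} {M : ℤ} (hM : M ≠ 0) (b : ℂ) (hr : D.R0 < M * r + b.re) (i : ℤ) :
    cf r (i * M) (fun w => D.T (M * w + b)) = Complex.exp (i * b) * D.J i := by
  set σ := M * r + b.re with hσ
  rw [← D.cf_T hr]
  have hT := D.T_line_continuous hr
  set g : ℝ → ℂ := fun s => D.T (σ + s * Complex.I) * Complex.exp (-(i * (σ + s * Complex.I))) with hg
  have gper : Function.Periodic g (2 * Real.pi) := by
    intro s
    simp only [hg]
    rw [exp_line_period]
    congr 1
    rw [← D.T_periodic (σ + s * Complex.I) 1]; congr 1; push_cast; ring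
  have gc : Continuous g := by
    simp only [hg]; fun_prop
  have h1 := integral_scale gper gc hM b.im
  unfold cf
  change _ = Complex.exp (i * b) * ∫ t in (0 : ℝ)..2 * Real.pi, g t
  rw [← h1, ← intervalIntegral.integral_const_mul]
  congr 1
  funext t
  simp only [hg]
  have e : (σ : ℂ) + ((M * t + b.im : ℝ) : ℂ) * Complex.I = M * (r + t * Complex.I) + b := by
    rw [hσ]; push_cast
    conv_rhs => rw [← Complex.re_add_im b]
    ring
  rw [e, mul_left_comm, ← Complex.exp_add]
  congr 2
  push_cast; ring

end HD

namespace HD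

variable (D : HD)

lemma dense_const {X : Type*} [TopologicalSpace X] [T2Space X] {g : ℝ → X} (hg : Continuous g)
    (h : ∀ (t : ℝ) (k : ℤ) (n : ℕ), g (t + 2 * Real.pi * k / (D.d : ℝ) ^ n) = g t) (s t : ℝ) : g s = g t := by
  have hpi := Real.pi_pos
  set u : ℕ → ℝ := fun n => t + 2 * Real.pi * (⌊(s - t) * (D.d : ℝ) ^ n / (2 * Real.pi)⌋ : ℤ) / (D.d : ℝ) ^ n with hu
  have h1 : Tendsto u atTop (𝓝 s) := by
    have h2 : Tendsto (fun n => 2 * Real.pi * ((D.d : ℝ) ^ n)⁻¹) atTop (𝓝 0) := by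
      simpa using D.tendsto_dpow.inv_tendsto_atTop.const_mul (2 * Real.pi)
    rw [tendsto_iff_dist_tendsto_zero]
    refine squeeze_zero (fun _ => dist_nonneg) (fun n => ?_) h2
    have hp := D.dpow_pos n
    have f1 := Int.floor_le ((s - t) * (D.d : ℝ) ^ n / (2 * Real.pi))
    have f2 := Int.lt_floor_add_one ((s - t) * (D.d : ℝ) ^ n / (2 * Real.pi))
    set k : ℝ := ((⌊(s - t) * (D.d : ℝ) ^ n / (2 * Real.pi)⌋ : ℤ) : ℝ) with hk
    rw [le_div_iff₀ (by positivity)] at f1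
    rw [div_lt_iff₀ (by positivity)] at f2
    have e : u n - s = (2 * Real.pi * k - (s - t) * (D.d : ℝ) ^ n) * ((D.d : ℝ) ^ n)⁻¹ := by
      simp only [hu, ← hk]; field_simp; ring
    rw [Real.dist_eq, e, abs_mul, abs_of_pos (inv_pos.mpr hp)]
    gcongr
    rw [abs_le]; constructor <;> linarith
  have h3 : Tendsto (fun n => g (u n)) atTop (𝓝 (g s)) := (hg.tendsto s).comp h1
  have h4 : (fun n => g (u n)) = fun _ => g t := by
    funext n; simp only [hu]; exact h _ _ _
  rw [h4] at h3
  exact tendsto_nhds_unique h3 tendsto_const_nhds |>.symm ▸ rfl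

/-- hypotheses of the main rigidity lemma -/
structure MainHyp (f : ℂ × ℂ → ℂ × ℂ) (U : Set (ℂ × ℂ)) (r ε : ℝ) (m : ℤ) (β : ℂ) : Prop where
  eps : 0 < ε
  hf : DifferentiableOn ℂ f U
  h1 : ∀ w : ℂ, |w.re - r| < ε → D.R0 < w.re
  h2 : ∀ w : ℂ, |w.re - r| < ε → D.R0 < (m * w + β).re
  hL : ∀ w : ℂ, |w.re - r| < ε → D.L w ⊆ U
  hm : ∀ w : ℂ, |w.re - r| < ε → MapsTo f (D.L w) (D.L (m * w + β))
  hi : ∀ w : ℂ, |w.re - r| < ε → InjOn f (D.L w)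

variable {D}
variable {f : ℂ × ℂ → ℂ × ℂ} {U : Set (ℂ × ℂ)} {r ε : ℝ} {m : ℤ} {β : ℂ}

lemma MainHyp.isOpen (r ε : ℝ) : IsOpen {w : ℂ | |w.re - r| < ε} :=
  isOpen_lt (by fun_prop) continuous_const

lemma MainHyp.diff_del (h : MainHyp D f U r ε m β) (N N' : ℕ) :
    DifferentiableOn ℂ (fun w => D.del (m * w + β) (f (D.rr N w)) (f (D.rr N' w))) {w : ℂ | |w.re - r| < ε} := by
  have ho := MainHyp.isOpen r ε
  have hr : ∀ N, DifferentiableOn ℂ (fun w => f (D.rr N w)) {w : ℂ | |w.re - r| < ε} := fun N =>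
    h.hf.comp (D.rr_differentiableOn N ho differentiableOn_id (fun t ht => D.R0_lt_dpow (h.h1 t ht) N))
      (fun w hw => h.hL w hw (D.rr_mem' (h.h1 w hw)))
  exact D.differentiableOn_del ho (by fun_prop) (hr N) (hr N') (fun w hw => D.re_pos_of (h.h2 w hw))
    (fun w hw => h.hm w hw (D.rr_mem' (h.h1 w hw))) (fun w hw => h.hm w hw (D.rr_mem' (h.h1 w hw)))

/-- the comparison functions -/
def Bf (D : HD) (f : ℂ × ℂ → ℂ × ℂ) (m : ℤ) (β : ℂ) (N : ℕ) (w : ℂ) : ℂ :=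
  D.del (m * w + β) (f (D.rr N w)) (D.rr N (m * w + β))

lemma MainHyp.diff_B (h : MainHyp D f U r ε m β) (N : ℕ) :
    DifferentiableOn ℂ (D.Bf f m β N) {w : ℂ | |w.re - r| < ε} := by
  have ho := MainHyp.isOpen r ε
  have hr : DifferentiableOn ℂ (fun w => f (D.rr N w)) {w : ℂ | |w.re - r| < ε} :=
    h.hf.comp (D.rr_differentiableOn N ho differentiableOn_id (fun t ht => D.R0_lt_dpow (h.h1 t ht) N))
      (fun w hw => h.hL w hw (D.rr_mem' (h.h1 w hw)))
  exact D.differentiableOn_del ho (by fun_prop) hr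
    (D.rr_differentiableOn N ho (by fun_prop) (fun t ht => D.R0_lt_dpow (h.h2 t ht) N))
    (fun w hw => D.re_pos_of (h.h2 w hw))
    (fun w hw => h.hm w hw (D.rr_mem' (h.h1 w hw))) (fun w hw => D.rr_mem' (h.h2 w hw))

lemma Bf_shift (N : ℕ) (w : ℂ) (k : ℤ) :
    D.Bf f m β N (w + 2 * Real.pi * Complex.I * k / (D.d : ℂ) ^ N) = D.Bf f m β N w := by
  unfold Bf
  have e : (m : ℂ) * (w + 2 * Real.pi * Complex.I * k / (D.d : ℂ) ^ N) + β =
    m * w + β + 2 * Real.pi * Complex.I * ((m * k : ℤ) : ℂ) / (D.d : ℂ) ^ N := by push_cast; ring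
  rw [e, D.rr_shift, D.rr_shift, D.del_shift]

lemma MainHyp.exists_A (h : MainHyp D f U r ε m β) : ∃ A : ℂ, A ≠ 0 ∧ ∀ w : ℂ, w.re = r →
    ∀ q ∈ D.L w, ∀ q' ∈ D.L w, D.del (m * w + β) (f q) (f q') = A * D.del w q q' := by
  have ho := MainHyp.isOpen r ε
  have hA : ∀ w : ℂ, ∃ A : ℂ, |w.re - r| < ε → A ≠ 0 ∧ ∀ q ∈ D.L w, ∀ q' ∈ D.L w,
      D.del (m * w + β) (f q) (f q') = A * D.del w q q' := by
    intro w
    by_cases hw : |w.re - r| < ε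
    · obtain ⟨A, h1, h2⟩ := D.leaf_affine (D.re_pos_of (h.h1 w hw)) (D.re_pos_of (h.h2 w hw)) h.hf (h.hL w hw)
        (h.hm w hw) (h.hi w hw) ⟨_, D.rr_mem' (N := 0) (h.h1 w hw)⟩
      exact ⟨A, fun _ => ⟨h1, h2⟩⟩
    · exact ⟨0, fun h => absurd h hw⟩
  choose A hA using hA
  have hline : ∀ t : ℝ, |((r : ℂ) + t * Complex.I).re - r| < ε := by intro t; simpa using h.eps
  have e1 : ∀ w : ℂ, |w.re - r| < ε → A w = D.del (m * w + β) (f (D.rr 1 w)) (f (D.rr 0 w)) / D.T w := by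
    intro w hw
    rw [(hA w hw).2 _ (D.rr_mem' (h.h1 w hw)) _ (D.rr_mem' (h.h1 w hw))]
    exact (mul_div_cancel_right₀ _ (D.T_ne (h.h1 w hw))).symm
  have hc : Continuous (fun t : ℝ => A (r + t * Complex.I)) := by
    have : ContinuousOn (fun w => D.del (m * w + β) (f (D.rr 1 w)) (f (D.rr 0 w)) / D.T w) {w : ℂ | |w.re - r| < ε} :=
      (h.diff_del 1 0).continuousOn.div (D.T_differentiableOn.continuousOn.mono (fun w hw => h.h1 w hw))
        (fun w hw => D.T_ne (h.h1 w hw))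
    have h3 := this.comp_continuous (line_continuous r) hline
    refine h3.congr (fun t => ?_)
    exact (e1 _ (hline t)).symm
  have hinv : ∀ (t : ℝ) (k : ℤ) (n : ℕ), A (r + ((t + 2 * Real.pi * k / (D.d : ℝ) ^ n : ℝ) : ℂ) * Complex.I) =
      A (r + t * Complex.I) := by
    intro t k n
    set w : ℂ := r + t * Complex.I with hw
    have ew : (r : ℂ) + ((t + 2 * Real.pi * k / (D.d : ℝ) ^ n : ℝ) : ℂ) * Complex.I =
        w + 2 * Real.pi * Complex.I * k / (D.d : ℂ) ^ n := by rw [hw]; push_cast; ring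
    have hs := hline (t + 2 * Real.pi * k / (D.d : ℝ) ^ n)
    have hwS := hline t
    rw [← hw] at hwS
    rw [ew] at hs ⊢
    have g1 := (hA w hwS).2 _ (D.rr_mem' (N := 1) (h.h1 w hwS)) _ (D.rr_mem' (N := 0) (h.h1 w hwS))
    have g2 := (hA _ hs).2 (D.rr 1 w) (by rw [D.L_shift]; exact D.rr_mem' (h.h1 w hwS)) (D.rr 0 w)
      (by rw [D.L_shift]; exact D.rr_mem' (h.h1 w hwS))
    have e : (m : ℂ) * (w + 2 * Real.pi * Complex.I * k / (D.d : ℂ) ^ n) + β =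
      m * w + β + 2 * Real.pi * Complex.I * ((m * k : ℤ) : ℂ) / (D.d : ℂ) ^ n := by push_cast; ring
    rw [e, D.del_shift, D.del_shift, g1] at g2
    exact (mul_right_cancel₀ (D.T_ne (h.h1 w hwS)) g2).symm
  have hconst := D.dense_const hc hinv
  refine ⟨A r, (hA r (by simpa using h.eps)).1, fun w hw q hq q' hq' => ?_⟩
  have ew : w = (r : ℂ) + (w.im : ℝ) * Complex.I := by rw [← hw]; exact (Complex.re_add_im w).symm
  have h3 := hconst w.im 0
  simp only [← ew, Complex.ofReal_zero, zero_mul, add_zero] at h3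
  rw [← h3]
  exact (hA w (by rw [hw]; simpa using h.eps)).2 q hq q' hq'

lemma MainHyp.B_rel (h : MainHyp D f U r ε m β) {A : ℂ} (hA : ∀ w : ℂ, w.re = r →
    ∀ q ∈ D.L w, ∀ q' ∈ D.L w, D.del (m * w + β) (f q) (f q') = A * D.del w q q') (N : ℕ) {w : ℂ} (hw : w.re = r) :
    D.Bf f m β N w = A * (∑ l ∈ Finset.range N, ((D.d : ℂ) / D.a) ^ l * D.T ((D.d : ℂ) ^ l * w)) + D.Bf f m β 0 w
      - ∑ l ∈ Finset.range N, ((D.d : ℂ) / D.a) ^ l * D.T ((D.d : ℂ) ^ l * (m * w + β)) := by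
  have hwS : |w.re - r| < ε := by rw [hw]; simpa using h.eps
  have a1 := h.h1 w hwS
  have a2 := h.h2 w hwS
  have m1 : ∀ N, f (D.rr N w) ∈ D.L (m * w + β) := fun N => h.hm w hwS (D.rr_mem' a1)
  have m2 : ∀ N, D.rr N (m * w + β) ∈ D.L (m * w + β) := fun N => D.rr_mem' a2
  have p2 := D.re_pos_of a2
  rw [← D.del_rr N a1, ← D.del_rr N a2, ← hA w hw _ (D.rr_mem' a1) _ (D.rr_mem' a1)]
  unfold Bf
  have g1 := D.del_add p2 (m1 N) (m1 0) (m2 N)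
  have g2 := D.del_add p2 (m1 0) (m2 N) (m2 0)
  rw [g1, g2]; ring

end HD

namespace HD

lemma cf_congr (r : ℝ) (j : ℤ) {F F' : ℂ → ℂ} (h : ∀ t : ℝ, F (r + t * Complex.I) = F' (r + t * Complex.I)) :
    cf r j F = cf r j F' := by
  unfold cf; simp only [h]

lemma cf_intble (r : ℝ) (j : ℤ) {F : ℂ → ℂ} (h : Continuous (fun t : ℝ => F (r + t * Complex.I))) :
    IntervalIntegrable (fun t : ℝ => F (r + t * Complex.I) * Complex.exp (-(j * (r + t * Complex.I))))
      MeasureTheory.volume 0 (2 * Real.pi) := by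
  exact (h.mul (by fun_prop)).intervalIntegrable _ _

lemma cf_add (r : ℝ) (j : ℤ) {F F' : ℂ → ℂ} (h : Continuous (fun t : ℝ => F (r + t * Complex.I)))
    (h' : Continuous (fun t : ℝ => F' (r + t * Complex.I))) :
    cf r j (fun w => F w + F' w) = cf r j F + cf r j F' := by
  unfold cf
  simp only [add_mul]
  have := intervalIntegral.integral_add (cf_intble r j h) (cf_intble r j h')
  simpa only [add_mul] using this

lemma cf_mul (r : ℝ) (j : ℤ) (F : ℂ → ℂ) (c : ℂ) : cf r j (fun w => c * F w) = c * cf r j F := by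
  unfold cf
  simp only [mul_assoc]
  rw [intervalIntegral.integral_const_mul]

lemma cf_sum (r : ℝ) (j : ℤ) (N : ℕ) {F : ℕ → ℂ → ℂ} (h : ∀ l, Continuous (fun t : ℝ => F l (r + t * Complex.I))) :
    cf r j (fun w => ∑ l ∈ Finset.range N, F l w) = ∑ l ∈ Finset.range N, cf r j (F l) := by
  induction N with
  | zero => simp [cf]
  | succ N ih =>
    simp only [Finset.sum_range_succ]
    rw [cf_add r j (continuous_finsetSum _ (fun l _ => h l)) (h N), ih]

variable {D : HD}
variable {f : ℂ × ℂ → ℂ × ℂ} {U : Set (ℂ × ℂ)} {r ε : ℝ} {m : ℤ} {β : ℂ}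

lemma MT_nonneg : 0 ≤ D.MT := by have := D.KT_nonneg; unfold MT; positivity

lemma d_int_pow_ne (l : ℕ) : (D.d : ℤ) ^ l ≠ 0 := pow_ne_zero _ (by have := D.d_pos; omega)

lemma coef_arith {l l0 K : ℕ} (hm : m ∣ (D.d : ℤ) ^ K) (hdiv : (D.d : ℤ) ^ l * m ∣ ((D.d : ℤ) + 1) * (D.d : ℤ) ^ l0) :
    ∃ i : ℤ, (((D.d : ℤ) + 1) * i) * ((D.d : ℤ) ^ l * m) = ((D.d : ℤ) + 1) * (D.d : ℤ) ^ l0 ∧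
      i * ((D.d : ℤ) ^ l * m) = (D.d : ℤ) ^ l0 := by
  obtain ⟨i, hi⟩ := hdiv
  have hc : IsCoprime ((D.d : ℤ) + 1) ((D.d : ℤ) ^ l * m) := by
    have h0 : IsCoprime ((D.d : ℤ) + 1) (D.d : ℤ) := ⟨1, -1, by ring⟩
    exact (h0.pow_right).mul_right ((h0.pow_right (n := K)).of_isCoprime_of_dvd_right hm)
  have h1 : ((D.d : ℤ) + 1) ∣ i := hc.dvd_of_dvd_mul_left ⟨_, hi.symm⟩
  obtain ⟨i', rfl⟩ := h1
  refine ⟨i', by rw [hi]; ring, ?_⟩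
  have hne : ((D.d : ℤ) + 1) ≠ 0 := by omega
  apply mul_left_cancel₀ hne
  rw [hi]; ring

lemma coef_first {l l0 : ℕ} (hl : l ≤ l0) (hr : D.R0 < r) :
    cf r (((D.d : ℤ) + 1) * (D.d : ℤ) ^ l0) (fun w => D.T ((D.d : ℂ) ^ l * w)) = if l = l0 then D.J (D.d + 1) else 0 := by
  have h := D.cf_T_mul (r := r) (M := (D.d : ℤ) ^ l) (d_int_pow_ne l) 0 (by
    have := D.dpow_ge_one l
    have := D.R0_pos
    push_cast; simp; nlinarith) (((D.d : ℤ) + 1) * (D.d : ℤ) ^ (l0 - l))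
  have e : ((D.d : ℤ) + 1) * (D.d : ℤ) ^ (l0 - l) * (D.d : ℤ) ^ l = ((D.d : ℤ) + 1) * (D.d : ℤ) ^ l0 := by
    rw [mul_assoc, ← pow_add, Nat.sub_add_cancel hl]
  rw [e] at h
  simp only [add_zero, mul_zero, Complex.exp_zero, one_mul] at h
  push_cast at h
  rw [h]
  split_ifs with hll
  · subst hll; simp
  · apply J_zero
    have : (D.d : ℤ) ≤ (D.d : ℤ) ^ (l0 - l) := by
      have h2 : 1 ≤ l0 - l := by omega
      have hd := D.d_pos
      calc (D.d : ℤ) = (D.d : ℤ) ^ 1 := (pow_one _).symm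
        _ ≤ _ := pow_le_pow_right₀ (by omega) h2
    have hd := D.hd
    nlinarith

lemma coef_second {l l0 K : ℕ} (hm0 : m ≠ 0) (hm : m ∣ (D.d : ℤ) ^ K) (hs : D.R0 < m * r + β.re)
    (hne : (D.d : ℤ) ^ l * m ≠ (D.d : ℤ) ^ l0) :
    ‖cf r (((D.d : ℤ) + 1) * (D.d : ℤ) ^ l0) (fun w => D.T ((D.d : ℂ) ^ l * (m * w + β)))‖ ≤
      2 * Real.pi * D.MT * Real.exp ((D.d + 1) * (m * r + β.re)) * Real.exp (-((D.d + 1) * r * D.d ^ l0)) := by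
  have hpi := Real.pi_pos
  have hMT := MT_nonneg (D := D)
  have hM : (D.d : ℤ) ^ l * m ≠ 0 := mul_ne_zero (d_int_pow_ne l) hm0
  have e0 : (fun w => D.T ((D.d : ℂ) ^ l * (m * w + β))) =
      fun w => D.T ((((D.d : ℤ) ^ l * m : ℤ) : ℂ) * w + (D.d : ℂ) ^ l * β) := by
    funext w; congr 1; push_cast; ring
  rw [e0]
  by_cases hdiv : (D.d : ℤ) ^ l * m ∣ ((D.d : ℤ) + 1) * (D.d : ℤ) ^ l0
  swap
  · rw [D.cf_T_zero r hM _ hdiv, norm_zero]; positivity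
  obtain ⟨i, hi1, hi2⟩ := coef_arith hm hdiv
  have hs' : D.R0 < (((D.d : ℤ) ^ l * m : ℤ) : ℝ) * r + ((D.d : ℂ) ^ l * β).re := by
    rw [re_dpow]; push_cast
    have := D.dpow_ge_one l
    have := D.R0_pos
    have e : (D.d : ℝ) ^ l * m * r + D.d ^ l * β.re = D.d ^ l * (m * r + β.re) := by ring
    rw [e]; nlinarith
  rw [← hi1, D.cf_T_mul hM _ hs']
  rcases lt_trichotomy i 0 with hi | hi | hi
  · rw [norm_mul, Complex.norm_exp]
    have h1 := D.J_le hs (((D.d : ℤ) + 1) * i)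
    have e1 : ((((D.d : ℤ) + 1) * i : ℤ) * ((D.d : ℂ) ^ l * β)).re = ((D.d + 1) * i : ℝ) * (D.d ^ l * β.re) := by
      rw [← re_dpow]
      have : ((((D.d : ℤ) + 1) * i : ℤ) : ℂ) = (((D.d + 1) * i : ℝ) : ℂ) := by push_cast; rfl
      rw [this, Complex.re_ofReal_mul]
    rw [e1]
    calc _ ≤ Real.exp (((D.d + 1) * i : ℝ) * (D.d ^ l * β.re)) *
          (2 * Real.pi * D.MT * Real.exp ((D.d + 1 - (((D.d : ℤ) + 1) * i : ℤ)) * (m * r + β.re))) := by gcongr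
      _ = 2 * Real.pi * D.MT * Real.exp ((D.d + 1) * (m * r + β.re)) *
          Real.exp (((D.d + 1) * i : ℝ) * (D.d ^ l * β.re) - ((D.d + 1) * i) * (m * r + β.re)) := by
        rw [mul_left_comm, ← Real.exp_add, mul_assoc _ (Real.exp _), ← Real.exp_add]
        congr 2; push_cast; ring
      _ ≤ _ := by
        gcongr
        have hi2' : (i : ℝ) * (D.d ^ l * m) = D.d ^ l0 := by exact_mod_cast hi2
        rw [← hi2']
        have hi' : (i : ℝ) < 0 := by exact_mod_cast hi
        have h3 : 0 ≤ ((D.d : ℝ) ^ l - 1) * (m * r + β.re) :=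
          mul_nonneg (by linarith [D.dpow_ge_one l]) (by linarith [D.R0_pos])
        have h4 : ((D.d : ℝ) + 1) * i * (((D.d : ℝ) ^ l - 1) * (m * r + β.re)) ≤ 0 :=
          mul_nonpos_of_nonpos_of_nonneg (mul_nonpos_of_nonneg_of_nonpos (by positivity) hi'.le) h3
        linarith
  · rw [hi, zero_mul] at hi2
    exact absurd hi2.symm (d_int_pow_ne l0)
  · have hi' : 2 ≤ i := by
      by_contra h
      have : i = 1 := by omega
      rw [this, one_mul] at hi2
      exact hne hi2
    rw [J_zero, mul_zero, norm_zero]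
    · positivity
    · have := D.d_pos
      nlinarith

lemma coef_eq {l l0 : ℕ} (hm0 : m ≠ 0) (hs : D.R0 < m * r + β.re)
    (he : (D.d : ℤ) ^ l * m = (D.d : ℤ) ^ l0) :
    cf r (((D.d : ℤ) + 1) * (D.d : ℤ) ^ l0) (fun w => D.T ((D.d : ℂ) ^ l * (m * w + β))) =
      Complex.exp ((D.d + 1) * ((D.d : ℂ) ^ l * β)) * D.J (D.d + 1) := by
  have hM : (D.d : ℤ) ^ l * m ≠ 0 := mul_ne_zero (d_int_pow_ne l) hm0
  have e0 : (fun w => D.T ((D.d : ℂ) ^ l * (m * w + β))) =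
      fun w => D.T ((((D.d : ℤ) ^ l * m : ℤ) : ℂ) * w + (D.d : ℂ) ^ l * β) := by
    funext w; congr 1; push_cast; ring
  have hs' : D.R0 < (((D.d : ℤ) ^ l * m : ℤ) : ℝ) * r + ((D.d : ℂ) ^ l * β).re := by
    rw [re_dpow]; push_cast
    have := D.dpow_ge_one l
    have := D.R0_pos
    have e : (D.d : ℝ) ^ l * m * r + D.d ^ l * β.re = D.d ^ l * (m * r + β.re) := by ring
    rw [e]; nlinarith
  rw [e0, ← he, D.cf_T_mul hM _ hs']
  push_cast; rfl

end HD

namespace HD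

variable {D : HD}
variable {f : ℂ × ℂ → ℂ × ℂ} {U : Set (ℂ × ℂ)} {r ε : ℝ} {m : ℤ} {β : ℂ}

lemma MainHyp.key (h : MainHyp D f U r ε m β) {K : ℕ} (hm0 : m ≠ 0) (hK : m ∣ (D.d : ℤ) ^ K) {A : ℂ}
    (hA : ∀ w : ℂ, w.re = r →
    ∀ q ∈ D.L w, ∀ q' ∈ D.L w, D.del (m * w + β) (f q) (f q') = A * D.del w q q') :
    ∃ C' : ℝ, ∃ Q : ℝ, 0 ≤ Q ∧ ∀ l0 : ℕ, ‖A * (((D.d : ℂ) / D.a) ^ l0 * D.J (D.d + 1)) -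
      ∑ l ∈ Finset.range (l0 + 1), ((D.d : ℂ) / D.a) ^ l * (if (D.d : ℤ) ^ l * m = (D.d : ℤ) ^ l0 then
        Complex.exp ((D.d + 1) * ((D.d : ℂ) ^ l * β)) * D.J (D.d + 1) else 0)‖ ≤
      C' * Q ^ l0 * Real.exp (-((D.d + 1) * r * D.d ^ l0)) := by
  have hpi := Real.pi_pos
  have hMT := MT_nonneg (D := D)
  have hrS : |(r : ℂ).re - r| < ε := by simpa using h.eps
  have hr : D.R0 < r := by simpa using h.h1 r hrS
  have hs : D.R0 < m * r + β.re := by simpa using h.h2 r hrS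
  have hline : ∀ t : ℝ, |((r : ℂ) + t * Complex.I).re - r| < ε := by intro t; simpa using h.eps
  have cB : ∀ N, Continuous (fun t : ℝ => D.Bf f m β N (r + t * Complex.I)) := fun N =>
    (h.diff_B N).continuousOn.comp_continuous (line_continuous r) hline
  have cT1 : ∀ l : ℕ, Continuous (fun t : ℝ => ((D.d : ℂ) / D.a) ^ l * D.T ((D.d : ℂ) ^ l * (r + t * Complex.I))) :=
    fun l => continuous_const.mul (D.T_differentiableOn.continuousOn.comp_continuous (by fun_prop)
      (fun t => D.R0_lt_dpow (h.h1 _ (hline t)) l))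
  have cT2 : ∀ l : ℕ, Continuous (fun t : ℝ => ((D.d : ℂ) / D.a) ^ l *
      D.T ((D.d : ℂ) ^ l * (m * (r + t * Complex.I) + β))) :=
    fun l => continuous_const.mul (D.T_differentiableOn.continuousOn.comp_continuous (by fun_prop)
      (fun t => D.R0_lt_dpow (h.h2 _ (hline t)) l))
  obtain ⟨MB, hMB⟩ := (isCompact_Icc (a := (0 : ℝ)) (b := 2 * Real.pi)).exists_bound_of_continuousOn (cB 0).continuousOn
  have hMB0 : 0 ≤ MB := (norm_nonneg _).trans (hMB 0 ⟨le_rfl, by positivity⟩)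
  set ρ := ‖(D.d : ℂ) / D.a‖ with hρ
  have hρ0 : 0 ≤ ρ := norm_nonneg _
  set C0 := 2 * Real.pi * D.MT * Real.exp ((D.d + 1) * (m * r + β.re)) with hC0
  have hC00 : 0 ≤ C0 := by positivity
  set Q := 2 * (1 + ρ) with hQ
  refine ⟨2 * Real.pi * MB + C0, Q, by positivity, fun l0 => ?_⟩
  set j : ℤ := ((D.d : ℤ) + 1) * (D.d : ℤ) ^ l0 with hj
  set e := Real.exp (-((D.d + 1) * r * D.d ^ l0)) with he
  have hej : Real.exp (-(j * r)) = e := by rw [he, hj]; congr 1; push_cast; ring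
  -- vanishing
  have z1 : cf r j (D.Bf f m β (l0 + 1)) = 0 := by
    refine cf_zero r j (M := (D.d : ℤ) ^ (l0 + 1)) (d_int_pow_ne _) ?_ (fun t => ?_) (fun t => ?_)
    · rintro ⟨c, hc⟩
      rw [hj, pow_succ, mul_assoc, mul_comm _ ((D.d : ℤ) ^ l0)] at hc
      have h1 := mul_left_cancel₀ (d_int_pow_ne l0) hc
      have h2 : (D.d : ℤ) ∣ 1 := ⟨c - 1, by linear_combination h1⟩
      have h3 := Int.le_of_dvd one_pos h2
      have := D.hd
      omega
    · have := Bf_shift (D := D) (f := f) (m := m) (β := β) (l0 + 1) (r + t * Complex.I) 1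
      rw [← this]; congr 1; push_cast; ring
    · have := Bf_shift (D := D) (f := f) (m := m) (β := β) (l0 + 1) (r + t * Complex.I) (D.d ^ (l0 + 1))
      rw [← this]; congr 1
      have := pow_ne_zero (l0 + 1) D.d_ne
      push_cast; field_simp
  have z2 : cf r j (D.Bf f m β (l0 + 1)) = A * (((D.d : ℂ) / D.a) ^ l0 * D.J (D.d + 1)) + cf r j (D.Bf f m β 0) -
      ∑ l ∈ Finset.range (l0 + 1), ((D.d : ℂ) / D.a) ^ l * cf r j (fun w => D.T ((D.d : ℂ) ^ l * (m * w + β))) := by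
    have s1 : cf r j (D.Bf f m β (l0 + 1)) = cf r j (fun w =>
        (A * (∑ l ∈ Finset.range (l0 + 1), ((D.d : ℂ) / D.a) ^ l * D.T ((D.d : ℂ) ^ l * w)) + D.Bf f m β 0 w)
      + (-1) * ∑ l ∈ Finset.range (l0 + 1), ((D.d : ℂ) / D.a) ^ l * D.T ((D.d : ℂ) ^ l * (m * w + β))) := by
      apply cf_congr
      intro t
      rw [h.B_rel hA (l0 + 1) (by simp)]; ring
    have c1 : Continuous (fun t : ℝ => ∑ l ∈ Finset.range (l0 + 1), ((D.d : ℂ) / D.a) ^ l *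
        D.T ((D.d : ℂ) ^ l * (r + t * Complex.I))) := continuous_finsetSum _ (fun l _ => cT1 l)
    have c2 : Continuous (fun t : ℝ => ∑ l ∈ Finset.range (l0 + 1), ((D.d : ℂ) / D.a) ^ l *
        D.T ((D.d : ℂ) ^ l * (m * (r + t * Complex.I) + β))) := continuous_finsetSum _ (fun l _ => cT2 l)
    have k1 := cf_add r j (F := fun w => A * (∑ l ∈ Finset.range (l0 + 1), ((D.d : ℂ) / D.a) ^ l *
        D.T ((D.d : ℂ) ^ l * w)) + D.Bf f m β 0 w)
      (F' := fun w => (-1) * ∑ l ∈ Finset.range (l0 + 1), ((D.d : ℂ) / D.a) ^ l * D.T ((D.d : ℂ) ^ l * (m * w + β)))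
      ((continuous_const.mul c1).add (cB 0)) (continuous_const.mul c2)
    have k2 := cf_add r j (F := fun w => A * (∑ l ∈ Finset.range (l0 + 1), ((D.d : ℂ) / D.a) ^ l *
        D.T ((D.d : ℂ) ^ l * w))) (F' := D.Bf f m β 0) (continuous_const.mul c1) (cB 0)
    have k3 := cf_sum r j (l0 + 1) (F := fun l w => ((D.d : ℂ) / D.a) ^ l * D.T ((D.d : ℂ) ^ l * w)) cT1
    have k4 := cf_sum r j (l0 + 1) (F := fun l w => ((D.d : ℂ) / D.a) ^ l * D.T ((D.d : ℂ) ^ l * (m * w + β))) cT2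
    rw [s1, k1, k2, cf_mul, cf_mul, k3, k4]
    simp only [cf_mul]
    have : ∑ l ∈ Finset.range (l0 + 1), ((D.d : ℂ) / D.a) ^ l * cf r j (fun w => D.T ((D.d : ℂ) ^ l * w)) =
        ((D.d : ℂ) / D.a) ^ l0 * D.J (D.d + 1) := by
      rw [Finset.sum_eq_single l0]
      · rw [hj, coef_first le_rfl hr, if_pos rfl]
      · intro l hl hne
        rw [hj, coef_first (by have := Finset.mem_range.mp hl; omega) hr, if_neg hne, mul_zero]
      · intro h; exact absurd (Finset.mem_range.mpr (Nat.lt_succ_self _)) h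
    rw [this]; ring
  rw [z1] at z2
  set X : ℕ → ℂ := fun l => if (D.d : ℤ) ^ l * m = (D.d : ℤ) ^ l0 then
        Complex.exp ((D.d + 1) * ((D.d : ℂ) ^ l * β)) * D.J (D.d + 1) else 0 with hX
  have b1 : ∀ l, ‖cf r j (fun w => D.T ((D.d : ℂ) ^ l * (m * w + β))) - X l‖ ≤ C0 * e := by
    intro l
    simp only [hX]
    split_ifs with hc
    · rw [hj, coef_eq hm0 hs hc, sub_self, norm_zero]; positivity
    · rw [sub_zero]
      exact coef_second hm0 hK hs hc
  have b2 := cf_le r j hMB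
  rw [hej] at b2
  have e2 : A * (((D.d : ℂ) / D.a) ^ l0 * D.J (D.d + 1)) - ∑ l ∈ Finset.range (l0 + 1), ((D.d : ℂ) / D.a) ^ l * X l =
      ∑ l ∈ Finset.range (l0 + 1), ((D.d : ℂ) / D.a) ^ l * (cf r j (fun w => D.T ((D.d : ℂ) ^ l * (m * w + β))) - X l) -
      cf r j (D.Bf f m β 0) := by
    simp only [mul_sub, Finset.sum_sub_distrib]
    linear_combination -z2
  rw [e2]
  have hQ1 : 1 ≤ Q := by linarith
  have b3 : ‖∑ l ∈ Finset.range (l0 + 1), ((D.d : ℂ) / D.a) ^ l *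
      (cf r j (fun w => D.T ((D.d : ℂ) ^ l * (m * w + β))) - X l)‖ ≤ Q ^ l0 * (C0 * e) := by
    calc _ ≤ ∑ l ∈ Finset.range (l0 + 1), (1 + ρ) ^ l0 * (C0 * e) := by
          refine norm_sum_le_of_le _ (fun l hl => ?_)
          rw [norm_mul, norm_pow, ← hρ]
          have hll : l ≤ l0 := by have := Finset.mem_range.mp hl; omega
          have : ρ ^ l ≤ (1 + ρ) ^ l0 := (pow_le_pow_left₀ hρ0 (by linarith) l).trans
            (pow_le_pow_right₀ (by linarith) hll)
          exact mul_le_mul this (b1 l) (norm_nonneg _) (by positivity)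
      _ = ((l0 + 1 : ℕ) : ℝ) * ((1 + ρ) ^ l0 * (C0 * e)) := by simp
      _ ≤ (2 : ℝ) ^ l0 * ((1 + ρ) ^ l0 * (C0 * e)) := by
          have : ((l0 + 1 : ℕ) : ℝ) ≤ (2 : ℝ) ^ l0 := by exact_mod_cast Nat.lt_two_pow_self
          gcongr
      _ = _ := by rw [hQ, mul_pow]; ring
  have b4 : 1 ≤ Q ^ l0 := one_le_pow₀ hQ1
  have he0 : 0 < e := Real.exp_pos _
  calc _ ≤ Q ^ l0 * (C0 * e) + 2 * Real.pi * MB * e := (norm_sub_le _ _).trans (add_le_add b3 b2)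
    _ ≤ Q ^ l0 * (C0 * e) + Q ^ l0 * (2 * Real.pi * MB * e) := by
      have b5 : 2 * Real.pi * MB * e ≤ Q ^ l0 * (2 * Real.pi * MB * e) := le_mul_of_one_le_left (by positivity) b4
      linarith
    _ = _ := by ring

lemma da_ne : (D.d : ℂ) / D.a ≠ 0 := div_ne_zero D.d_ne D.ha

lemma J_top_ne : D.J (D.d + 1) ≠ 0 := by
  rw [J_top]
  have := da_ne (D := D)
  have hpi : (Real.pi : ℂ) ≠ 0 := by exact_mod_cast Real.pi_ne_zero
  simp only [ne_eq, neg_eq_zero, mul_eq_zero, not_or]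
  exact ⟨⟨two_ne_zero, hpi⟩, this⟩

theorem MainHyp.main (h : MainHyp D f U r ε m β) {K : ℕ} (hm0 : m ≠ 0) (hK : m ∣ (D.d : ℤ) ^ K) :
    ∃ k : ℕ, m = (D.d : ℤ) ^ k ∧ β.re = 0 := by
  obtain ⟨A, hA0, hA⟩ := h.exists_A
  obtain ⟨C', Q, hQ, hkey⟩ := h.key hm0 hK hA
  have hr : D.R0 < r := by simpa using h.h1 r (by simpa using h.eps)
  have hr0 : 0 < r := D.R0_pos.trans hr
  have hda := da_ne (D := D)
  have hJ := J_top_ne (D := D)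
  set ρ := ‖(D.d : ℂ) / D.a‖ with hρ
  have hρ0 : 0 < ρ := norm_pos_iff.mpr hda
  -- error term over ρ^l0
  have herr : Tendsto (fun l0 : ℕ => C' * ((Q / ρ) ^ l0 * Real.exp (-((D.d + 1) * r * D.d ^ l0)))) atTop (𝓝 0) := by
    simpa using (superexp D.d D.hd (Q / ρ) (by positivity) (s := (D.d + 1) * r) (by positivity)).const_mul C'
  have hlim : Tendsto (fun l0 : ℕ => A * D.J (D.d + 1) - (∑ l ∈ Finset.range (l0 + 1), ((D.d : ℂ) / D.a) ^ l *
      (if (D.d : ℤ) ^ l * m = (D.d : ℤ) ^ l0 then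
        Complex.exp ((D.d + 1) * ((D.d : ℂ) ^ l * β)) * D.J (D.d + 1) else 0)) / ((D.d : ℂ) / D.a) ^ l0) atTop (𝓝 0) := by
    refine squeeze_zero_norm (fun l0 => ?_) herr
    have hp := pow_ne_zero l0 hda
    have := hkey l0
    set S := ∑ l ∈ Finset.range (l0 + 1), ((D.d : ℂ) / D.a) ^ l *
      (if (D.d : ℤ) ^ l * m = (D.d : ℤ) ^ l0 then
        Complex.exp ((D.d + 1) * ((D.d : ℂ) ^ l * β)) * D.J (D.d + 1) else 0)
    have e : A * D.J (D.d + 1) - S / ((D.d : ℂ) / D.a) ^ l0 =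
      (A * (((D.d : ℂ) / D.a) ^ l0 * D.J (D.d + 1)) - S) / ((D.d : ℂ) / D.a) ^ l0 := by
      rw [sub_div]; congr 1; rw [mul_left_comm, mul_div_cancel_left₀ _ hp]
    rw [e, norm_div, norm_pow, ← hρ, div_le_iff₀ (by positivity)]
    refine this.trans (le_of_eq ?_)
    rw [div_pow]; field_simp
  by_cases hpow : ∃ k : ℕ, m = (D.d : ℤ) ^ k
  · obtain ⟨k, hk⟩ := hpow
    refine ⟨k, hk, ?_⟩
    have hlim2 := hlim.comp (tendsto_add_atTop_nat k)
    have e : ∀ l : ℕ, (∑ l' ∈ Finset.range (l + k + 1), ((D.d : ℂ) / D.a) ^ l' *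
      (if (D.d : ℤ) ^ l' * m = (D.d : ℤ) ^ (l + k) then
        Complex.exp ((D.d + 1) * ((D.d : ℂ) ^ l' * β)) * D.J (D.d + 1) else 0)) =
        ((D.d : ℂ) / D.a) ^ l * (Complex.exp ((D.d + 1) * ((D.d : ℂ) ^ l * β)) * D.J (D.d + 1)) := by
      intro l
      rw [Finset.sum_eq_single l]
      · rw [if_pos (by rw [hk, pow_add])]
      · intro l' _ hne
        rw [if_neg, mul_zero]
        rw [hk, ← pow_add]
        intro hh
        have := pow_right_injective₀ (a := (D.d : ℤ)) (by have := D.d_pos; omega) (by have := D.hd; omega) hh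
        omega
      · intro h; exact absurd (Finset.mem_range.mpr (by omega)) h
    have hlim3 : Tendsto (fun l : ℕ => A * ((D.d : ℂ) / D.a) ^ k - Complex.exp ((D.d + 1) * ((D.d : ℂ) ^ l * β)))
        atTop (𝓝 0) := by
      have := hlim2.mul_const (((D.d : ℂ) / D.a) ^ k / D.J (D.d + 1))
      rw [zero_mul] at this
      refine this.congr (fun l => ?_)
      simp only [Function.comp]
      rw [e l]
      have hp := pow_ne_zero l hda
      have hp' := pow_ne_zero k hda
      rw [pow_add]
      generalize ((D.d : ℂ) / D.a) ^ l = x at *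
      generalize ((D.d : ℂ) / D.a) ^ k = y at *
      field_simp
    set c := A * ((D.d : ℂ) / D.a) ^ k with hc
    have hc0 : c ≠ 0 := mul_ne_zero hA0 (pow_ne_zero k hda)
    have hlim4 : Tendsto (fun l : ℕ => Complex.exp ((D.d + 1) * ((D.d : ℂ) ^ l * β))) atTop (𝓝 c) := by
      have := (tendsto_const_nhds (x := c)).sub hlim3
      simpa using this
    have hlim5 : Tendsto (fun l : ℕ => ((D.d : ℝ) + 1) * (D.d ^ l * β.re)) atTop (𝓝 (Real.log ‖c‖)) := by
      have := (Real.continuousAt_log (norm_ne_zero_iff.mpr hc0)).tendsto.comp hlim4.norm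
      refine this.congr (fun l => ?_)
      simp only [Function.comp]
      rw [Complex.norm_exp, Real.log_exp]
      have : ((D.d : ℂ) + 1) = (((D.d : ℝ) + 1 : ℝ) : ℂ) := by push_cast; rfl
      rw [this, Complex.re_ofReal_mul, re_dpow]
    by_contra hβ
    have hlim6 : Tendsto (fun l : ℕ => (D.d : ℝ) ^ l) atTop (𝓝 (Real.log ‖c‖ * (((D.d : ℝ) + 1) * β.re)⁻¹)) := by
      refine (hlim5.mul_const _).congr (fun l => ?_)
      have : (D.d : ℝ) + 1 ≠ 0 := by positivity
      field_simp
    exact not_tendsto_nhds_of_tendsto_atTop D.tendsto_dpow _ hlim6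
  · exfalso
    have e : ∀ l0 : ℕ, (∑ l ∈ Finset.range (l0 + 1), ((D.d : ℂ) / D.a) ^ l *
      (if (D.d : ℤ) ^ l * m = (D.d : ℤ) ^ l0 then
        Complex.exp ((D.d + 1) * ((D.d : ℂ) ^ l * β)) * D.J (D.d + 1) else 0)) = 0 := by
      intro l0
      refine Finset.sum_eq_zero (fun l hl => ?_)
      rw [if_neg, mul_zero]
      intro hh
      have hll : l ≤ l0 := by have := Finset.mem_range.mp hl; omega
      apply hpow
      refine ⟨l0 - l, mul_left_cancel₀ (d_int_pow_ne (D := D) l) ?_⟩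
      rw [hh, ← pow_add]; congr 1; omega
    simp only [e, zero_div, sub_zero] at hlim
    exact mul_ne_zero hA0 hJ (tendsto_nhds_unique tendsto_const_nhds hlim)

end HD

namespace HD

variable {D : HD} {G : ℂ × ℂ → ℝ}

/-- holomorphic map from a sublevel set to a sublevel set -/
structure HMap (G : ℂ × ℂ → ℝ) (f : ℂ × ℂ → ℂ × ℂ) (c₁ c₂ : ℝ) : Prop where
  diff : DifferentiableOn ℂ f {z | G z < c₁}
  maps : ∀ z, G z < c₁ → G (f z) < c₂

variable {f : ℂ × ℂ → ℂ × ℂ} {c₁ c₂ : ℝ}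

lemma IsGreen.isOpen_sub (hG : IsGreen D G) (c : ℝ) : IsOpen {z | G z < c} := isOpen_lt hG.cont continuous_const

lemma IsGreen.leafconst (hG : IsGreen D G) (hf : HMap G f c₁ c₂) {w : ℂ} (hw : 0 < w.re) (hw1 : w.re < c₁)
    {q q' : ℂ × ℂ} (hq : q ∈ D.L w) (hq' : q' ∈ D.L w) : G (f q) = G (f q') := by
  obtain ⟨π, h1, h2, h3, h4⟩ := D.leaf_param hw hq
  have hm : ∀ z, G (π z) < c₁ := fun z => by rw [hG.G_L (h2 z)]; exact hw1
  have hd : Differentiable ℂ (fun z => f (π z)) := fun z =>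
    (hf.diff.differentiableAt ((hG.isOpen_sub c₁).mem_nhds (hm z))).comp z (h1 z)
  have := hG.liouville hd (c := c₂) (fun t => hf.maps _ (hm t)) (D.del w q q) (D.del w q' q)
  rwa [h4 q hq, h4 q' hq'] at this

lemma exists_N (D : HD) {t : ℝ} (ht : 0 < t) : ∃ N : ℕ, D.R0 < (D.d : ℝ) ^ N * t := by
  obtain ⟨N, hN⟩ := (D.tendsto_dpow.eventually (eventually_gt_atTop (D.R0 / t))).exists
  exact ⟨N, by rwa [div_lt_iff₀ ht] at hN⟩

lemma IsGreen.same (hG : IsGreen D G) (hf : HMap G f c₁ c₂) {q q' : ℂ × ℂ} (hq : 0 < G q) (hq1 : G q < c₁)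
    (he : G q = G q') : G (f q) = G (f q') := by
  obtain ⟨w, hw⟩ := hG.exists_L hq
  obtain ⟨w', hw'⟩ := hG.exists_L (he ▸ hq)
  have e1 := hG.G_L hw
  have e2 := hG.G_L hw'
  obtain ⟨N, hN⟩ := exists_N D hq
  set t := G q with ht
  have hmem : ∀ s : ℝ, D.rr N (t + s * Complex.I) ∈ D.L (t + s * Complex.I) := fun s =>
    D.rr_mem (by rw [re_dpow]; simpa using hN)
  have ho : IsOpen {w : ℂ | D.R0 < ((D.d : ℂ) ^ N * w).re} := isOpen_lt continuous_const (by fun_prop)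
  have hc : Continuous (fun s : ℝ => G (f (D.rr N (t + s * Complex.I)))) := by
    have h1 : Continuous (fun s : ℝ => D.rr N (t + s * Complex.I)) :=
      (D.rr_differentiableOn N ho differentiableOn_id (fun t ht => ht)).continuousOn.comp_continuous
        (line_continuous t) (fun s => by
          change D.R0 < ((D.d : ℂ) ^ N * (t + s * Complex.I)).re
          rw [re_dpow]; simpa using hN)
    refine hG.cont.comp (hf.diff.continuousOn.comp_continuous h1 (fun s => ?_))
    change G _ < c₁
    rw [hG.G_L (hmem s)]; simpa using hq1
  have hinv := D.dense_const hc (fun s k n => by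
    have h1 := hmem (s + 2 * Real.pi * k / (D.d : ℝ) ^ n)
    have e : (t : ℂ) + ((s + 2 * Real.pi * k / (D.d : ℝ) ^ n : ℝ) : ℂ) * Complex.I =
      t + s * Complex.I + 2 * Real.pi * Complex.I * k / (D.d : ℂ) ^ n := by push_cast; ring
    have h2 : D.rr N ((t : ℂ) + ((s + 2 * Real.pi * k / (D.d : ℝ) ^ n : ℝ) : ℂ) * Complex.I) ∈ D.L (t + s * Complex.I) := by
      rw [e, D.L_shift] at h1
      rw [e]; exact h1
    exact hG.leafconst hf (by simpa using hq) (by simpa using hq1) h2 (hmem s))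
  have ew : w = t + w.im * Complex.I := by rw [e1]; exact (Complex.re_add_im w).symm
  have ew' : w' = t + w'.im * Complex.I := by rw [he, e2]; exact (Complex.re_add_im w').symm
  have g1 := hmem w.im
  have g2 := hmem w'.im
  have g3 := hinv w.im w'.im
  rw [← ew] at g1
  rw [← ew'] at g2
  simp only [← ew, ← ew'] at g3
  rw [hG.leafconst hf (by rw [← e1]; exact hq) (by rw [← e1]; exact hq1) hw g1, g3]
  exact hG.leafconst hf (by rw [← e2, ← he]; exact hq) (by rw [← e2, ← he]; exact hq1) g2 hw'

lemma IsGreen.exists_pt (hG : IsGreen D G) {t : ℝ} (ht : 0 < t) : ∃ q, G q = t := by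
  obtain ⟨N, hN⟩ := exists_N D ht
  have : D.rr N (t : ℂ) ∈ D.L (t : ℂ) := D.rr_mem (by rw [re_dpow]; simpa using hN)
  exact ⟨_, by rw [hG.G_L this]; simp⟩

lemma IsGreen.exists_h (hG : IsGreen D G) (hf : HMap G f c₁ c₂) :
    ∃ h : ℝ → ℝ, ContinuousOn h (Ioo 0 c₁) ∧ ∀ q, 0 < G q → G q < c₁ → G (f q) = h (G q) := by
  have : ∀ t : ℝ, ∃ q, 0 < t → G q = t := by
    intro t
    by_cases ht : 0 < t
    · obtain ⟨q, hq⟩ := hG.exists_pt ht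
      exact ⟨q, fun _ => hq⟩
    · exact ⟨0, fun h => absurd h ht⟩
  choose Q hQ using this
  have key : ∀ q, 0 < G q → G q < c₁ → G (f q) = G (f (Q (G q))) := fun q h1 h2 =>
    hG.same hf h1 h2 (hQ _ h1).symm
  refine ⟨fun t => G (f (Q t)), ?_, key⟩
  intro t ht
  obtain ⟨N, hN⟩ := exists_N D ht.1
  have ho : IsOpen {w : ℂ | D.R0 < ((D.d : ℂ) ^ N * w).re} := isOpen_lt continuous_const (by fun_prop)
  have htm : (t : ℂ) ∈ {w : ℂ | D.R0 < ((D.d : ℂ) ^ N * w).re} := by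
    change D.R0 < ((D.d : ℂ) ^ N * t).re
    rw [re_dpow]; simpa using hN
  have hmem : ∀ w : ℂ, D.R0 < ((D.d : ℂ) ^ N * w).re → D.rr N w ∈ D.L w := fun w h => D.rr_mem h
  have h1 : ContinuousAt (fun s : ℝ => G (f (D.rr N (s : ℂ)))) t := by
    have a1 : ContinuousAt (fun w : ℂ => D.rr N w) (t : ℂ) :=
      (D.rr_differentiableOn N ho differentiableOn_id (fun t ht => ht)).continuousOn.continuousAt (ho.mem_nhds htm)
    have a2 : ContinuousAt f (D.rr N (t : ℂ)) := hf.diff.continuousOn.continuousAt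
      ((hG.isOpen_sub c₁).mem_nhds (by change G _ < c₁; rw [hG.G_L (hmem _ htm)]; simpa using ht.2))
    have a3 : ContinuousAt (fun s : ℝ => D.rr N (s : ℂ)) t :=
      ContinuousAt.comp (g := fun w : ℂ => D.rr N w) a1 Complex.continuous_ofReal.continuousAt
    exact hG.cont.continuousAt.comp (ContinuousAt.comp (g := f) a2 a3)
  refine (h1.congr ?_).continuousWithinAt
  have hev : ∀ᶠ s : ℝ in 𝓝 t, D.R0 < ((D.d : ℂ) ^ N * s).re :=
    Complex.continuous_ofReal.continuousAt.eventually (ho.mem_nhds htm)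
  filter_upwards [hev, Ioo_mem_nhds ht.1 ht.2] with s hs hs'
  have := hG.G_L (hmem _ hs)
  rw [Complex.ofReal_re] at this
  have k := key (D.rr N (s : ℂ)) (by rw [this]; exact hs'.1) (by rw [this]; exact hs'.2)
  rw [this] at k
  exact k

/-- curves in level sets stay in leaves -/
lemma IsGreen.curve_leaf (hG : IsGreen D G) {c : ℂ → ℂ × ℂ} (hc : Differentiable ℂ c) {κ : ℝ} (hκ : 0 < κ)
    (hcon : ∀ z, G (c z) = κ) {w : ℂ} {z₀ : ℂ} (h0 : c z₀ ∈ D.L w) (z : ℂ) : c z ∈ D.L w := by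
  have loc : ∀ z : ℂ, ∃ w', ∃ e > 0, ∀ y ∈ Metric.ball z e, c y ∈ D.L w' := by
    intro z
    obtain ⟨F, e, he, -, hF, h⟩ := hG.lift isOpen_univ hc.differentiableOn (mem_univ z) (by rw [hcon]; exact hκ)
    obtain ⟨w', hw'⟩ := (hF.analyticOnNhd Metric.isOpen_ball).eq_const_of_re_eq_const (c₀ := κ)
      (fun y hy => by rw [← hG.G_L (h y hy), hcon]) Metric.isOpen_ball
      (Metric.isConnected_ball he)
    exact ⟨w', e, he, fun y hy => hw' y hy ▸ h y hy⟩
  have hclopen : IsClopen {z | c z ∈ D.L w} := by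
    constructor
    · rw [← isOpen_compl_iff, Metric.isOpen_iff]
      intro z hz
      obtain ⟨w', e, he, h⟩ := loc z
      refine ⟨e, he, fun y hy hy2 => hz ?_⟩
      have := D.L_eq_of_mem (h y hy) hy2
      change c z ∈ D.L w
      rw [this]; exact h z (Metric.mem_ball_self he)
    · rw [Metric.isOpen_iff]
      intro z hz
      obtain ⟨w', e, he, h⟩ := loc z
      refine ⟨e, he, fun y hy => ?_⟩
      have := D.L_eq_of_mem (h z (Metric.mem_ball_self he)) hz
      change c y ∈ D.L w
      rw [this]; exact h y hy
  have := hclopen.eq_univ ⟨z₀, h0⟩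
  have hz : z ∈ {z | c z ∈ D.L w} := by rw [this]; trivial
  exact hz

lemma IsGreen.leaf_leaf (hG : IsGreen D G) (hf : HMap G f c₁ c₂) {w w' : ℂ} (hw : 0 < w.re) (hw1 : w.re < c₁)
    {q q' : ℂ × ℂ} (hq : q ∈ D.L w) (hq' : q' ∈ D.L w) (hpos : 0 < G (f q)) (hfq : f q ∈ D.L w') :
    f q' ∈ D.L w' := by
  obtain ⟨π, h1, h2, h3, h4⟩ := D.leaf_param hw hq
  have hm : ∀ z, G (π z) < c₁ := fun z => by rw [hG.G_L (h2 z)]; exact hw1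
  have hd : Differentiable ℂ (fun z => f (π z)) := fun z =>
    (hf.diff.differentiableAt ((hG.isOpen_sub c₁).mem_nhds (hm z))).comp z (h1 z)
  have := hG.curve_leaf hd hpos (fun z => hG.leafconst hf hw hw1 (h2 z) hq) (w := w') (z₀ := D.del w q q)
    (by rw [h4 q hq]; exact hfq) (D.del w q' q)
  rwa [h4 q' hq'] at this

end HD

namespace HD

variable {D : HD} {G : ℂ × ℂ → ℝ}
variable {f : ℂ × ℂ → ℂ × ℂ} {c₁ c₂ : ℝ}

lemma IsGreen.L_pos (hG : IsGreen D G) {q : ℂ × ℂ} {w : ℂ} (hq : q ∈ D.L w) : 0 < G q := by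
  obtain ⟨n, h1, _⟩ := hq
  have := hG.pos_V h1
  rw [hG.iter] at this
  exact pos_of_mul_pos_right this (D.dpow_pos n).le

lemma affine_of_re {F : ℂ → ℂ} {t : ℂ} {e : ℝ} (he : 0 < e) (hF : DifferentiableOn ℂ F (Metric.ball t e))
    {h : ℝ → ℝ} (hh : ∀ w ∈ Metric.ball t e, (F w).re = h w.re) :
    ∃ (α : ℝ) (β : ℂ), ∀ w ∈ Metric.ball t e, F w = α * w + β := by
  have him : ∀ w ∈ Metric.ball t e, (deriv F w).im = 0 := by
    intro w hw
    have h1 : HasDerivAt F (deriv F w) w := (hF.differentiableAt (Metric.isOpen_ball.mem_nhds hw)).hasDerivAt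
    have h2 : HasDerivAt (fun s : ℂ => F (w + s * Complex.I)) (deriv F w * (1 * Complex.I)) ((0 : ℝ) : ℂ) := by
      have a : HasDerivAt (fun s : ℂ => w + s * Complex.I) (1 * Complex.I) ((0 : ℝ) : ℂ) :=
        ((hasDerivAt_id _).mul_const _).const_add _
      refine HasDerivAt.comp (h₂ := F) _ ?_ a
      simpa using h1
    have h3 := h2.real_of_complex
    have h4 : HasDerivAt (fun _ : ℝ => (F w).re) 0 (0 : ℝ) := hasDerivAt_const _ _
    have hev : (fun s : ℝ => (F (w + s * Complex.I)).re) =ᶠ[𝓝 0] (fun _ : ℝ => (F w).re) := by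
      have hc : Continuous (fun s : ℝ => w + s * Complex.I) := by fun_prop
      have : ∀ᶠ s : ℝ in 𝓝 0, w + s * Complex.I ∈ Metric.ball t e :=
        hc.continuousAt.eventually (Metric.isOpen_ball.mem_nhds (by simpa using hw))
      filter_upwards [this] with s hs
      rw [hh _ hs, hh _ hw]; simp
    have := h3.unique (h4.congr_of_eventuallyEq hev)
    simpa using this
  obtain ⟨c, hc⟩ := ((hF.deriv Metric.isOpen_ball).analyticOnNhd Metric.isOpen_ball).eq_const_of_im_eq_const
    him Metric.isOpen_ball (Metric.isConnected_ball he)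
  have hc0 : c = ((c.re : ℝ) : ℂ) := by
    apply Complex.ext
    · simp
    · have := him t (Metric.mem_ball_self he)
      rw [hc t (Metric.mem_ball_self he)] at this
      simpa using this
  obtain ⟨β, hβ⟩ := Metric.isOpen_ball.exists_is_const_of_deriv_eq_zero (𝕜 := ℂ) (f := fun w => F w - c * w)
    (Metric.isConnected_ball he).isPreconnected (hF.sub (by fun_prop)) (by
      intro w hw
      have h1 : HasDerivAt F (deriv F w) w := (hF.differentiableAt (Metric.isOpen_ball.mem_nhds hw)).hasDerivAt
      have h2 := h1.sub ((hasDerivAt_id w).const_mul c)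
      have h3 : HasDerivAt (fun w => F w - c * w) (deriv F w - c * 1) w := h2
      rw [h3.deriv, hc w hw]; simp)
  refine ⟨c.re, β, fun w hw => ?_⟩
  rw [← hc0, ← hβ w hw]; ring

lemma IsGreen.local_affine (hG : IsGreen D G) (hf : HMap G f c₁ c₂) {h : ℝ → ℝ}
    (hh : ∀ q, 0 < G q → G q < c₁ → G (f q) = h (G q)) {t : ℝ} (ht : t ∈ Ioo 0 c₁) (hpos : 0 < h t) :
    ∃ (n : ℤ) (b : ℕ) (β : ℂ) (e : ℝ), 0 < e ∧ ∀ w : ℂ, |w.re - t| < e → 0 < w.re ∧ w.re < c₁ ∧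
      h w.re = n / (D.d : ℝ) ^ b * w.re + β.re ∧ MapsTo f (D.L w) (D.L (n / (D.d : ℂ) ^ b * w + β)) := by
  have hpi := Real.pi_pos
  obtain ⟨N, hN⟩ := exists_N D ht.1
  set S : Set ℂ := {w : ℂ | D.R0 < ((D.d : ℂ) ^ N * w).re ∧ w.re < c₁} with hS
  have ho1 : IsOpen {w : ℂ | D.R0 < ((D.d : ℂ) ^ N * w).re} := isOpen_lt continuous_const (by fun_prop)
  have ho2 : IsOpen {w : ℂ | w.re < c₁} := isOpen_lt (by fun_prop) continuous_const
  have ho : IsOpen S := ho1.inter ho2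
  have htS : (t : ℂ) ∈ S := by
    refine ⟨?_, by simpa using ht.2⟩
    rw [re_dpow]; simpa using hN
  have hpS : ∀ w ∈ S, 0 < w.re := by
    intro w hw
    have h1 := hw.1
    rw [re_dpow] at h1
    exact pos_of_mul_pos_right (D.R0_pos.trans h1) (D.dpow_pos N).le
  have hmem : ∀ w ∈ S, D.rr N w ∈ D.L w := fun w hw => D.rr_mem hw.1
  have hcd : DifferentiableOn ℂ (fun w => f (D.rr N w)) S :=
    hf.diff.comp (D.rr_differentiableOn N ho differentiableOn_id (fun w hw => hw.1))
      (fun w hw => by change G _ < c₁; rw [hG.G_L (hmem w hw)]; exact hw.2)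
  have hcv : ∀ w ∈ S, ∀ q ∈ D.L w, G (f q) = h w.re := by
    intro w hw q hq
    have := hG.G_L hq
    rw [hh _ (by rw [this]; exact hpS w hw) (by rw [this]; exact hw.2), this]
  obtain ⟨F, e, he, hsub, hF, hFL⟩ := hG.lift ho hcd htS (by
    rw [hcv _ htS _ (hmem _ htS)]; simpa using hpos)
  obtain ⟨α, β, hαβ⟩ := affine_of_re he hF (h := h) (fun w hw => by
    rw [← hG.G_L (hFL w hw), hcv w (hsub hw) _ (hmem w (hsub hw))])
  have hL : ∀ w ∈ Metric.ball (t : ℂ) e, MapsTo f (D.L w) (D.L (α * w + β)) := by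
    intro w hw q hq
    have h1 := hFL w hw
    rw [hαβ w hw] at h1
    exact hG.leaf_leaf hf (hpS w (hsub hw)) (hsub hw).2 (hmem w (hsub hw)) hq (hG.L_pos h1) h1
  -- density
  have hsmall : ∃ n : ℕ, 2 * Real.pi / (D.d : ℝ) ^ n < e := by
    obtain ⟨n, hn⟩ := (D.tendsto_dpow.eventually (eventually_gt_atTop (2 * Real.pi / e))).exists
    refine ⟨n, ?_⟩
    rw [div_lt_iff₀ he] at hn
    rw [div_lt_iff₀ (D.dpow_pos n)]; linarith
  have hdp : ∀ n, (D.d : ℂ) ^ n ≠ 0 := fun n => pow_ne_zero n D.d_ne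
  obtain ⟨k, b, hk⟩ : ∃ (k : ℤ) (b : ℕ), (α : ℂ) = k / (D.d : ℂ) ^ b := by
    obtain ⟨n, hn⟩ := hsmall
    have hw1 : (t : ℂ) + 2 * Real.pi * Complex.I * (1 : ℤ) / (D.d : ℂ) ^ n ∈ Metric.ball (t : ℂ) e := by
      rw [Metric.mem_ball, dist_eq_norm, add_sub_cancel_left]
      simpa [abs_of_pos hpi] using hn
    have m1 := hL _ hw1
    have m0 := hL _ (Metric.mem_ball_self he)
    rw [D.L_shift] at m1
    obtain ⟨k, n', hkn⟩ := L_inter (m0 (hmem _ htS)) (m1 (hmem _ htS))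
    refine ⟨k * D.d ^ n, n', ?_⟩
    have h2 : (2 * Real.pi * Complex.I : ℂ) ≠ 0 := Complex.two_pi_I_ne_zero
    have h3 : (2 * Real.pi * Complex.I : ℂ) * (α / (D.d : ℂ) ^ n) = (2 * Real.pi * Complex.I) * (k / (D.d : ℂ) ^ n') := by
      push_cast at hkn
      linear_combination hkn
    have h4 := mul_left_cancel₀ h2 h3
    rw [div_eq_iff (hdp n)] at h4
    rw [h4]; push_cast; ring
  have hk' : α = k / (D.d : ℝ) ^ b := by exact_mod_cast hk
  refine ⟨k, b, β, e / 2, by positivity, fun w hw => ?_⟩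
  have hreal : ((w.re : ℝ) : ℂ) ∈ Metric.ball (t : ℂ) e := by
    rw [Metric.mem_ball, dist_eq_norm, ← Complex.ofReal_sub, Complex.norm_real, Real.norm_eq_abs]; linarith
  have hrS := hsub hreal
  refine ⟨by simpa using hpS _ hrS, by simpa using hrS.2, ?_, ?_⟩
  · have h1 := hG.G_L (hFL _ hreal)
    rw [hcv _ hrS _ (hmem _ hrS), hαβ _ hreal] at h1
    rw [← hk']
    rw [Complex.add_re, Complex.re_ofReal_mul, Complex.ofReal_re] at h1
    exact h1
  · obtain ⟨n, hn⟩ : ∃ n : ℕ, 2 * Real.pi / (D.d : ℝ) ^ n < e / 2 := by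
      obtain ⟨n, hn⟩ := (D.tendsto_dpow.eventually (eventually_gt_atTop (2 * Real.pi / (e / 2)))).exists
      refine ⟨n, ?_⟩
      rw [div_lt_iff₀ (by positivity)] at hn
      rw [div_lt_iff₀ (D.dpow_pos n)]; linarith
    set j : ℤ := -⌊w.im * (D.d : ℝ) ^ n / (2 * Real.pi)⌋ with hj
    set w0 := w + 2 * Real.pi * Complex.I * j / (D.d : ℂ) ^ n with hw0
    have hw0' : w0 = w + ((2 * Real.pi * j / (D.d : ℝ) ^ n : ℝ) : ℂ) * Complex.I := by
      rw [hw0]; push_cast; ring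
    have hre : w0.re = w.re := by rw [hw0']; simp only [Complex.add_re, Complex.re_ofReal_mul]; simp
    have him : w0.im = w.im + 2 * Real.pi * j / (D.d : ℝ) ^ n := by
      rw [hw0']; simp only [Complex.add_im, Complex.im_ofReal_mul]; simp
    have him2 : |w0.im| < e / 2 := by
      refine lt_of_le_of_lt ?_ hn
      have hp := D.dpow_pos n
      have f1 := Int.floor_le (w.im * (D.d : ℝ) ^ n / (2 * Real.pi))
      have f2 := Int.lt_floor_add_one (w.im * (D.d : ℝ) ^ n / (2 * Real.pi))
      have hj' : (j : ℝ) = -((⌊w.im * (D.d : ℝ) ^ n / (2 * Real.pi)⌋ : ℤ) : ℝ) := by rw [hj]; push_cast; rfl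
      set x : ℝ := ((⌊w.im * (D.d : ℝ) ^ n / (2 * Real.pi)⌋ : ℤ) : ℝ)
      rw [le_div_iff₀ (by positivity)] at f1
      rw [div_lt_iff₀ (by positivity)] at f2
      have e1 : w0.im = (w.im * (D.d : ℝ) ^ n - x * (2 * Real.pi)) / (D.d : ℝ) ^ n := by
        rw [him, hj']; field_simp; ring
      rw [e1, abs_div, abs_of_pos hp]
      gcongr
      rw [abs_le]; constructor <;> linarith
    have hball : w0 ∈ Metric.ball (t : ℂ) e := by
      rw [Metric.mem_ball, dist_eq_norm]
      refine (Complex.norm_le_abs_re_add_abs_im _).trans_lt ?_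
      simp only [Complex.sub_re, Complex.sub_im, Complex.ofReal_re, Complex.ofReal_im, sub_zero, hre]
      linarith
    have hfin := hL _ hball
    have e2 : (α : ℂ) * w0 + β = k / (D.d : ℂ) ^ b * w + β + 2 * Real.pi * Complex.I * ((k * j : ℤ) : ℂ) / (D.d : ℂ) ^ (b + n) := by
      rw [hw0, hk, pow_add]
      have := hdp b; have := hdp n
      push_cast; field_simp; ring
    have e3 : D.L w0 = D.L w := by rw [hw0, D.L_shift]
    rw [e2, e3, D.L_shift] at hfin
    exact hfin

end HD

namespace HD

variable {D : HD} {G : ℂ × ℂ → ℝ}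
variable {f g : ℂ × ℂ → ℂ × ℂ} {c₁ c₂ : ℝ}

/-- two functions describing the action of `f` and its inverse on levels -/
lemma IsGreen.kh (hG : IsGreen D G) (hf : HMap G f c₁ c₂) (hgf : ∀ z, G z < c₁ → g (f z) = z) {h k : ℝ → ℝ}
    (hh : ∀ q, 0 < G q → G q < c₁ → G (f q) = h (G q))
    (hk : ∀ q, 0 < G q → G q < c₂ → G (g q) = k (G q)) {t : ℝ} (ht : t ∈ Ioo 0 c₁) :
    h t < c₂ ∧ (0 < h t → k (h t) = t) := by
  obtain ⟨q, rfl⟩ := hG.exists_pt ht.1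
  have h1 := hh q ht.1 ht.2
  have h2 := hf.maps q ht.2
  refine ⟨by rw [← h1]; exact h2, fun hp => ?_⟩
  rw [← h1] at hp ⊢
  rw [← hk _ hp h2, hgf q ht.2]

lemma IsGreen.stepD (hG : IsGreen D G) (hf : HMap G f c₁ c₂) (hg : HMap G g c₂ c₁)
    (hgf : ∀ z, G z < c₁ → g (f z) = z) {h k : ℝ → ℝ}
    (hcont : ContinuousOn h (Ioo 0 c₁)) (hh : ∀ q, 0 < G q → G q < c₁ → G (f q) = h (G q))
    (hk : ∀ q, 0 < G q → G q < c₂ → G (g q) = k (G q)) {t : ℝ} (ht : t ∈ Ioo 0 c₁) (hpos : 0 < h t) :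
    ∃ n : ℤ, h t = (D.d : ℝ) ^ n * t := by
  have hdn : (D.d : ℝ) ≠ 0 := by have := D.two_le_d; linarith
  have hdp : ∀ n, (D.d : ℝ) ^ n ≠ 0 := fun n => pow_ne_zero n hdn
  have hdc : ∀ n, (D.d : ℂ) ^ n ≠ 0 := fun n => pow_ne_zero n D.d_ne
  obtain ⟨n, b, β, e, he, H1⟩ := hG.local_affine hf hh ht hpos
  obtain ⟨hlt, hkh⟩ := hG.kh hf hgf hh hk ht
  have hkh := hkh hpos
  obtain ⟨n', b', β', e', he', H2⟩ := hG.local_affine hg hk ⟨hpos, hlt⟩ (by rw [hkh]; exact ht.1)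
  -- divisibility
  have hev : ∀ᶠ s in 𝓝 t, s ∈ Ioo 0 c₁ ∧ |s - t| < e ∧ |h s - h t| < e' ∧ 0 < h s := by
    have hca : ContinuousAt h t := hcont.continuousAt (Ioo_mem_nhds ht.1 ht.2)
    have a1 : ∀ᶠ s in 𝓝 t, |s - t| < e := Metric.ball_mem_nhds t he
    have a2 : ∀ᶠ s in 𝓝 t, |h s - h t| < e' := hca.eventually (Metric.ball_mem_nhds (h t) he')
    filter_upwards [Ioo_mem_nhds ht.1 ht.2, a1, a2, hca.eventually (lt_mem_nhds hpos)] with s b1 b2 b3 b4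
    exact ⟨b1, b2, b3, b4⟩
  have hid : ∀ s, s ∈ Ioo 0 c₁ ∧ |s - t| < e ∧ |h s - h t| < e' ∧ 0 < h s →
      s = n' / (D.d : ℝ) ^ b' * (n / (D.d : ℝ) ^ b * s + β.re) + β'.re := by
    rintro s ⟨s1, s2, s3, s4⟩
    have g1 := (H1 (s : ℂ) (by simpa using s2)).2.2.1
    have g2 := (H2 ((h s : ℝ) : ℂ) (by simpa using s3)).2.2.1
    simp only [Complex.ofReal_re] at g1 g2
    rw [(hG.kh hf hgf hh hk s1).2 s4, g1] at g2
    exact g2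
  have hprod : (n : ℝ) * n' = (D.d : ℝ) ^ (b + b') := by
    obtain ⟨δ, hδ, hb⟩ := Metric.eventually_nhds_iff_ball.mp hev
    have i1 := hid t (hb t (Metric.mem_ball_self hδ))
    have i2 := hid (t + δ / 2) (hb _ (by
      rw [Metric.mem_ball, Real.dist_eq, add_sub_cancel_left, abs_of_pos (by positivity)]; linarith))
    have i3 : (δ / 2) * 1 = (δ / 2) * (n' / (D.d : ℝ) ^ b' * (n / (D.d : ℝ) ^ b)) := by linear_combination i2 - i1
    have i4 := mul_left_cancel₀ (by positivity) i3
    have := hdp b; have := hdp b'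
    rw [pow_add]
    field_simp at i4
    linarith
  have hprodZ : n * n' = (D.d : ℤ) ^ (b + b') := by exact_mod_cast hprod
  have hn0 : n ≠ 0 := by
    rintro rfl
    rw [zero_mul] at hprodZ
    exact d_int_pow_ne _ hprodZ.symm
  -- shrink and rescale
  set α : ℝ := n / (D.d : ℝ) ^ b with hα
  have hαc : (α : ℂ) = n / (D.d : ℂ) ^ b := by rw [hα]; push_cast; rfl
  have ht' : h t = α * t + β.re := by
    have := (H1 (t : ℂ) (by simpa using he)).2.2.1
    simpa using this
  obtain ⟨e1, he1, hsm⟩ : ∃ e1 > 0, e1 ≤ e ∧ ∀ s, |s - t| < e1 → t / 2 < s ∧ h t / 2 < α * s + β.re := by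
    have hc : Continuous (fun s : ℝ => α * s + β.re) := by fun_prop
    have a1 : ∀ᶠ s in 𝓝 t, t / 2 < s := lt_mem_nhds (by linarith [ht.1])
    have a2 : ∀ᶠ s in 𝓝 t, h t / 2 < α * s + β.re := hc.continuousAt.eventually (lt_mem_nhds (by show h t / 2 < α * t + β.re; rw [← ht']; linarith))
    obtain ⟨δ, hδ, hb⟩ := Metric.eventually_nhds_iff_ball.mp (a1.and a2)
    exact ⟨min δ e, lt_min hδ he, min_le_right _ _, fun s hs => hb s (hs.trans_le (min_le_left _ _))⟩
  obtain ⟨K1, hK1⟩ := exists_N D (half_pos ht.1)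
  obtain ⟨K2, hK2⟩ := exists_N D (half_pos hpos)
  set K := K1 + K2 with hKdef
  have up : ∀ {a b : ℕ} {x : ℝ}, a ≤ b → 0 < x → D.R0 < (D.d : ℝ) ^ a * x → D.R0 < (D.d : ℝ) ^ b * x := by
    intro a b x hab hx h1
    refine h1.trans_le ?_
    gcongr
    linarith [D.two_le_d]
  have hscale : ∀ w : ℂ, ∃ w0 : ℂ, w = (D.d : ℂ) ^ K * w0 := fun w => ⟨w / (D.d : ℂ) ^ K, by
    rw [mul_div_cancel₀ _ (hdc K)]⟩
  have hstrip : ∀ w0 : ℂ, |((D.d : ℂ) ^ K * w0).re - (D.d : ℝ) ^ K * t| < (D.d : ℝ) ^ K * e1 → |w0.re - t| < e1 := by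
    intro w0 hw
    rw [re_dpow, ← mul_sub, abs_mul, abs_of_pos (D.dpow_pos K)] at hw
    exact lt_of_mul_lt_mul_left hw (D.dpow_pos K).le
  have hw' : ∀ w0 : ℂ, (n : ℂ) * ((D.d : ℂ) ^ K * w0) + (D.d : ℂ) ^ (K + b) * β = (D.d : ℂ) ^ (K + b) * (n / (D.d : ℂ) ^ b * w0 + β) := by
    intro w0
    have := hdc b
    rw [pow_add]; field_simp; ring
  have hMain : MainHyp D (fun q => D.H^[K + b] (f (D.Hi^[K] q))) {q | G (D.Hi^[K] q) < c₁} ((D.d : ℝ) ^ K * t)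
      ((D.d : ℝ) ^ K * e1) n ((D.d : ℂ) ^ (K + b) * β) := by
    refine ⟨mul_pos (D.dpow_pos K) he1, ?_, ?_, ?_, ?_, ?_, ?_⟩
    · exact (D.differentiable_iter (K + b)).comp_differentiableOn
        (hf.diff.comp (D.differentiable_iteri K).differentiableOn (fun q hq => hq))
    · intro w hw
      obtain ⟨w0, rfl⟩ := hscale w
      have h1 := (hsm.2 _ (hstrip w0 hw)).1
      rw [re_dpow]
      exact up (a := K1) (by omega) (by linarith [ht.1]) (hK1.trans (by have := D.dpow_pos K1; gcongr))
    · intro w hw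
      obtain ⟨w0, rfl⟩ := hscale w
      have h1 := (hsm.2 _ (hstrip w0 hw)).2
      rw [hw', re_dpow, ← hαc, Complex.add_re, Complex.re_ofReal_mul]
      exact up (a := K2) (by omega) (by linarith) (hK2.trans (by have := D.dpow_pos K2; gcongr))
    · intro w hw q hq
      obtain ⟨w0, rfl⟩ := hscale w
      have := H1 w0 ((hstrip w0 hw).trans_le hsm.1)
      change G _ < c₁
      rw [hG.G_L (D.L_iteri K hq)]; exact this.2.1
    · intro w hw q hq
      obtain ⟨w0, rfl⟩ := hscale w
      have := H1 w0 ((hstrip w0 hw).trans_le hsm.1)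
      rw [hw']
      exact (D.L_iter (K + b)).mpr (this.2.2.2 (D.L_iteri K hq))
    · intro w hw q hq q' hq' heq
      obtain ⟨w0, rfl⟩ := hscale w
      have := H1 w0 ((hstrip w0 hw).trans_le hsm.1)
      have a1 := congrArg (D.Hi^[K + b]) heq
      simp only [D.Hi_H_iter] at a1
      have a2 := congrArg g a1
      rw [hgf _ (by rw [hG.G_L (D.L_iteri K hq)]; exact this.2.1),
        hgf _ (by rw [hG.G_L (D.L_iteri K hq')]; exact this.2.1)] at a2
      have a3 := congrArg (D.H^[K]) a2
      simpa only [D.H_Hi_iter] using a3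
  obtain ⟨k', hk', hre⟩ := hMain.main hn0 ⟨n', hprodZ.symm⟩
  rw [re_dpow] at hre
  have hre' : β.re = 0 := (mul_eq_zero.mp hre).resolve_left (hdp _)
  refine ⟨(k' : ℤ) - b, ?_⟩
  rw [ht', hre', add_zero, hα, hk', zpow_sub₀ hdn]
  push_cast
  rw [zpow_natCast, zpow_natCast]

/-- `f` does not collapse everything to the zero level -/
lemma IsGreen.not_zero (hG : IsGreen D G) (hc₁ : 0 < c₁) (hc₂ : 0 < c₂) (hf : HMap G f c₁ c₂) (hg : HMap G g c₂ c₁)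
    (hfg : ∀ z, G z < c₂ → f (g z) = z) (h0 : ∀ q, 0 < G q → G q < c₁ → G (f q) = 0) : False := by
  obtain ⟨q, hq⟩ := hG.exists_pt (half_pos hc₂)
  have hq2 : G q < c₂ := by rw [hq]; linarith
  have hp1 := hg.maps q hq2
  have hp2 : 0 < G (f (g q)) := by rw [hfg q hq2, hq]; linarith
  rcases hxy : g q with ⟨x, y⟩
  rw [hxy] at hp1 hp2
  have hz : ∀ y : ℂ, G (x, y) < c₁ → 0 < G (f (x, y)) → G (x, y) = 0 := by
    intro y h1 h2
    by_contra hne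
    have := h0 (x, y) (lt_of_le_of_ne (hG.nonneg _) (Ne.symm hne)) h1
    linarith
  have hcs : Continuous (fun y : ℂ => G (x, y)) := hG.cont.comp (by fun_prop)
  set Kc : Set ℂ := {y | G (x, y) ≤ c₁ / 2} with hKc
  have hclosed : IsClosed Kc := isClosed_le hcs continuous_const
  have hbdd : Kc ⊆ Metric.closedBall 0 (max (max ‖x‖ D.R) (Real.exp (c₁ / 2) + 4 * D.C)) := by
    intro y hy
    rw [mem_closedBall_zero_iff]
    by_contra hcon
    push Not at hcon
    have b1 : ‖x‖ < ‖y‖ := lt_of_le_of_lt ((le_max_left _ _).trans (le_max_left _ _)) hcon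
    have b2 : D.R < ‖y‖ := lt_of_le_of_lt ((le_max_right _ _).trans (le_max_left _ _)) hcon
    have b3 : Real.exp (c₁ / 2) + 4 * D.C < ‖y‖ := lt_of_le_of_lt (le_max_right _ _) hcon
    have hV : (x, y) ∈ D.V := ⟨b1, b2⟩
    have hy' : G (x, y) ≤ c₁ / 2 := hy
    rw [hG.G_V hV, Real.log_le_iff_le_exp (by linarith [phi_norm hV])] at hy'
    have h3 := phi_near hV
    have h4 := norm_sub_norm_le y (D.phi (x, y))
    simp only at h3
    linarith
  have hcomp : IsCompact Kc := (isCompact_closedBall _ _).of_isClosed_subset hclosed hbdd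
  set S : Set ℂ := {y | G (x, y) < c₁} with hS
  have hSo : IsOpen S := isOpen_lt hcs continuous_const
  have hKS : Kc ⊆ S := fun y hy => by
    have : G (x, y) ≤ c₁ / 2 := hy
    change G (x, y) < c₁; linarith
  have hcd : DifferentiableOn ℂ (fun y => f (x, y)) S :=
    hf.diff.comp (by fun_prop) (fun y hy => hy)
  have hvc : ContinuousOn (fun y => G (f (x, y))) S := hG.cont.comp_continuousOn hcd.continuousOn
  have hyK : y ∈ Kc := by
    change G (x, y) ≤ c₁ / 2
    rw [hz y hp1 hp2]; linarith
  obtain ⟨y1, hy1, hmax⟩ := hcomp.exists_isMaxOn ⟨y, hyK⟩ (hvc.mono hKS)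
  set μ := G (f (x, y1)) with hμ
  have hμ0 : 0 < μ := hp2.trans_le (hmax hyK)
  have hclopen : IsClopen {y | y ∈ Kc ∧ G (f (x, y)) = μ} := by
    constructor
    · have := (hvc.mono hKS).preimage_isClosed_of_isClosed hclosed (isClosed_singleton (x := μ))
      exact this
    · rw [isOpen_iff_mem_nhds]
      rintro y2 ⟨hy2, hv2⟩
      have g0 : G (x, y2) = 0 := hz y2 (hKS hy2) (by rw [hv2]; exact hμ0)
      have hev : ∀ᶠ z in 𝓝 y2, z ∈ Kc := by
        have : ∀ᶠ z in 𝓝 y2, G (x, z) < c₁ / 2 := hcs.continuousAt.eventually (gt_mem_nhds (by show G (x, y2) < c₁ / 2; rw [g0]; linarith))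
        filter_upwards [this] with z hz using hz.le
      have hlm : IsLocalMax (fun y => G (f (x, y))) y2 := by
        filter_upwards [hev] with z hz
        rw [hv2]; exact hmax hz
      have := hG.localmax hSo hcd (hKS hy2) (by rw [hv2]; exact hμ0) (v := fun y => G (f (x, y))) (l := fun _ => 0)
        (by filter_upwards with z; fun_prop) (by filter_upwards with z; simp) hlm
      filter_upwards [hev, this] with z z1 z2
      exact ⟨z1, z2.trans hv2⟩
  have huniv := hclopen.eq_univ ⟨y1, hy1, rfl⟩
  have : Kc = univ := by
    apply eq_univ_of_forall
    intro z
    have : z ∈ {y | y ∈ Kc ∧ G (f (x, y)) = μ} := by rw [huniv]; trivial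
    exact this.1
  rw [this] at hcomp
  exact noncompact_univ ℂ hcomp

lemma IsGreen.stepE (hG : IsGreen D G) (hc₁ : 0 < c₁) (hc₂ : 0 < c₂) (hf : HMap G f c₁ c₂) (hg : HMap G g c₂ c₁)
    (hgf : ∀ z, G z < c₁ → g (f z) = z) (hfg : ∀ z, G z < c₂ → f (g z) = z) :
    ∃ n : ℤ, ∀ q, 0 < G q → G q < c₁ → G (f q) = (D.d : ℝ) ^ n * G q := by
  obtain ⟨h, hcont, hh⟩ := hG.exists_h hf
  obtain ⟨k, -, hk⟩ := hG.exists_h hg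
  have hnn : ∀ t ∈ Ioo 0 c₁, 0 ≤ h t := by
    intro t ht
    obtain ⟨q, rfl⟩ := hG.exists_pt ht.1
    rw [← hh q ht.1 ht.2]; exact hG.nonneg _
  set φ : ℝ → ℝ := fun t => h t / t with hφ
  have hφc : ContinuousOn φ (Ioo 0 c₁) := hcont.div continuousOn_id (fun t ht => ht.1.ne')
  set Cs : Set ℝ := insert 0 (range (fun n : ℤ => (D.d : ℝ) ^ n)) with hCs
  have hCc : Cs.Countable := (countable_range _).insert 0
  have himg : φ '' Ioo 0 c₁ ⊆ Cs := by
    rintro _ ⟨t, ht, rfl⟩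
    rcases (hnn t ht).eq_or_lt with h0 | h0
    · left; simp [hφ, ← h0]
    · right
      obtain ⟨n, hn⟩ := hG.stepD hf hg hgf hcont hh hk ht h0
      refine ⟨n, ?_⟩
      simp only [hφ]
      rw [hn, mul_div_cancel_right₀ _ ht.1.ne']
  have hsub := hCc.isTotallyDisconnected _ himg (isPreconnected_Ioo.image φ hφc)
  have hmid : c₁ / 2 ∈ Ioo 0 c₁ := ⟨by linarith, by linarith⟩
  have hconst : ∀ t ∈ Ioo 0 c₁, h t = φ (c₁ / 2) * t := by
    intro t ht
    rw [← hsub ⟨t, ht, rfl⟩ ⟨c₁ / 2, hmid, rfl⟩]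
    simp only [hφ]
    rw [div_mul_cancel₀ _ ht.1.ne']
  rcases himg ⟨c₁ / 2, hmid, rfl⟩ with h0 | ⟨n, hn⟩
  · exfalso
    refine hG.not_zero hc₁ hc₂ hf hg hfg (fun q q1 q2 => ?_)
    rw [hh q q1 q2, hconst _ ⟨q1, q2⟩, h0, zero_mul]
  · refine ⟨n, fun q q1 q2 => ?_⟩
    rw [hh q q1 q2, hconst _ ⟨q1, q2⟩, ← hn]

lemma IsGreen.le_of_scale (hG : IsGreen D G) (hc₁ : 0 < c₁) (hf : HMap G f c₁ c₂) {n : ℤ}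
    (hn : ∀ q, 0 < G q → G q < c₁ → G (f q) = (D.d : ℝ) ^ n * G q) : (D.d : ℝ) ^ n * c₁ ≤ c₂ := by
  have hd0 : (0 : ℝ) < D.d := by have := D.two_le_d; linarith
  have hp : (0 : ℝ) < (D.d : ℝ) ^ n := zpow_pos hd0 n
  by_contra! hcon
  have h1 : c₂ / (D.d : ℝ) ^ n < c₁ := by rw [div_lt_iff₀ hp]; linarith
  obtain ⟨t, ht1, ht2⟩ := exists_between (max_lt h1 hc₁)
  have ht0 : 0 < t := (le_max_right _ _).trans_lt ht1
  obtain ⟨q, rfl⟩ := hG.exists_pt ht0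
  have h3 := hf.maps q ht2
  rw [hn q ht0 ht2] at h3
  have h4 := (le_max_left _ _).trans_lt ht1
  rw [div_lt_iff₀ hp] at h4
  linarith

theorem IsGreen.final (hG : IsGreen D G) (hc₁ : 0 < c₁) (hc₂ : 0 < c₂) (hf : HMap G f c₁ c₂) (hg : HMap G g c₂ c₁)
    (hgf : ∀ z, G z < c₁ → g (f z) = z) (hfg : ∀ z, G z < c₂ → f (g z) = z) :
    ∃ n : ℤ, c₁ = c₂ * (D.d : ℝ) ^ n := by
  have hd0 : (0 : ℝ) < D.d := by have := D.two_le_d; linarith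
  obtain ⟨n, hn⟩ := hG.stepE hc₁ hc₂ hf hg hgf hfg
  obtain ⟨n', hn'⟩ := hG.stepE hc₂ hc₁ hg hf hfg hgf
  have h1 := hG.le_of_scale hc₁ hf hn
  have h2 := hG.le_of_scale hc₂ hg hn'
  have hp : (0 : ℝ) < (D.d : ℝ) ^ n := zpow_pos hd0 n
  have hp' : (0 : ℝ) < (D.d : ℝ) ^ n' := zpow_pos hd0 n'
  obtain ⟨q, hq⟩ := hG.exists_pt (half_pos hc₁)
  have q1 : 0 < G q := by rw [hq]; linarith
  have q2 : G q < c₁ := by rw [hq]; linarith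
  have h3 := hn q q1 q2
  have h4 := hn' (f q) (by rw [h3]; positivity) (hf.maps q q2)
  rw [hgf q q2, h3, ← mul_assoc] at h4
  have h5 : (D.d : ℝ) ^ n' * (D.d : ℝ) ^ n = 1 := by
    have : ((D.d : ℝ) ^ n' * (D.d : ℝ) ^ n) * G q = 1 * G q := by linarith
    exact mul_right_cancel₀ q1.ne' this
  refine ⟨n', le_antisymm ?_ (by linarith)⟩
  calc c₁ = (D.d : ℝ) ^ n' * ((D.d : ℝ) ^ n * c₁) := by rw [← mul_assoc, h5, one_mul]
    _ ≤ (D.d : ℝ) ^ n' * c₂ := by gcongr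
    _ = _ := mul_comm _ _

end HD

/-- Let `c₁, c₂ > 0`. There exists a biholomorphism from `Ω_{c₁}` onto
`Ω_{c₂}` if and only if `c₁ = c₂·dⁿ` for some integer `n ∈ ℤ`. -/
theorem stmt_16 (d : ℕ) (hd : 2 ≤ d) (a : ℂ) (ha : a ≠ 0)
    (p : Polynomial ℂ) (hpm : p.Monic) (hpd : p.natDegree = d)
    (hpc : p.coeff (d - 1) = 0)
    (H : ℂ × ℂ → ℂ × ℂ) (hH : ∀ z : ℂ × ℂ, H z = (z.2, p.eval z.2 - a * z.1))
    (G : ℂ × ℂ → ℝ) (hGcont : Continuous G) (hGnonneg : ∀ z, 0 ≤ G z)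
    (hGlim : ∀ z : ℂ × ℂ,
      Tendsto (fun n : ℕ => Real.log (max ‖H^[n] z‖ 1) / (d : ℝ) ^ n) atTop (𝓝 (G z)))
    (hGH : ∀ z : ℂ × ℂ, G (H z) = d * G z)
    (c₁ c₂ : ℝ) (hc₁ : 0 < c₁) (hc₂ : 0 < c₂) :
    (∃ f g : ℂ × ℂ → ℂ × ℂ,
        IsBiholoOn f g {z : ℂ × ℂ | G z < c₁} {z : ℂ × ℂ | G z < c₂}) ↔
      ∃ n : ℤ, c₁ = c₂ * (d : ℝ) ^ n := by
  let D : HD := ⟨d, hd, a, ha, p, hpm, hpd⟩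
  have hHD : H = D.H := funext hH
  subst hHD
  have hG : HD.IsGreen D G := ⟨hGcont, hGnonneg, hGlim, hGH⟩
  have hdpos : ∀ k : ℕ, (0 : ℝ) < (d : ℝ) ^ k := fun k => D.dpow_pos k
  have hit : ∀ (k : ℕ) z, G (D.H^[k] z) = (d : ℝ) ^ k * G z := fun k z => hG.iter k z
  have hiti : ∀ (k : ℕ) z, G z = (d : ℝ) ^ k * G (D.Hi^[k] z) := fun k z => by
    rw [← hit, D.H_Hi_iter]
  constructor
  · rintro ⟨f, g, h1, h2, h3, h4, h5, h6⟩
    exact hG.final hc₁ hc₂ ⟨h1, fun z hz => h3 hz⟩ ⟨h2, fun z hz => h4 hz⟩ (fun z hz => h5 z hz)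
      (fun z hz => h6 z hz)
  · rintro ⟨n, hn⟩
    obtain ⟨k, rfl | rfl⟩ := n.eq_nat_or_neg
    · rw [zpow_natCast] at hn
      refine ⟨D.Hi^[k], D.H^[k], (D.differentiable_iteri k).differentiableOn,
        (D.differentiable_iter k).differentiableOn, fun z hz => ?_, fun z hz => ?_,
        fun z _ => D.H_Hi_iter k z, fun z _ => D.Hi_H_iter k z⟩
      · have hz : G z < c₁ := hz
        rw [hiti k z, hn, mul_comm c₂] at hz
        exact lt_of_mul_lt_mul_left hz (hdpos k).le
      · have hz : G z < c₂ := hz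
        change G _ < c₁
        rw [hit, hn, mul_comm c₂]
        exact mul_lt_mul_of_pos_left hz (hdpos k)
    · rw [zpow_neg, zpow_natCast] at hn
      have hn : c₂ = (d : ℝ) ^ k * c₁ := by
        have := (hdpos k).ne'
        rw [hn]; field_simp
      refine ⟨D.H^[k], D.Hi^[k], (D.differentiable_iter k).differentiableOn,
        (D.differentiable_iteri k).differentiableOn, fun z hz => ?_, fun z hz => ?_,
        fun z _ => D.Hi_H_iter k z, fun z _ => D.H_Hi_iter k z⟩
      · have hz : G z < c₁ := hz
        change G _ < c₂
        rw [hit, hn]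
        exact mul_lt_mul_of_pos_left hz (hdpos k)
      · have hz : G z < c₂ := hz
        rw [hiti k z, hn] at hz
        exact lt_of_mul_lt_mul_left hz (hdpos k).le
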